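/- arXiv:math/0703808 — 2 statements merged into one kernel-verified Lean document; each statement's English description precedes it below -/
import Mathlib

section
/- Let N ≥ 2 and 1 < p < N*, where N* = (N+2)/(N−2) if N ≥ 3 and N* = ∞ if N = 2. For every Λ > 0 there exists a constant C = C(N,p,Λ) > 0, depending only on N, p and Λ, such that every non-constant positive C² solution v of −Δ_{S^N} v = v^p − λ v on S^N with λ ≤ Λ satisfies 1/C ≤ v(θ) ≤ C for all θ ∈ S^N. -/
open scoped BigOperators

/-- The Euclidean Laplacian of `u : ℝᵐ → ℝ` at `x`, as the sum of the pure second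
derivatives in the standard coordinate directions. -/
noncomputable def eLaplacian {m : ℕ} (u : EuclideanSpace ℝ (Fin m) → ℝ)
    (x : EuclideanSpace ℝ (Fin m)) : ℝ :=
  ∑ i : Fin m, iteratedFDeriv ℝ 2 u x ![EuclideanSpace.single i 1, EuclideanSpace.single i 1]

/-- The Laplace–Beltrami operator on the unit sphere: apply the Euclidean Laplacian to the
degree-zero homogeneous extension `x ↦ v (x/|x|)` and evaluate at a point of the sphere. -/
noncomputable def sphLaplacian {m : ℕ} (v : EuclideanSpace ℝ (Fin m) → ℝ)
    (θ : EuclideanSpace ℝ (Fin m)) : ℝ :=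
  eLaplacian (fun x => v (‖x‖⁻¹ • x)) θ

section

open Filter Topology

/-- `f` has, at `x`, gradient `g` and Laplacian `L`: it is differentiable near `x` and its gradient
field is differentiable at `x`, with trace `L`. -/
def HasJet {m : ℕ} (f : EuclideanSpace ℝ (Fin m) → ℝ) (x g : EuclideanSpace ℝ (Fin m)) (L : ℝ) :
    Prop :=
  ∃ (G : EuclideanSpace ℝ (Fin m) → EuclideanSpace ℝ (Fin m))
    (T : EuclideanSpace ℝ (Fin m) →L[ℝ] EuclideanSpace ℝ (Fin m)),
    (∀ᶠ y in 𝓝 x, HasFDerivAt f (innerSL ℝ (G y)) y) ∧ HasFDerivAt G T x ∧ G x = g ∧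
      ∑ i, T (EuclideanSpace.single i 1) i = L

namespace HasJet

variable {m : ℕ} {f f₁ f₂ : EuclideanSpace ℝ (Fin m) → ℝ} {x g g₁ g₂ : EuclideanSpace ℝ (Fin m)}
  {L L₁ L₂ : ℝ}

theorem hasFDerivAt (h : HasJet f x g L) : HasFDerivAt f (innerSL ℝ g) x := by
  obtain ⟨G, T, h1, -, rfl, -⟩ := h
  exact h1.self_of_nhds

theorem const (c : ℝ) (x : EuclideanSpace ℝ (Fin m)) : HasJet (fun _ => c) x 0 0 :=
  ⟨0, 0, Eventually.of_forall fun y => by simpa using hasFDerivAt_const c y,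
    hasFDerivAt_const 0 x, rfl, by simp⟩

theorem add (h₁ : HasJet f₁ x g₁ L₁) (h₂ : HasJet f₂ x g₂ L₂) :
    HasJet (fun y => f₁ y + f₂ y) x (g₁ + g₂) (L₁ + L₂) := by
  obtain ⟨G₁, T₁, a1, b1, rfl, rfl⟩ := h₁
  obtain ⟨G₂, T₂, a2, b2, rfl, rfl⟩ := h₂
  refine ⟨fun y => G₁ y + G₂ y, T₁ + T₂, ?_, b1.add b2, rfl, ?_⟩
  · filter_upwards [a1, a2] with y k1 k2
    exact (k1.fun_add k2).congr_fderiv (by simp)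
  · simp [Finset.sum_add_distrib]

theorem mul (h₁ : HasJet f₁ x g₁ L₁) (h₂ : HasJet f₂ x g₂ L₂) :
    HasJet (fun y => f₁ y * f₂ y) x (f₁ x • g₂ + f₂ x • g₁)
      (f₁ x * L₂ + 2 * inner ℝ g₁ g₂ + f₂ x * L₁) := by
  have e1 := h₁.hasFDerivAt
  have e2 := h₂.hasFDerivAt
  obtain ⟨G₁, T₁, a1, b1, rfl, rfl⟩ := h₁
  obtain ⟨G₂, T₂, a2, b2, rfl, rfl⟩ := h₂
  refine ⟨fun y => f₁ y • G₂ y + f₂ y • G₁ y, _, ?_, (e1.smul b2).add (e2.smul b1), rfl, ?_⟩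
  · filter_upwards [a1, a2] with y k1 k2
    exact (k1.fun_mul k2).congr_fderiv (by simp)
  · simp only [PiLp.inner_apply, add_apply, smul_apply,
      ContinuousLinearMap.smulRight_apply, PiLp.add_apply, PiLp.smul_apply, Finset.sum_add_distrib,
      Finset.mul_sum, smul_eq_mul, innerSL_apply_apply]
    simp only [two_mul, ← Finset.sum_add_distrib]
    refine Finset.sum_congr rfl fun i _ => ?_
    simp
    ring

theorem comp {φ φ₁ φ₂ : ℝ → ℝ} (h : HasJet f x g L) (hφ : ∀ t, HasDerivAt φ (φ₁ t) t)
    (hφ₁ : ∀ t, HasDerivAt φ₁ (φ₂ t) t) :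
    HasJet (fun y => φ (f y)) x (φ₁ (f x) • g) (φ₁ (f x) * L + φ₂ (f x) * ‖g‖ ^ 2) := by
  have e := h.hasFDerivAt
  obtain ⟨G, T, a, b, rfl, rfl⟩ := h
  refine ⟨fun y => φ₁ (f y) • G y, _, ?_, ((hφ₁ (f x)).comp_hasFDerivAt x e).smul b, rfl, ?_⟩
  · filter_upwards [a] with y k
    exact ((hφ (f y)).comp_hasFDerivAt y k).congr_fderiv (by simp)
  · simp only [EuclideanSpace.norm_sq_eq, add_apply,
      smul_apply, ContinuousLinearMap.smulRight_apply, PiLp.add_apply,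
      PiLp.smul_apply, Finset.sum_add_distrib, Finset.mul_sum, smul_eq_mul, innerSL_apply_apply,
      EuclideanSpace.inner_single_right]
    simp only [← Finset.sum_add_distrib]
    refine Finset.sum_congr rfl fun i _ => ?_
    simp
    ring

/-- Jets transform naturally under the affine maps `y ↦ c • y + z`. -/
theorem comp_affine {c : ℝ} {z : EuclideanSpace ℝ (Fin m)} (h : HasJet f (c • x + z) g L) :
    HasJet (fun y => f (c • y + z)) x (c • g) (c ^ 2 * L) := by
  obtain ⟨G, T, a, b, rfl, rfl⟩ := h
  have hA (y : EuclideanSpace ℝ (Fin m)) : HasFDerivAt (fun y => c • y + z)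
      (c • ContinuousLinearMap.id ℝ (EuclideanSpace ℝ (Fin m))) y :=
    ((hasFDerivAt_id y).const_smul c).add_const z
  refine ⟨fun y => c • G (c • y + z), _, ?_, (b.comp x (hA x)).const_smul c, rfl, ?_⟩
  · have hc : Tendsto (fun y => c • y + z) (𝓝 x) (𝓝 (c • x + z)) := (hA x).continuousAt
    filter_upwards [hc.eventually a] with y k
    refine (k.comp y (hA y)).congr_fderiv ?_
    ext w
    simp
  · simp [Finset.mul_sum]
    refine Finset.sum_congr rfl fun i _ => ?_
    ring

theorem unique (h₁ : HasJet f x g₁ L₁) (h₂ : HasJet f x g₂ L₂) : g₁ = g₂ ∧ L₁ = L₂ := by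
  obtain ⟨G₁, T₁, a1, b1, rfl, rfl⟩ := h₁
  obtain ⟨G₂, T₂, a2, b2, rfl, rfl⟩ := h₂
  have e : G₁ =ᶠ[𝓝 x] G₂ := by
    filter_upwards [a1, a2] with y k1 k2
    exact ext_inner_right ℝ fun w => by simpa using DFunLike.congr_fun (k1.unique k2) w
  refine ⟨e.self_of_nhds, ?_⟩
  rw [b1.unique (b2.congr_of_eventuallyEq e)]

theorem congr (h : HasJet f₁ x g L) (e : f₂ =ᶠ[𝓝 x] f₁) : HasJet f₂ x g L := by
  obtain ⟨G, T, a, b, hg, hL⟩ := h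
  refine ⟨G, T, ?_, b, hg, hL⟩
  filter_upwards [a, e.eventuallyEq_nhds] with y k1 k2
  exact k1.congr_of_eventuallyEq k2

theorem norm_sub_sq (z x : EuclideanSpace ℝ (Fin m)) :
    HasJet (fun y => ‖y - z‖ ^ 2) x ((2 : ℝ) • (x - z)) (2 * m) := by
  refine ⟨fun y => (2 : ℝ) • (y - z), (2 : ℝ) • ContinuousLinearMap.id ℝ _, ?_,
    ((hasFDerivAt_id x).sub_const z).const_smul (2 : ℝ), rfl, ?_⟩
  · refine Eventually.of_forall fun y => ?_
    refine ((hasFDerivAt_id y).sub_const z).norm_sq.congr_fderiv ?_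
    ext w
    simp
  · simp [mul_comm]

/-- The second-derivative test at a local maximum. -/
theorem of_isLocalMax (h : HasJet f x g L) (hx : IsLocalMax f x) : g = 0 ∧ L ≤ 0 := by
  have hg : g = 0 := by
    have := hx.hasFDerivAt_eq_zero h.hasFDerivAt
    simpa using DFunLike.congr_fun this g
  refine ⟨hg, ?_⟩
  obtain ⟨G, T, a, b, rfl, rfl⟩ := h
  refine Finset.sum_nonpos fun i _ => ?_
  by_contra! hpos
  set e : EuclideanSpace ℝ (Fin m) := EuclideanSpace.single i 1 with he
  have hl (t : ℝ) : HasDerivAt (fun t : ℝ => x + t • e) e t := by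
    simpa using ((hasDerivAt_id t).smul_const e).const_add x
  have hl0 : Tendsto (fun t : ℝ => x + t • e) (𝓝 0) (𝓝 x) := by
    simpa using (hl 0).continuousAt.tendsto
  have d1 : ∀ᶠ t in 𝓝 (0 : ℝ), HasDerivAt (fun t : ℝ => f (x + t • e)) (G (x + t • e) i) t := by
    filter_upwards [hl0.eventually a] with t k
    have := k.comp_hasDerivAt t (hl t)
    exact this.congr_deriv (by simp [he, EuclideanSpace.inner_single_right])
  have d1' : deriv (fun t : ℝ => f (x + t • e)) =ᶠ[𝓝 0] fun t => G (x + t • e) i := by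
    filter_upwards [d1] with t k using k.deriv
  have d2 : HasDerivAt (fun t : ℝ => G (x + t • e) i) (T e i) 0 := by
    have b' : HasFDerivAt G T (x + (0 : ℝ) • e) := by simpa using b
    have := b'.comp_hasDerivAt (0 : ℝ) (hl 0)
    exact ((EuclideanSpace.proj i : EuclideanSpace ℝ (Fin m) →L[ℝ] ℝ).hasFDerivAt).comp_hasDerivAt
      (0 : ℝ) this
  have dd : deriv (deriv fun t : ℝ => f (x + t • e)) 0 = T e i := by
    rw [d1'.deriv_eq, d2.deriv]
  have hmin : IsLocalMin (fun t : ℝ => f (x + t • e)) 0 := by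
    refine isLocalMin_of_deriv_deriv_pos (by rw [dd]; exact hpos) ?_
      d1.self_of_nhds.continuousAt
    rw [d1'.self_of_nhds]
    simp [hg]
  have hmax : IsLocalMax (fun t : ℝ => f (x + t • e)) 0 := by
    have : ∀ᶠ t in 𝓝 (0 : ℝ), f (x + t • e) ≤ f x := hl0.eventually hx
    simpa [IsLocalMax, IsMaxFilter] using this
  have hc : (fun t : ℝ => f (x + t • e)) =ᶠ[𝓝 0] fun _ => f (x + (0 : ℝ) • e) := by
    filter_upwards [hmin, hmax] with t k1 k2
    exact le_antisymm k2 k1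
  have := hc.deriv.deriv_eq
  rw [dd] at this
  simp at this
  linarith

end HasJet

/-- `f` is a limit, near `x`, of functions `F τ` (as `τ → 0`) with jets at the points near `x`, whose
gradients and Laplacians converge to `g` and `L` at `x`. -/
def HasWeakJet {m : ℕ} (f : EuclideanSpace ℝ (Fin m) → ℝ) (x g : EuclideanSpace ℝ (Fin m)) (L : ℝ) :
    Prop :=
  ∃ (F : ℝ → EuclideanSpace ℝ (Fin m) → ℝ)
    (G : ℝ → EuclideanSpace ℝ (Fin m) → EuclideanSpace ℝ (Fin m))
    (M : ℝ → EuclideanSpace ℝ (Fin m) → ℝ),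
    (∀ᶠ p in 𝓝[≠] (0 : ℝ) ×ˢ 𝓝 x, HasJet (F p.1) p.2 (G p.1 p.2) (M p.1 p.2)) ∧
    (∀ᶠ y in 𝓝 x, Tendsto (fun p : ℝ × EuclideanSpace ℝ (Fin m) => F p.1 p.2)
      (𝓝[≠] (0 : ℝ) ×ˢ 𝓝 y) (𝓝 (f y))) ∧
    Tendsto (fun p : ℝ × EuclideanSpace ℝ (Fin m) => G p.1 p.2) (𝓝[≠] (0 : ℝ) ×ˢ 𝓝 x) (𝓝 g) ∧
    Tendsto (fun p : ℝ × EuclideanSpace ℝ (Fin m) => M p.1 p.2) (𝓝[≠] (0 : ℝ) ×ˢ 𝓝 x) (𝓝 L)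

namespace HasWeakJet

variable {m : ℕ} {f f₁ f₂ : EuclideanSpace ℝ (Fin m) → ℝ} {x g g₁ g₂ : EuclideanSpace ℝ (Fin m)}
  {L L₁ L₂ : ℝ}

/-- A field of jets with continuous gradient and Laplacian at `x` is a weak jet. -/
theorem of_hasJet {G : EuclideanSpace ℝ (Fin m) → EuclideanSpace ℝ (Fin m)}
    {M : EuclideanSpace ℝ (Fin m) → ℝ} (h : ∀ᶠ y in 𝓝 x, HasJet f y (G y) (M y))
    (hG : ContinuousAt G x) (hM : ContinuousAt M x) : HasWeakJet f x (G x) (M x) := by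
  refine ⟨fun _ => f, fun _ => G, fun _ => M, tendsto_snd.eventually h, ?_,
    hG.tendsto.comp tendsto_snd, hM.tendsto.comp tendsto_snd⟩
  filter_upwards [h] with y k
  exact k.hasFDerivAt.continuousAt.tendsto.comp tendsto_snd

theorem add (h₁ : HasWeakJet f₁ x g₁ L₁) (h₂ : HasWeakJet f₂ x g₂ L₂) :
    HasWeakJet (fun y => f₁ y + f₂ y) x (g₁ + g₂) (L₁ + L₂) := by
  obtain ⟨F₁, G₁, M₁, a₁, b₁, c₁, d₁⟩ := h₁
  obtain ⟨F₂, G₂, M₂, a₂, b₂, c₂, d₂⟩ := h₂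
  refine ⟨fun τ y => F₁ τ y + F₂ τ y, fun τ y => G₁ τ y + G₂ τ y,
    fun τ y => M₁ τ y + M₂ τ y, ?_, ?_, c₁.add c₂, d₁.add d₂⟩
  · filter_upwards [a₁, a₂] with p k₁ k₂ using k₁.add k₂
  · filter_upwards [b₁, b₂] with y k₁ k₂ using k₁.add k₂

theorem mul (h₁ : HasWeakJet f₁ x g₁ L₁) (h₂ : HasWeakJet f₂ x g₂ L₂) :
    HasWeakJet (fun y => f₁ y * f₂ y) x (f₁ x • g₂ + f₂ x • g₁)
      (f₁ x * L₂ + 2 * inner ℝ g₁ g₂ + f₂ x * L₁) := by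
  obtain ⟨F₁, G₁, M₁, a₁, b₁, c₁, d₁⟩ := h₁
  obtain ⟨F₂, G₂, M₂, a₂, b₂, c₂, d₂⟩ := h₂
  have e₁ := b₁.self_of_nhds
  have e₂ := b₂.self_of_nhds
  refine ⟨fun τ y => F₁ τ y * F₂ τ y, fun τ y => F₁ τ y • G₂ τ y + F₂ τ y • G₁ τ y,
    fun τ y => F₁ τ y * M₂ τ y + 2 * inner ℝ (G₁ τ y) (G₂ τ y) + F₂ τ y * M₁ τ y, ?_, ?_, (e₁.smul c₂).add (e₂.smul c₁),
    ((e₁.mul d₂).add ((c₁.inner c₂).const_mul 2)).add (e₂.mul d₁)⟩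
  · filter_upwards [a₁, a₂] with p k₁ k₂ using k₁.mul k₂
  · filter_upwards [b₁, b₂] with y k₁ k₂ using k₁.mul k₂

theorem const (c : ℝ) (x : EuclideanSpace ℝ (Fin m)) : HasWeakJet (fun _ => c) x 0 0 :=
  of_hasJet (G := fun _ => 0) (M := fun _ => 0) (Eventually.of_forall fun y => HasJet.const c y)
    continuousAt_const continuousAt_const

theorem norm_sq (x : EuclideanSpace ℝ (Fin m)) :
    HasWeakJet (fun y => ‖y‖ ^ 2) x ((2 : ℝ) • x) (2 * m) :=
  of_hasJet (G := fun y => (2 : ℝ) • y) (M := fun _ => 2 * m)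
    (Eventually.of_forall fun y => by simpa using HasJet.norm_sub_sq 0 y)
    (by fun_prop) continuousAt_const

theorem sum {ι : Type*} {s : Finset ι} {f : ι → EuclideanSpace ℝ (Fin m) → ℝ}
    {g : ι → EuclideanSpace ℝ (Fin m)} {L : ι → ℝ} (h : ∀ i ∈ s, HasWeakJet (f i) x (g i) (L i)) :
    HasWeakJet (fun y => ∑ i ∈ s, f i y) x (∑ i ∈ s, g i) (∑ i ∈ s, L i) := by
  classical
  induction s using Finset.induction_on with
  | empty => simpa using const 0 x
  | insert i s hi ih =>
    simp only [Finset.sum_insert hi]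
    exact (h i (s.mem_insert_self i)).add (ih fun j hj => h j (Finset.mem_insert_of_mem hj))

theorem comp {φ φ₁ φ₂ : ℝ → ℝ} (h : HasWeakJet f x g L) (hφ : ∀ t, HasDerivAt φ (φ₁ t) t)
    (hφ₁ : ∀ t, HasDerivAt φ₁ (φ₂ t) t) (hφ₂ : Continuous φ₂) :
    HasWeakJet (fun y => φ (f y)) x (φ₁ (f x) • g) (φ₁ (f x) * L + φ₂ (f x) * ‖g‖ ^ 2) := by
  obtain ⟨F, G, M, a, b, c, d⟩ := h
  have e := b.self_of_nhds
  have e₁ := (hφ₁ (f x)).continuousAt.tendsto.comp e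
  refine ⟨fun τ y => φ (F τ y), fun τ y => φ₁ (F τ y) • G τ y,
    fun τ y => φ₁ (F τ y) * M τ y + φ₂ (F τ y) * ‖G τ y‖ ^ 2, ?_, ?_, e₁.smul c,
    (e₁.mul d).add ((hφ₂.continuousAt.tendsto.comp e).mul (c.norm.pow 2))⟩
  · filter_upwards [a] with p k using k.comp hφ hφ₁
  · filter_upwards [b] with y k using (hφ (f y)).continuousAt.tendsto.comp k

/-- The maximum principle for weak jets. -/
theorem of_isLocalMax (h : HasWeakJet f x g L) (hx : IsLocalMax f x) : g = 0 ∧ L ≤ 0 := by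
  obtain ⟨F, G, M, a, b, c, d⟩ := h
  suffices key : ∀ δ : ℝ, 0 < δ → g = 0 ∧ L ≤ 2 * m * δ by
    refine ⟨(key 1 one_pos).1, ?_⟩
    have hlim : Tendsto (fun δ : ℝ => 2 * m * δ) (𝓝[>] 0) (𝓝 0) := by
      have : Tendsto (fun δ : ℝ => 2 * m * δ) (𝓝 0) (𝓝 (2 * m * 0)) :=
        (continuous_const.mul continuous_id).tendsto 0
      rw [mul_zero] at this
      exact this.mono_left nhdsWithin_le_nhds
    refine ge_of_tendsto hlim ?_
    filter_upwards [self_mem_nhdsWithin] with δ hδ using (key δ hδ).2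
  intro δ hδ
  obtain ⟨A, hA, B, hB, hAB⟩ := eventually_prod_iff.mp a
  obtain ⟨r, hr, hrU⟩ := Metric.nhds_basis_closedBall.mem_iff.mp (hB.and (b.and hx))
  obtain ⟨τ, hτ⟩ : ∃ τ : ℕ → ℝ, Tendsto τ atTop (𝓝[≠] 0) := exists_seq_tendsto _
  obtain ⟨k₀, hk₀⟩ := eventually_atTop.mp (hτ.eventually hA)
  replace hτ : Tendsto (fun k => τ (k + k₀)) atTop (𝓝[≠] 0) := (tendsto_add_atTop_iff_nat k₀).2 hτ
  set σ : ℕ → ℝ := fun k => τ (k + k₀)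
  have hjet (k : ℕ) (y : EuclideanSpace ℝ (Fin m)) (hy : y ∈ Metric.closedBall x r) :
      HasJet (F (σ k)) y (G (σ k) y) (M (σ k) y) :=
    hAB (hk₀ _ (Nat.le_add_left _ _)) (hrU hy).1
  have hmax (k : ℕ) : ∃ y ∈ Metric.closedBall x r,
      IsMaxOn (fun y => F (σ k) y + -δ * ‖y - x‖ ^ 2) (Metric.closedBall x r) y := by
    refine (isCompact_closedBall x r).exists_isMaxOn ⟨x, Metric.mem_closedBall_self hr.le⟩ ?_
    refine ContinuousOn.add (fun y hy => ?_) (by fun_prop)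
    exact (hjet k y hy).hasFDerivAt.continuousAt.continuousWithinAt
  choose z hz hzmax using hmax
  obtain ⟨y, hy, φ, hφ, hlim⟩ := (isCompact_closedBall x r).tendsto_subseq hz
  have hσ : Tendsto (fun k => σ (φ k)) atTop (𝓝[≠] 0) := hτ.comp hφ.tendsto_atTop
  have hyx : y = x := by
    have t1 : Tendsto (fun k => F (σ (φ k)) (z (φ k)) + -δ * ‖z (φ k) - x‖ ^ 2) atTop
        (𝓝 (f y + -δ * ‖y - x‖ ^ 2)) :=
      ((hrU hy).2.1.comp (hσ.prodMk hlim)).add (((hlim.sub_const x).norm.pow 2).const_mul _)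
    have t2 : Tendsto (fun k => F (σ (φ k)) x + -δ * ‖x - x‖ ^ 2) atTop
        (𝓝 (f x + -δ * ‖x - x‖ ^ 2)) :=
      (b.self_of_nhds.comp (hσ.prodMk tendsto_const_nhds)).add_const _
    have := le_of_tendsto_of_tendsto' t2 t1
      fun k => hzmax (φ k) (Metric.mem_closedBall_self hr.le)
    have hfy : f y ≤ f x := (hrU hy).2.2
    simp only [sub_self, norm_zero] at this
    have h0 : ‖y - x‖ ^ 2 ≤ 0 := by
      by_contra! hc
      nlinarith [mul_pos hδ hc]
    rw [← sub_eq_zero, ← norm_eq_zero]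
    exact pow_eq_zero_iff two_ne_zero |>.mp (le_antisymm h0 (sq_nonneg _))
  subst hyx
  have hloc : ∀ᶠ k in atTop, G (σ (φ k)) (z (φ k)) + (-δ) • (2 : ℝ) • (z (φ k) - y) = 0 ∧
      M (σ (φ k)) (z (φ k)) + -δ * (2 * m) ≤ 0 := by
    filter_upwards [hlim.eventually (Metric.ball_mem_nhds y hr)] with k hk
    have := (hjet (φ k) _ (hz (φ k))).add ((HasJet.const (-δ) _).mul (HasJet.norm_sub_sq y _))
    simpa using this.of_isLocalMax
      ((hzmax (φ k)).isLocalMax (mem_of_superset (Metric.isOpen_ball.mem_nhds hk)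
        Metric.ball_subset_closedBall))
  have hpair := hσ.prodMk hlim
  constructor
  · have t : Tendsto (fun k => G (σ (φ k)) (z (φ k)) + (-δ) • (2 : ℝ) • (z (φ k) - y)) atTop
        (𝓝 (g + (-δ) • (2 : ℝ) • (y - y))) :=
      (c.comp hpair).add (((hlim.sub_const y).const_smul (2 : ℝ)).const_smul (-δ))
    have := tendsto_nhds_unique (t.congr' (hloc.mono fun k hk => hk.1)) tendsto_const_nhds
    simpa using this
  · have t : Tendsto (fun k => M (σ (φ k)) (z (φ k)) + -δ * (2 * m)) atTop
        (𝓝 (L + -δ * (2 * m))) := (d.comp hpair).add_const _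
    have := le_of_tendsto t (hloc.mono fun k hk => hk.2)
    linarith

/-- Partial derivatives of a `C²` function whose Laplacian is strictly differentiable. -/
theorem partial_deriv {G : EuclideanSpace ℝ (Fin m) → EuclideanSpace ℝ (Fin m)}
    {M : EuclideanSpace ℝ (Fin m) → ℝ}
    {T : EuclideanSpace ℝ (Fin m) →L[ℝ] EuclideanSpace ℝ (Fin m)}
    {S : EuclideanSpace ℝ (Fin m) →L[ℝ] ℝ}
    (h : ∀ᶠ y in 𝓝 x, HasJet f y (G y) (M y)) (hf : ∀ᶠ y in 𝓝 x, ContDiffAt ℝ 1 f y)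
    (hG : HasStrictFDerivAt G T x) (hM : HasStrictFDerivAt M S x)
    (e : EuclideanSpace ℝ (Fin m)) :
    HasWeakJet (fun y => inner ℝ (G y) e) x (T e) (S e) := by
  have hpair (y : EuclideanSpace ℝ (Fin m)) : Tendsto
      (fun p : ℝ × EuclideanSpace ℝ (Fin m) => (p.2 + p.1 • e, p.2)) (𝓝[≠] (0 : ℝ) ×ˢ 𝓝 y)
      (𝓝 (y, y)) := by
    have h0 : Tendsto (fun p : ℝ × EuclideanSpace ℝ (Fin m) => (p.2 + p.1 • e, p.2)) (𝓝 (0, y))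
        (𝓝 (y + (0 : ℝ) • e, y)) := by
      refine Continuous.tendsto ?_ (0, y)
      fun_prop
    rw [zero_smul, add_zero] at h0
    refine h0.mono_left ?_
    rw [nhds_prod_eq]
    exact prod_mono_left _ nhdsWithin_le_nhds
  have hne (y : EuclideanSpace ℝ (Fin m)) :
      ∀ᶠ p : ℝ × EuclideanSpace ℝ (Fin m) in 𝓝[≠] (0 : ℝ) ×ˢ 𝓝 y, p.1 ≠ 0 :=
    tendsto_fst.eventually (self_mem_nhdsWithin : {0}ᶜ ∈ 𝓝[≠] (0 : ℝ))
  have quot {V : Type} [NormedAddCommGroup V] [NormedSpace ℝ V] {u : EuclideanSpace ℝ (Fin m) → V}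
      {u' : EuclideanSpace ℝ (Fin m) →L[ℝ] V} {y : EuclideanSpace ℝ (Fin m)}
      (hu : HasStrictFDerivAt u u' y) :
      Tendsto (fun p : ℝ × EuclideanSpace ℝ (Fin m) => p.1⁻¹ • (u (p.2 + p.1 • e) - u p.2))
        (𝓝[≠] (0 : ℝ) ×ˢ 𝓝 y) (𝓝 (u' e)) := by
    have ho := hu.isLittleO.comp_tendsto (hpair y)
    have hb : (fun p : ℝ × EuclideanSpace ℝ (Fin m) => p.1 • e) =O[𝓝[≠] (0 : ℝ) ×ˢ 𝓝 y]
        fun p => p.1 := by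
      refine Asymptotics.IsBigO.of_bound ‖e‖ (Eventually.of_forall fun p => ?_)
      rw [norm_smul, mul_comm]
    have h2 : (fun p : ℝ × EuclideanSpace ℝ (Fin m) =>
        u (p.2 + p.1 • e) - u p.2 - p.1 • u' e) =o[𝓝[≠] (0 : ℝ) ×ˢ 𝓝 y] fun p => p.1 := by
      refine Asymptotics.IsLittleO.trans_isBigO ?_ hb
      simpa [Function.comp_def] using ho
    have h3 : (fun p : ℝ × EuclideanSpace ℝ (Fin m) =>
        p.1⁻¹ • (u (p.2 + p.1 • e) - u p.2 - p.1 • u' e)) =o[𝓝[≠] (0 : ℝ) ×ˢ 𝓝 y]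
          fun _ => (1 : ℝ) := by
      refine ((Asymptotics.isBigO_refl (fun p : ℝ × EuclideanSpace ℝ (Fin m) => p.1⁻¹)
        _).smul_isLittleO h2).congr' EventuallyEq.rfl ?_
      filter_upwards [hne y] with p hp
      simp [hp]
    have h4 := ((Asymptotics.isLittleO_one_iff ℝ).mp h3).add_const (u' e)
    rw [zero_add] at h4
    refine h4.congr' ?_
    filter_upwards [hne y] with p hp
    rw [smul_sub, smul_smul, inv_mul_cancel₀ hp, one_smul, sub_add_cancel]
  refine ⟨fun τ y => τ⁻¹ * (f (y + τ • e) + -1 * f y),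
    fun τ y => τ⁻¹ • (G (y + τ • e) - G y), fun τ y => τ⁻¹ • (M (y + τ • e) - M y), ?_, ?_,
    quot hG, quot hM⟩
  · have h2 := (hpair x).eventually (h.prod_nhds h)
    filter_upwards [h2] with p hp
    have j1 := HasJet.comp_affine (c := 1) (z := p.1 • e) (x := p.2) (by simpa using hp.1)
    have := (HasJet.const p.1⁻¹ p.2).mul (j1.add ((HasJet.const (-1) p.2).mul hp.2))
    simpa [sub_eq_add_neg] using this
  · filter_upwards [h, hf] with y k1 k2
    have s := k2.hasStrictFDerivAt (by norm_num)
    have := quot s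
    rw [(s.hasFDerivAt.unique k1.hasFDerivAt)] at this
    simpa [sub_eq_add_neg] using this

end HasWeakJet

theorem HasJet.eLaplacian_eq {m : ℕ} {f : EuclideanSpace ℝ (Fin m) → ℝ}
    {x g : EuclideanSpace ℝ (Fin m)} {L : ℝ} (h : HasJet f x g L) : eLaplacian f x = L := by
  obtain ⟨G, T, a, b, rfl, rfl⟩ := h
  have e : fderiv ℝ f =ᶠ[𝓝 x] fun y => innerSL ℝ (G y) := a.mono fun y k => k.fderiv
  have d : HasFDerivAt (fun y => innerSL ℝ (G y)) ((innerSL ℝ).comp T) x :=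
    (innerSL ℝ).hasFDerivAt.comp x b
  refine Finset.sum_congr rfl fun i _ => ?_
  rw [iteratedFDeriv_two_apply, e.fderiv_eq, d.fderiv]
  simp [EuclideanSpace.inner_single_right]

section Gradient

variable {m : ℕ} {f : EuclideanSpace ℝ (Fin m) → ℝ} {x : EuclideanSpace ℝ (Fin m)}

theorem ContDiffAt.gradient (h : ContDiffAt ℝ 2 f x) : ContDiffAt ℝ 1 (gradient f) x :=
  (InnerProductSpace.toDual ℝ (EuclideanSpace ℝ (Fin m))).symm.contDiff.contDiffAt.comp x
    (h.fderiv_right (m := 1) (by norm_num))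

theorem ContDiffAt.eventually_hasFDerivAt_gradient (h : ContDiffAt ℝ 2 f x) :
    ∀ᶠ y in 𝓝 x, HasFDerivAt f (innerSL ℝ (_root_.gradient f y)) y := by
  filter_upwards [h.eventually (by simp)] with y hy
  exact (hy.differentiableAt (by simp)).hasGradientAt.hasFDerivAt

theorem ContDiffAt.hasJet (h : ContDiffAt ℝ 2 f x) :
    HasJet f x (_root_.gradient f x)
      (∑ i, fderiv ℝ (_root_.gradient f) x (EuclideanSpace.single i 1) i) :=
  ⟨_root_.gradient f, _, h.eventually_hasFDerivAt_gradient,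
    (h.gradient.differentiableAt (by simp)).hasFDerivAt, rfl, rfl⟩

theorem inner_fderiv_gradient_comm (h : ContDiffAt ℝ 2 f x)
    (v w : EuclideanSpace ℝ (Fin m)) :
    inner ℝ (fderiv ℝ (_root_.gradient f) x v) w = inner ℝ (fderiv ℝ (_root_.gradient f) x w) v := by
  have := second_derivative_symmetric_of_eventually h.eventually_hasFDerivAt_gradient
    ((innerSL ℝ).hasFDerivAt.comp x (h.gradient.differentiableAt (by simp)).hasFDerivAt) v w
  exact this

end Gradient

/-- `W` is the degree-zero homogeneous extension of the logarithm of a positive solution `v` of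
`-Δ v = v ^ (q + 1) - lam * v` on the unit sphere. -/
structure IsLogSolution {m : ℕ} (q lam : ℝ) (W : EuclideanSpace ℝ (Fin m) → ℝ) : Prop where
  contDiffAt : ∀ x, x ≠ 0 → ContDiffAt ℝ 2 W x
  smul : ∀ c : ℝ, 0 < c → ∀ x, W (c • x) = W x
  laplacian : ∀ x, ‖x‖ = 1 → ∃ g,
    HasJet W x g (lam - Real.exp (q * W x) - ‖g‖ ^ 2)

namespace IsLogSolution

variable {m : ℕ} {q lam : ℝ} {W : EuclideanSpace ℝ (Fin m) → ℝ} {x : EuclideanSpace ℝ (Fin m)}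

theorem gradient_smul (h : IsLogSolution q lam W) (hx : x ≠ 0) {c : ℝ} (hc : 0 < c) :
    gradient W x = c • gradient W (c • x) := by
  have h1 := (h.contDiffAt x hx).hasJet
  have h2 := HasJet.comp_affine (c := c) (z := 0) (x := x)
    (by simpa using (h.contDiffAt (c • x) (smul_ne_zero hc.ne' hx)).hasJet)
  simp only [add_zero, h.smul c hc] at h2
  exact (h1.unique h2).1

theorem hasJet (h : IsLogSolution q lam W) (hx : x ≠ 0) :
    HasJet W x (gradient W x)
      ((‖x‖ ^ 2)⁻¹ * (lam - Real.exp (q * W x)) - ‖gradient W x‖ ^ 2) := by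
  have hc : 0 < ‖x‖⁻¹ := inv_pos.2 (norm_pos_iff.2 hx)
  have hn : ‖‖x‖⁻¹ • x‖ = 1 := norm_smul_inv_norm (𝕜 := ℝ) hx
  obtain ⟨g, hg⟩ := h.laplacian _ hn
  have hgrad := (hg.unique (h.contDiffAt _ (smul_ne_zero hc.ne' hx)).hasJet).1
  have h2 := HasJet.comp_affine (c := ‖x‖⁻¹) (z := 0) (x := x) (by simpa using hg)
  simp only [add_zero, h.smul _ hc] at h2
  rw [h.gradient_smul hx hc, ← hgrad, norm_smul, norm_inv, norm_norm]
  convert h2 using 1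
  ring

theorem inner_gradient_self (h : IsLogSolution q lam W) (hx : x ≠ 0) :
    inner ℝ (gradient W x) x = 0 := by
  have h1 : HasDerivAt (fun t : ℝ => W (t • x)) (inner ℝ (gradient W x) x) 1 := by
    have hl : HasDerivAt (fun t : ℝ => t • x) x 1 := by
      simpa using (hasDerivAt_id (1 : ℝ)).smul_const x
    have : HasFDerivAt W (innerSL ℝ (gradient W x)) ((1 : ℝ) • x) := by
      rw [one_smul]
      exact (h.hasJet hx).hasFDerivAt
    exact this.comp_hasDerivAt (1 : ℝ) hl
  have h2 : (fun t : ℝ => W (t • x)) =ᶠ[𝓝 1] fun _ => W x := by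
    filter_upwards [lt_mem_nhds one_pos] with t ht using h.smul t ht x
  exact h1.unique ((hasDerivAt_const _ _).congr_of_eventuallyEq h2)

theorem fderiv_gradient_self (h : IsLogSolution q lam W) (hx : x ≠ 0) :
    fderiv ℝ (gradient W) x x = -gradient W x := by
  have h1 : HasFDerivAt (gradient W) (fderiv ℝ (gradient W) x) x :=
    ((h.contDiffAt x hx).gradient.differentiableAt (by simp)).hasFDerivAt
  have h2 : (fun y => inner ℝ (gradient W y) y) =ᶠ[𝓝 x] fun _ => (0 : ℝ) := by
    filter_upwards [isOpen_ne.mem_nhds hx] with y hy using h.inner_gradient_self hy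
  have h3 := (h1.inner ℝ (hasFDerivAt_id x)).unique
    ((hasFDerivAt_const (0 : ℝ) x).congr_of_eventuallyEq h2)
  refine ext_inner_right ℝ fun w => ?_
  have := DFunLike.congr_fun h3 w
  simp only [ContinuousLinearMap.coe_comp, Function.comp_apply, ContinuousLinearMap.prod_apply,
    fderivInnerCLM_apply, id_eq, ContinuousLinearMap.id_apply, zero_apply] at this
  rw [inner_fderiv_gradient_comm (h.contDiffAt x hx), inner_neg_left]
  linarith

/-- Bochner's formula. -/
theorem hasWeakJet_gradient (h : IsLogSolution q lam W) (hx : ‖x‖ = 1) :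
    HasWeakJet (fun y => ‖y‖ ^ 2 * ‖gradient W y‖ ^ 2) x
      ((2 : ℝ) • fderiv ℝ (gradient W) x (gradient W x) + (2 * ‖gradient W x‖ ^ 2) • x)
      (2 * ∑ i, ‖fderiv ℝ (gradient W) x (EuclideanSpace.single i 1)‖ ^ 2
        - 2 * q * Real.exp (q * W x) * ‖gradient W x‖ ^ 2
        - 4 * inner ℝ (fderiv ℝ (gradient W) x (gradient W x)) (gradient W x)
        + (2 * m - 8) * ‖gradient W x‖ ^ 2) := by
  have hx0 : x ≠ 0 := by
    rintro rfl
    simp at hx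
  have hcd := h.contDiffAt x hx0
  set G := gradient W with hG
  set T := fderiv ℝ G x with hT
  have hT' : HasFDerivAt G T x := (hcd.gradient.differentiableAt (by simp)).hasFDerivAt
  set M : EuclideanSpace ℝ (Fin m) → ℝ :=
    fun y => (‖y‖ ^ 2)⁻¹ * (lam - Real.exp (q * W y)) - ‖G y‖ ^ 2 with hM
  have hMc : ContDiffAt ℝ 1 M x := by
    have : ContDiffAt ℝ 1 W x := hcd.of_le (by norm_num)
    have hg : ContDiffAt ℝ 1 G x := hcd.gradient
    have hn : ContDiffAt ℝ 1 (fun y : EuclideanSpace ℝ (Fin m) => ‖y‖ ^ 2) x :=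
      contDiffAt_id.norm_sq ℝ
    exact ((hn.inv (by simp [hx])).mul
      (contDiffAt_const.sub (contDiffAt_const.mul this).exp)).sub (hg.norm_sq ℝ)
  have hS := hMc.hasStrictFDerivAt (by norm_num)
  set S := fderiv ℝ M x with hSdef
  have hSG : S (G x) = -(q * Real.exp (q * W x) * ‖G x‖ ^ 2) - 2 * inner ℝ (T (G x)) (G x) := by
    have hn := ((hasStrictFDerivAt_norm_sq x).hasFDerivAt)
    have hW := (((h.hasJet hx0).hasFDerivAt.const_mul q).exp).const_sub lam
    have hi := (hasDerivAt_inv (x := ‖x‖ ^ 2) (by simp [hx])).comp_hasFDerivAt x hn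
    have := DFunLike.congr_fun (hS.hasFDerivAt.unique ((hi.fun_mul hW).fun_sub hT'.norm_sq)) (G x)
    rw [this]
    have hxG : inner ℝ x (G x) = 0 := by rw [real_inner_comm, h.inner_gradient_self hx0]
    simp [hx, ← hG, hxG, real_inner_comm (T (G x))]
    ring
  have hjets : ∀ᶠ y in 𝓝 x, HasJet W y (G y) (M y) := by
    filter_upwards [isOpen_ne.mem_nhds hx0] with y hy using h.hasJet hy
  have hpart := HasWeakJet.partial_deriv (T := T) hjets
    ((hcd.eventually (by simp)).mono fun y k => k.of_le (by norm_num))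
    (hcd.gradient.hasStrictFDerivAt (by norm_num)) hS
  have hE := HasWeakJet.sum (s := Finset.univ) fun i _ =>
    (hpart (EuclideanSpace.single i 1)).mul (hpart (EuclideanSpace.single i 1))
  have hdecomp (A : EuclideanSpace ℝ (Fin m)) : A = ∑ i, A i • EuclideanSpace.single i (1 : ℝ) := by
    ext j
    simp [Finset.sum_apply, Pi.single_apply]
  have hTG : T (G x) = ∑ i, G x i • T (EuclideanSpace.single i 1) := by
    conv_lhs => rw [hdecomp (G x)]
    simp
  have hSG' : S (G x) = ∑ i, G x i * S (EuclideanSpace.single i 1) := by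
    conv_lhs => rw [hdecomp (G x)]
    simp
  have hE' : HasWeakJet (fun y => ‖G y‖ ^ 2) x ((2 : ℝ) • T (G x))
      (2 * ∑ i, ‖T (EuclideanSpace.single i 1)‖ ^ 2 + 2 * S (G x)) := by
    convert hE using 1
    · ext y
      rw [EuclideanSpace.norm_sq_eq]
      simp [EuclideanSpace.inner_single_right, ← sq]
    · rw [hTG]
      simp [EuclideanSpace.inner_single_right, Finset.smul_sum, two_smul, Finset.sum_add_distrib]
    · rw [hSG', Finset.mul_sum, Finset.mul_sum, ← Finset.sum_add_distrib]
      refine Finset.sum_congr rfl fun i _ => ?_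
      simp [EuclideanSpace.inner_single_right]
      ring
  convert (HasWeakJet.norm_sq x).mul hE' using 1
  · simp [hx, smul_smul, mul_comm]
  · have hxT : inner ℝ x (T (G x)) = -‖G x‖ ^ 2 := by
      rw [real_inner_comm, hT, hG, inner_fderiv_gradient_comm hcd, h.fderiv_gradient_self hx0,
        inner_neg_left, real_inner_self_eq_norm_sq]
    rw [hSG, inner_smul_left, inner_smul_right, hxT, hx]
    simp
    ring

end IsLogSolution

/-- Lower bounds for the Hilbert–Schmidt norm of a symmetric operator whose action on the vectors
`x` and `g` is prescribed, obtained by comparison with an explicit operator. -/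
theorem sum_norm_sq_apply_single_ge {m : ℕ}
    {T : EuclideanSpace ℝ (Fin m) →L[ℝ] EuclideanSpace ℝ (Fin m)} {x g : EuclideanSpace ℝ (Fin m)}
    (hT : ∀ v w, inner ℝ (T v) w = inner ℝ (T w) v) (hx : ‖x‖ = 1) (hgx : inner ℝ g x = 0)
    (hTx : T x = -g) {a : ℝ} (hTg : T g = (-a) • g - ‖g‖ ^ 2 • x) (α μ : ℝ) :
    -2 * α * a * ‖g‖ ^ 2 + 2 * ‖g‖ ^ 2 + 2 * μ * ∑ i, T (EuclideanSpace.single i 1) i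
        - α ^ 2 * (‖g‖ ^ 2) ^ 2 - (m - 1) * μ ^ 2 - 2 * α * μ * ‖g‖ ^ 2
      ≤ ∑ i, ‖T (EuclideanSpace.single i 1)‖ ^ 2 := by
  have hxg : inner ℝ x g = 0 := by rw [real_inner_comm, hgx]
  have hxx : inner ℝ x x = 1 := by rw [real_inner_self_eq_norm_sq, hx, one_pow]
  have key (i : Fin m) : 0 ≤ ‖T (EuclideanSpace.single i 1)‖ ^ 2
      - 2 * (α * (g i * (-a * g i - ‖g‖ ^ 2 * x i)) + g i * g i - x i * (-a * g i - ‖g‖ ^ 2 * x i)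
        + μ * T (EuclideanSpace.single i 1) i + μ * (x i * g i))
      + (α ^ 2 * ‖g‖ ^ 2 * (g i * g i) + g i * g i + ‖g‖ ^ 2 * (x i * x i) + μ ^ 2
        - μ ^ 2 * (x i * x i) - 2 * α * ‖g‖ ^ 2 * (g i * x i) + 2 * α * μ * (g i * g i)
        - 2 * μ * (g i * x i)) := by
    set e : EuclideanSpace ℝ (Fin m) := EuclideanSpace.single i 1 with he
    have h1 : inner ℝ (T e) g = -a * g i - ‖g‖ ^ 2 * x i := by
      rw [hT, hTg]
      simp [he, EuclideanSpace.inner_single_right]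
    have h2 : inner ℝ (T e) x = -g i := by
      rw [hT, hTx]
      simp [he, EuclideanSpace.inner_single_right]
    have h3 : inner ℝ (T e) e = T e i := by simp [he, EuclideanSpace.inner_single_right]
    have h4 : inner ℝ g e = g i := by simp [he, EuclideanSpace.inner_single_right]
    have h5 : inner ℝ x e = x i := by simp [he, EuclideanSpace.inner_single_right]
    have h6 : inner ℝ e g = g i := by rw [real_inner_comm, h4]
    have h7 : inner ℝ e x = x i := by rw [real_inner_comm, h5]
    have h8 : inner ℝ e e = (1 : ℝ) := by simp [he]
    have h9 : inner ℝ g g = ‖g‖ ^ 2 := real_inner_self_eq_norm_sq g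
    have hB := sq_nonneg ‖T e - ((α * g i) • g - g i • x - x i • g + μ • e - (μ * x i) • x)‖
    rw [norm_sub_sq_real, ← real_inner_self_eq_norm_sq (_ - _)] at hB
    simp only [inner_sub_left, inner_sub_right, inner_add_left, inner_add_right, inner_smul_left,
      inner_smul_right, h1, h2, h3, h4, h5, h6, h7, h8, h9, hgx, hxg, hxx, conj_trivial] at hB
    linarith
  have hsum := Finset.sum_nonneg fun i (_ : i ∈ Finset.univ) => key i
  have s1 : ∑ i, g i * g i = ‖g‖ ^ 2 := by simp [EuclideanSpace.norm_sq_eq, ← sq]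
  have s2 : ∑ i, x i * x i = 1 := by
    rw [← one_pow 2, ← hx]
    simp [EuclideanSpace.norm_sq_eq, ← sq]
  have s3 : ∑ i, g i * x i = 0 := by
    rw [← hxg]
    simp [PiLp.inner_apply]
  have expand : ∑ i, (‖T (EuclideanSpace.single i 1)‖ ^ 2
      - 2 * (α * (g i * (-a * g i - ‖g‖ ^ 2 * x i)) + g i * g i - x i * (-a * g i - ‖g‖ ^ 2 * x i)
        + μ * T (EuclideanSpace.single i 1) i + μ * (x i * g i))
      + (α ^ 2 * ‖g‖ ^ 2 * (g i * g i) + g i * g i + ‖g‖ ^ 2 * (x i * x i) + μ ^ 2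
        - μ ^ 2 * (x i * x i) - 2 * α * ‖g‖ ^ 2 * (g i * x i) + 2 * α * μ * (g i * g i)
        - 2 * μ * (g i * x i))) =
      ∑ i, ‖T (EuclideanSpace.single i 1)‖ ^ 2 - 2 * μ * ∑ i, T (EuclideanSpace.single i 1) i
      + (2 * α * a - 1 + α ^ 2 * ‖g‖ ^ 2 + 2 * α * μ) * ∑ i, g i * g i
      + (-‖g‖ ^ 2 - μ ^ 2) * ∑ i, x i * x i
      + (-2 * a - 4 * μ) * ∑ i, g i * x i + m * μ ^ 2 := by
    have hc : (m : ℝ) * μ ^ 2 = ∑ _i : Fin m, μ ^ 2 := by simp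
    rw [hc]
    simp only [Finset.mul_sum, ← Finset.sum_add_distrib, ← Finset.sum_sub_distrib]
    refine Finset.sum_congr rfl fun i _ => ?_
    ring
  rw [expand, s1, s2, s3] at hsum
  linarith

namespace IsLogSolution

variable {m : ℕ} {q lam : ℝ} {W : EuclideanSpace ℝ (Fin m) → ℝ} {x : EuclideanSpace ℝ (Fin m)}

theorem hasWeakJet (h : IsLogSolution q lam W) (hx : x ≠ 0) :
    HasWeakJet W x (gradient W x)
      ((‖x‖ ^ 2)⁻¹ * (lam - Real.exp (q * W x)) - ‖gradient W x‖ ^ 2) := by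
  have hG : ContinuousAt (gradient W) x := (h.contDiffAt x hx).gradient.continuousAt
  refine HasWeakJet.of_hasJet (M := fun y => (‖y‖ ^ 2)⁻¹ * (lam - Real.exp (q * W y))
    - ‖gradient W y‖ ^ 2) ?_ hG ?_
  · filter_upwards [isOpen_ne.mem_nhds hx] with y hy using h.hasJet hy
  · have hW : ContinuousAt W x := (h.contDiffAt x hx).continuousAt
    have h0 : ‖x‖ ^ 2 ≠ 0 := by simpa using hx
    fun_prop (disch := assumption)

/-- The differential inequality at a maximum point of
`Φ (W y) * (‖y‖ ^ 2 * ‖∇ W y‖ ^ 2 + d * exp (q * W y))`, where `Φ' = κ Φ`. -/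
theorem ineq_of_isLocalMax (h : IsLogSolution q lam W) (hx : ‖x‖ = 1) {Φ κ κ' : ℝ → ℝ} {d : ℝ}
    (hΦ : ∀ t, HasDerivAt Φ (κ t * Φ t) t) (hκ : ∀ t, HasDerivAt κ (κ' t) t) (hκ' : Continuous κ')
    (hpos : ∀ t, 0 < Φ t)
    (hmax : IsLocalMax
      (fun y => Φ (W y) * (‖y‖ ^ 2 * ‖gradient W y‖ ^ 2 + d * Real.exp (q * W y))) x)
    {g s k k' D a : ℝ} (hg : g = ‖gradient W x‖ ^ 2) (hs : s = Real.exp (q * W x))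
    (hk : k = κ (W x)) (hk' : k' = κ' (W x)) (hD : D = lam - s - g)
    (ha : 2 * a = k * (g + d * s) + d * q * s) (α μ : ℝ) :
    2 * (-2 * α * a * g + 2 * μ * D - α ^ 2 * g ^ 2 - (m - 1) * μ ^ 2 - 2 * α * μ * g)
      + 4 * a * g - 2 * q * s * g + (2 * m - 4) * g + d * q * s * (D + q * g)
      + (k' - k ^ 2) * g * (g + d * s) + k * D * (g + d * s) ≤ 0 := by
  have hx0 : x ≠ 0 := by
    rintro rfl
    simp at hx
  have hcd := h.contDiffAt x hx0
  have hexp (t : ℝ) : HasDerivAt (fun t => Real.exp (q * t)) (q * Real.exp (q * t)) t := by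
    simpa [mul_comm] using ((hasDerivAt_id t).const_mul q).exp
  have hjG := (h.hasWeakJet_gradient hx).add ((HasWeakJet.const d x).mul
    ((h.hasWeakJet hx0).comp hexp (fun t => (hexp t).const_mul q) (by fun_prop)))
  have hjΦ := (h.hasWeakJet hx0).comp hΦ (fun t => (hκ t).fun_mul (hΦ t)) (by
    have hc1 : Continuous Φ := continuous_iff_continuousAt.2 fun t => (hΦ t).continuousAt
    have hc2 : Continuous κ := continuous_iff_continuousAt.2 fun t => (hκ t).continuousAt
    fun_prop)
  obtain ⟨hgrad, hlap⟩ := (hjΦ.mul hjG).of_isLocalMax hmax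
  simp only [← hs, ← hg, hx, ← hk, ← hk'] at hgrad hlap
  set G := gradient W x with hG
  set T := fderiv ℝ (gradient W) x with hT
  have hΦ0 := hpos (W x)
  set P := Φ (W x)
  have hTG : T G = (-a) • G - ‖G‖ ^ 2 • x := by
    have : (2 * P) • (T G - ((-a) • G - ‖G‖ ^ 2 • x)) = 0 := by
      rw [← hgrad, ← hg]
      have : -a = -(k * (g + d * s) + d * q * s) / 2 := by linarith
      rw [this]
      module
    have h2 := (smul_eq_zero.mp this).resolve_left (by positivity)
    exact sub_eq_zero.mp h2
  have hTsymm : ∀ v w, inner ℝ (T v) w = inner ℝ (T w) v := inner_fderiv_gradient_comm hcd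
  have hGx : inner ℝ G x = 0 := h.inner_gradient_self hx0
  have hbound := sum_norm_sq_apply_single_ge hTsymm hx hGx (h.fderiv_gradient_self hx0) hTG α μ
  have htr : ∑ i, T (EuclideanSpace.single i 1) i = D := by
    rw [(hcd.hasJet.unique (h.hasJet hx0)).2, hx, ← hs, ← hG, ← hg, hD]
    ring
  rw [htr, ← hg] at hbound
  have hGG : inner ℝ G G = g := by rw [real_inner_self_eq_norm_sq, hg]
  have hxG : inner ℝ G (T G) = -a * g := by
    rw [hTG, inner_sub_right, inner_smul_right, inner_smul_right, hGx, hGG]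
    ring
  have hxG' : inner ℝ (T G) G = -a * g := by rw [real_inner_comm, hxG]
  simp only [inner_smul_left, inner_smul_right, inner_add_right, hGx, hGG, hxG, hxG', conj_trivial,
    one_pow, inv_one, one_mul, inner_zero_left, inner_zero_right] at hlap
  generalize (∑ i, ‖T (EuclideanSpace.single i 1)‖ ^ 2) = Q at hlap hbound
  have hDe : lam - s = D + g := by rw [hD]; ring
  rw [hDe] at hlap
  have hfin : P * (2 * Q - 2 * q * s * g + 4 * a * g + (2 * m - 8) * g
      + d * q * s * (D + q * g) + (k' - k ^ 2) * g * (g + d * s) + k * D * (g + d * s)) ≤ 0 := by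
    have h2a : a = (k * (g + d * s) + d * q * s) / 2 := by linarith
    rw [h2a] at hlap ⊢
    refine le_trans (le_of_eq ?_) hlap
    ring
  have := nonpos_of_mul_nonpos_right hfin hΦ0
  linarith

end IsLogSolution

theorem quadratic_of_forall_le {n q b t m h s l : ℝ} (hn : 2 ≤ n) (hq : 0 < q) (hh : 0 < h)
    {k k' d D a : ℝ} (hk : k = -(q / 2) * t) (hk' : k' = -(q / 2) * b * t * (1 - t))
    (hd : d = 2 * m / q) (hD : D = l - s - h) (ha : 2 * a = k * (h + d * s) + d * q * s)
    (H : ∀ α μ : ℝ, 2 * (-2 * α * a * h + 2 * μ * D - α ^ 2 * h ^ 2 - n * μ ^ 2 - 2 * α * μ * h)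
      + 4 * a * h - 2 * q * s * h + 2 * (n - 1) * h + d * q * s * (D + q * h)
      + (k' - k ^ 2) * h * (h + d * s) + k * D * (h + d * s) ≤ 0) :
    ((2 - k) * (2 + (n - 2) * k) / (2 * (n - 1)) + k') * h ^ 2
      + ((2 - k) * (2 - m * (2 - t)) / (n - 1) + m * (2 - t) * (1 + q) - 2 * q - k
        - m * b * t * (1 - t)) * (h * s)
      + (2 - m * (2 - t)) * (2 - n * (m * (2 - t))) / (2 * (n - 1)) * s ^ 2
      + (-(2 * l * ((2 - k) * h + (2 - m * (2 - t)) * s)) / (n - 1) + 2 * l ^ 2 / (n - 1)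
        + l * k * h + m * (2 - t) * s * l + 2 * (n - 1) * h) ≤ 0 := by
  have hn1 : n - 1 ≠ 0 := by linarith
  refine le_trans (le_of_eq ?_) (H (-(a + (D + a) / (n - 1)) / h) ((D + a) / (n - 1)))
  have ha' : a = (k * (h + d * s) + d * q * s) / 2 := by linarith
  subst hD ha' hk' hd hk
  field_simp
  ring

theorem le_of_mul_sq_le {c P Q h : ℝ} (hc : 0 < c) (hP : 0 ≤ P) (hQ : 0 ≤ Q)
    (H : c * h ^ 2 ≤ P * h + Q) : h ≤ 1 + (P + Q) / c := by
  by_contra! hlt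
  have h1 : 1 < h := by
    have : 0 ≤ (P + Q) / c := by positivity
    linarith
  have h2 : (P + Q) < c * h := by
    have : (P + Q) / c < h := by linarith
    rwa [div_lt_iff₀' hc] at this
  nlinarith

theorem le_of_forall_le_zero {n q t m s l : ℝ} (hn : 0 < n) (hq : 0 < q)
    {k k' : ℝ} (hk : k = -(q / 2) * t)
    (H : ∀ D a : ℝ, D = l - s - 0 → 2 * a = k * (0 + 2 * m / q * s) + 2 * m / q * q * s →
      ∀ α μ : ℝ, 2 * (-2 * α * a * 0 + 2 * μ * D - α ^ 2 * 0 ^ 2 - n * μ ^ 2 - 2 * α * μ * 0)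
        + 4 * a * 0 - 2 * q * s * 0 + 2 * (n - 1) * 0 + 2 * m / q * q * s * (D + q * 0)
        + (k' - k ^ 2) * 0 * (0 + 2 * m / q * s) + k * D * (0 + 2 * m / q * s) ≤ 0)
    (hls : l < s) : 2 * (s - l) ≤ n * (m * (2 - t)) * s := by
  have h2 := H (l - s) (m * (2 - t) * s / 2) (by ring) (by rw [hk]; field_simp; ring) 0 ((l - s) / n)
  have h3 : 2 * ((l - s) ^ 2 / n) + m * (2 - t) * s * (l - s) ≤ 0 := by
    refine le_trans (le_of_eq ?_) h2
    rw [hk]; field_simp; ring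
  have h5 : (s - l) * (2 * (s - l) - n * (m * (2 - t)) * s) ≤ 0 := by
    refine le_trans (le_of_eq ?_) (mul_nonpos_of_nonneg_of_nonpos hn.le h3)
    field_simp; ring
  linarith [nonpos_of_mul_nonpos_right h5 (sub_pos.2 hls)]

theorem lower_order_ge {n q h s l L k y : ℝ} (hn : 2 ≤ n) (hq : 0 < q) (hh : 0 ≤ h) (hs : 0 ≤ s)
    (hl : 0 < l) (hlL : l ≤ L) (hkq : -(q / 2) ≤ k) (hy : 0 ≤ y) :
    -(L * (4 + 2 * q) * (h + s)) ≤ -(2 * l * ((2 - k) * h + (2 - y) * s)) / (n - 1)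
        + 2 * l ^ 2 / (n - 1) + l * k * h + y * s * l + 2 * (n - 1) * h := by
  have hn1 : 0 < n - 1 := by linarith
  have e1 : 2 * l * ((2 - k) * h + (2 - y) * s) / (n - 1)
      ≤ 2 * l * ((2 + q / 2) * h + 2 * s) := by
    rw [div_le_iff₀ hn1]
    have e2 : (2 - k) * h + (2 - y) * s ≤ (2 + q / 2) * h + 2 * s := by
      have := mul_le_mul_of_nonneg_right hkq hh
      have := mul_nonneg hy hs
      linarith
    have e3 : 2 * l * ((2 - k) * h + (2 - y) * s) ≤ 2 * l * ((2 + q / 2) * h + 2 * s) :=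
      mul_le_mul_of_nonneg_left e2 (by linarith)
    have e4 : 0 ≤ 2 * l * ((2 + q / 2) * h + 2 * s) := by positivity
    have := mul_le_mul_of_nonneg_left (by linarith : 1 ≤ n - 1) e4
    linarith
  have e5 : 0 ≤ 2 * l ^ 2 / (n - 1) := by positivity
  have e6 : 0 ≤ y * s * l := by positivity
  have e7 : 0 ≤ 2 * (n - 1) * h := by positivity
  have e8 : 0 ≤ l * (k + q / 2) * h := mul_nonneg (mul_nonneg hl.le (by linarith)) hh
  have e9 : l * (4 + 2 * q) * (h + s) ≤ L * (4 + 2 * q) * (h + s) := by gcongr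
  have e10 : 0 ≤ l * (q * h) := by positivity
  have e11 : 0 ≤ l * (q * s) := by positivity
  rw [neg_div]
  linarith

theorem coeff_sq_grad_ge {n q b t A k k' : ℝ} (hn : 2 ≤ n) (hq : 0 < q)
    (hnq : (n - 2) * q < 4) (hb : b = 2 * (4 - (n - 2) * q) / (q * (n - 1)))
    (hA : A = (4 - (n - 2) * q) / (4 * (n - 1))) (ht0 : 0 < t) (ht1 : t < 1)
    (hk : k = -(q / 2) * t) (hk' : k' = -(q / 2) * b * t * (1 - t)) :
    A ≤ (2 - k) * (2 + (n - 2) * k) / (2 * (n - 1)) + k' := by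
  have hn1 : 0 < n - 1 := by linarith
  have hA0 : 0 < A := by rw [hA]; exact div_pos (by linarith) (by linarith)
  have htt : t * (1 - t) ≤ 1 / 4 := by nlinarith [sq_nonneg (t - 1 / 2)]
  have e1 : -A ≤ k' := by
    have h1 : q * b = 8 * A := by rw [hb, hA]; field_simp; ring
    have h2 : k' = -(4 * A) * (t * (1 - t)) := by
      rw [hk']; linear_combination (-(t * (1 - t)) / 2) * h1
    rw [h2]
    linarith [mul_le_mul_of_nonneg_left htt hA0.le]
  have e2 : 2 * A ≤ (2 - k) * (2 + (n - 2) * k) / (2 * (n - 1)) := by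
    rw [le_div_iff₀ (by positivity)]
    have h1 : 2 * A * (2 * (n - 1)) = 4 - (n - 2) * q := by rw [hA]; field_simp; ring
    rw [h1]
    have h2 : (4 - (n - 2) * q) / 2 ≤ 2 + (n - 2) * k := by
      rw [hk]
      have := mul_le_mul_of_nonneg_left ht1.le (mul_nonneg (sub_nonneg.2 hn) hq.le)
      linarith
    have h3 : 2 ≤ 2 - k := by rw [hk]; linarith [mul_pos hq ht0]
    have h4 := mul_le_mul h3 h2 (by linarith) (by linarith)
    linarith
  linarith

theorem coeff_mixed_nonneg {n q b t m y ε k : ℝ} (hn : 2 ≤ n) (hq : 0 < q) (hb : 0 < b)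
    (hm : m ≤ 1) (hε0 : 0 < ε) (hε : ε * (8 * (1 + q)) = 4 - (n - 2) * q) (ht0 : 0 < t)
    (ht1 : t < 1) (hk : k = -(q / 2) * t) (hy2 : n * y ≤ 2) (hy : 2 - 2 * ε ≤ n * y)
    (hy0 : 0 ≤ y) (ht : (1 - t) * (n * (2 * q + b)) ≤ 4 - (n - 2) * q) :
    0 ≤ (2 - k) * (2 - y) / (n - 1) + y * (1 + q) - 2 * q - k - m * b * t * (1 - t) := by
  have hn1 : 0 < n - 1 := by linarith
  have hn0 : 0 < n := by linarith
  have ht' : 0 ≤ 1 - t := by linarith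
  obtain ⟨z, hz⟩ : ∃ z, z = (2 - y) / (n - 1) := ⟨_, rfl⟩
  have hz2 : z ≤ 2 := by rw [hz, div_le_iff₀ hn1]; linarith
  have hnz : 2 ≤ n * z := by
    rw [hz, ← mul_div_assoc, le_div_iff₀ hn1]
    linarith
  have e1 : m * (b * (t * (1 - t))) ≤ 1 * (b * (1 * (1 - t))) := by gcongr
  have e3 : (2 + q / 2) * 2 ≤ (2 + q / 2) * (n * z) := by gcongr
  have e4 : n * (q / 2 * (1 - t) * z) ≤ n * (q / 2 * (1 - t) * 2) := by gcongr
  have e5 : (1 + q) * (2 - 2 * ε) ≤ (1 + q) * (n * y) := by gcongr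
  have e7 : n * (m * (b * (t * (1 - t)))) ≤ n * (1 * (b * (1 * (1 - t)))) := by gcongr
  have e8 : 0 ≤ n * q * (1 - t) := by positivity
  have e9 : 0 < ε * (8 * (1 + q)) := by positivity
  refine nonneg_of_mul_nonneg_right ?_ hn0
  rw [mul_div_assoc, ← hz, hk]
  linarith

theorem exists_weight_bound {n q L : ℝ} (hn : 2 ≤ n) (hq : 0 < q) (hnq : (n - 2) * q < 4)
    (hL : 0 < L) : ∃ b > 0, ∃ d > 0, ∃ K, ∀ w h s l t k k' : ℝ, s = Real.exp (q * w) →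
      t = Real.exp (b * w) / (1 + Real.exp (b * w)) → k = -(q / 2) * t →
      k' = -(q / 2) * b * t * (1 - t) → 0 ≤ h → 0 < l → l ≤ L →
      (∀ D a : ℝ, D = l - s - h → 2 * a = k * (h + d * s) + d * q * s → ∀ α μ : ℝ,
        2 * (-2 * α * a * h + 2 * μ * D - α ^ 2 * h ^ 2 - n * μ ^ 2 - 2 * α * μ * h)
          + 4 * a * h - 2 * q * s * h + 2 * (n - 1) * h + d * q * s * (D + q * h)
          + (k' - k ^ 2) * h * (h + d * s) + k * D * (h + d * s) ≤ 0) →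
      h + d * s ≤ K := by
  have hn1 : 0 < n - 1 := by linarith
  have hn0 : 0 < n := by linarith
  obtain ⟨σ, hσ⟩ : ∃ σ, σ = 4 - (n - 2) * q := ⟨_, rfl⟩
  have hσ0 : 0 < σ := by linarith
  have hσ4 : σ ≤ 4 := by nlinarith
  obtain ⟨ε, hε⟩ : ∃ ε, ε = σ / (8 * (1 + q)) := ⟨_, rfl⟩
  have hε0 : 0 < ε := by rw [hε]; positivity
  have hεσ : ε * (8 * (1 + q)) = σ := by rw [hε]; field_simp
  have hε1 : ε ≤ 1 / 2 := by nlinarith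
  obtain ⟨b, hb⟩ : ∃ b, b = 2 * σ / (q * (n - 1)) := ⟨_, rfl⟩
  have hb0 : 0 < b := by rw [hb]; positivity
  obtain ⟨m, hm⟩ : ∃ m, m = 2 * (1 - ε) / n := ⟨_, rfl⟩
  have hm0 : 0 < m := by rw [hm]; exact div_pos (by linarith) hn0
  have hmn : n * m = 2 * (1 - ε) := by rw [hm]; field_simp
  have hm1 : m ≤ 1 := by nlinarith
  obtain ⟨η, hη⟩ : ∃ η, η = min (ε / 2) (σ / (n * (2 * q + b))) := ⟨_, rfl⟩
  have hη0 : 0 < η := by rw [hη]; positivity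
  have hηε : η ≤ ε / 2 := by rw [hη]; exact min_le_left _ _
  have hησ : η * (n * (2 * q + b)) ≤ σ := by
    rw [← le_div_iff₀ (by positivity), hη]; exact min_le_right _ _
  obtain ⟨S, hS⟩ : ∃ S, S = Real.exp (q * (Real.log η⁻¹ / b)) := ⟨_, rfl⟩
  have hS0 : 0 < S := by rw [hS]; positivity
  obtain ⟨A, hA⟩ : ∃ A, A = σ / (4 * (n - 1)) := ⟨_, rfl⟩
  have hA0 : 0 < A := by rw [hA]; positivity
  obtain ⟨C, hC⟩ : ∃ C, C = ε / (2 * (n - 1)) := ⟨_, rfl⟩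
  have hC0 : 0 < C := by rw [hC]; positivity
  obtain ⟨M, hM⟩ : ∃ M, M = L * (4 + 2 * q) := ⟨_, rfl⟩
  have hM0 : 0 < M := by rw [hM]; positivity
  have hsmall (w : ℝ) (hw : η < 1 - Real.exp (b * w) / (1 + Real.exp (b * w))) :
      Real.exp (q * w) ≤ S := by
    rw [hS, Real.exp_le_exp]
    refine mul_le_mul_of_nonneg_left ?_ hq.le
    rw [le_div_iff₀ hb0, Real.le_log_iff_exp_le (by positivity), mul_comm w b]
    have hE := Real.exp_pos (b * w)
    have h1 : 1 - Real.exp (b * w) / (1 + Real.exp (b * w)) = 1 / (1 + Real.exp (b * w)) := by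
      field_simp; ring
    rw [h1, lt_div_iff₀ (by positivity)] at hw
    rw [← one_div, le_div_iff₀ hη0]
    nlinarith
  refine ⟨b, hb0, 2 * m / q, by positivity,
    (1 + (M + (2 * q + b) * S + (M * S + 2 * S ^ 2)) / A) + 2 * (M / min A C)
      + 2 * m / q * (S + L + 2 * L / ε + 2 * (M / min A C)), ?_⟩
  intro w h s l t k k' hs ht hk hk' hh hl hlL H
  have hs0 : 0 < s := by rw [hs]; positivity
  have hE := Real.exp_pos (b * w)
  have ht0 : 0 < t := by rw [ht]; positivity
  have ht1 : t < 1 := by rw [ht, div_lt_one (by positivity)]; linarith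
  have hx1 : 0 ≤ M / min A C := by positivity
  have hx2 : 0 ≤ (M + (2 * q + b) * S + (M * S + 2 * S ^ 2)) / A := by positivity
  have hx3 : 0 ≤ L / ε := by positivity
  suffices hK : h ≤ (1 + (M + (2 * q + b) * S + (M * S + 2 * S ^ 2)) / A) + 2 * (M / min A C) ∧
      s ≤ S + L + 2 * L / ε + 2 * (M / min A C) from
    add_le_add hK.1 (mul_le_mul_of_nonneg_left hK.2 (by positivity))
  obtain ⟨y, hy⟩ : ∃ y, y = m * (2 - t) := ⟨_, rfl⟩
  have hmy : m ≤ y := by rw [hy]; linarith [mul_pos hm0 (sub_pos.2 ht1)]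
  have hny : n * y = 2 * (1 - ε) * (2 - t) := by rw [hy, ← hmn]; ring
  have hy0 : 0 < y := hm0.trans_le hmy
  have hny4 : n * y ≤ 4 := by
    rw [hny]
    linarith [mul_nonneg hε0.le (by linarith : 0 ≤ 2 - t)]
  have hy2 : y ≤ 2 := by linarith [mul_le_mul_of_nonneg_right hn hy0.le]
  have hnear (htη : 1 - t ≤ η) : n * y ≤ 2 - ε := by
    rw [hny]
    have := mul_le_mul_of_nonneg_left (htη.trans hηε) (by linarith : 0 ≤ 1 - ε)
    linarith [sq_nonneg ε]
  have hfar (htη : ¬ 1 - t ≤ η) : s ≤ S := by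
    rw [hs]
    refine hsmall w ?_
    rw [← ht]
    exact not_lt.1 (fun h' => htη h'.le) |>.lt_of_ne fun h' => htη h'.ge
  have hk0 : k ≤ 0 := by rw [hk]; linarith [mul_pos hq ht0]
  have hkq : -(q / 2) ≤ k := by rw [hk]; linarith [mul_lt_mul_of_pos_left ht1 hq]
  rcases hh.eq_or_lt with rfl | hh
  · refine ⟨by linarith, ?_⟩
    by_cases hsL : s ≤ L
    · linarith [mul_div_assoc 2 L ε]
    by_cases htη : 1 - t ≤ η
    · have h4 := le_of_forall_le_zero hn0 hq hk H (by linarith)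
      rw [← hy] at h4
      have h6 := mul_le_mul_of_nonneg_right (hnear htη) hs0.le
      have h7 : s ≤ 2 * L / ε := by rw [le_div_iff₀ hε0]; linarith
      linarith
    · linarith [hfar htη, mul_div_assoc 2 L ε]
  · have h1 := quadratic_of_forall_le hn hq hh (l := l) (d := 2 * m / q) (D := l - s - h)
      (a := (k * (h + 2 * m / q * s) + 2 * m / q * q * s) / 2) hk hk' rfl rfl (by ring)
      (H _ _ rfl (by ring))
    rw [← hy] at h1
    have hlin := lower_order_ge hn hq hh.le hs0.le hl hlL hkq hy0.le
    rw [← hM] at hlin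
    have hAk := coeff_sq_grad_ge hn hq hnq (hσ ▸ hb) (hσ ▸ hA) ht0 ht1 hk hk'
    obtain ⟨B, hB⟩ : ∃ B, B = (2 - k) * (2 - y) / (n - 1) + y * (1 + q) - 2 * q - k
        - m * b * t * (1 - t) := ⟨_, rfl⟩
    rw [← hB] at h1
    obtain ⟨c, hc⟩ : ∃ c, c = (2 - y) * (2 - n * y) / (2 * (n - 1)) := ⟨_, rfl⟩
    rw [← hc] at h1
    have e1 := mul_le_mul_of_nonneg_right hAk (sq_nonneg h)
    by_cases htη : 1 - t ≤ η
    · have hyn := hnear htη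
      have hCc : C ≤ c := by
        rw [hC, hc]
        gcongr
        have : 1 * ε ≤ (2 - y) * (2 - n * y) :=
          mul_le_mul (by linarith [mul_le_mul_of_nonneg_right hn hy0.le])
            (by linarith) hε0.le (by linarith)
        linarith
      have hB0 : 0 ≤ B := by
        rw [hB]
        refine coeff_mixed_nonneg hn hq hb0 hm1 hε0 (hεσ.trans hσ) ht0 ht1 hk (by linarith) ?_
          hy0.le (le_trans ?_ (hσ ▸ hησ))
        · rw [hny]
          linarith [mul_nonneg (by linarith : 0 ≤ 1 - ε) (by linarith : 0 ≤ 1 - t)]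
        · gcongr
      have hmin : min A C * (h ^ 2 + s ^ 2) ≤ M * (h + s) := by
        have e0 := mul_le_mul_of_nonneg_right (min_le_left A C) (sq_nonneg h)
        have e2 := mul_le_mul_of_nonneg_right ((min_le_right A C).trans hCc) (sq_nonneg s)
        have e3 : 0 ≤ B * (h * s) := by positivity
        linarith
      have hc0 : 0 < min A C := lt_min hA0 hC0
      have hsum : h + s ≤ 2 * (M / min A C) := by
        rw [← mul_div_assoc, le_div_iff₀ hc0]
        have e4 : (min A C * (h + s)) * (h + s) ≤ 2 * M * (h + s) := by
          linarith [mul_nonneg hc0.le (sq_nonneg (h - s))]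
        rw [mul_comm]
        exact le_of_mul_le_mul_right e4 (by positivity)
      constructor <;> linarith [mul_div_assoc 2 L ε]
    · have hsS := hfar htη
      refine ⟨?_, by linarith [mul_div_assoc 2 L ε]⟩
      have hBl : -(2 * q + b) ≤ B := by
        have e1 : m * (b * (t * (1 - t))) ≤ 1 * (b * (1 * 1)) := by
          have : 0 ≤ 1 - t := by linarith
          gcongr
          linarith
        have e2 : 0 ≤ (2 - k) * (2 - y) / (n - 1) :=
          div_nonneg (mul_nonneg (by linarith) (by linarith)) hn1.le
        have e3 : 0 ≤ y * (1 + q) := mul_nonneg (by linarith) (by linarith)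
        linarith
      have hCl : -2 ≤ c := by
        rw [hc, le_div_iff₀ (by positivity)]
        have := mul_nonneg (by linarith : 0 ≤ 2 - y) (by linarith : 0 ≤ 4 - n * y)
        linarith
      have e2 := mul_le_mul_of_nonneg_right hCl (sq_nonneg s)
      have e3 := mul_le_mul_of_nonneg_right hBl (mul_nonneg hh.le hs0.le)
      have e4 : (2 * q + b) * (h * s) ≤ (2 * q + b) * (h * S) := by gcongr
      have e5 : s ^ 2 ≤ S ^ 2 := by gcongr
      have e6 : M * s ≤ M * S := by gcongr
      have := le_of_mul_sq_le (h := h) hA0 (P := M + (2 * q + b) * S) (Q := M * S + 2 * S ^ 2)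
        (by positivity) (by positivity) (by linarith)
      linarith

theorem exists_isLocalMax_of_smul_eq {n : ℕ} {F : EuclideanSpace ℝ (Fin (n + 1)) → ℝ}
    (hF : ContinuousOn F {0}ᶜ) (hs : ∀ c : ℝ, 0 < c → ∀ x, x ≠ 0 → F (c • x) = F x) :
    ∃ x, ‖x‖ = 1 ∧ IsLocalMax F x ∧ ∀ y, ‖y‖ = 1 → F y ≤ F x := by
  obtain ⟨x, hx, hmax⟩ := (isCompact_sphere (0 : EuclideanSpace ℝ (Fin (n + 1))) 1).exists_isMaxOn
    ((NormedSpace.sphere_nonempty).2 zero_le_one)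
    (hF.mono fun y hy => ne_zero_of_mem_unit_sphere ⟨y, hy⟩)
  have hx1 : ‖x‖ = 1 := by simpa using hx
  have hle (y) (hy : ‖y‖ = 1) : F y ≤ F x := hmax (by simpa using hy)
  refine ⟨x, hx1, ?_, hle⟩
  filter_upwards [isOpen_ne.mem_nhds (norm_ne_zero_iff.1 (hx1 ▸ one_ne_zero) : x ≠ 0)] with y hy
  rw [← hs ‖y‖⁻¹ (inv_pos.2 (norm_pos_iff.2 hy)) y hy]
  exact hle _ (norm_smul_inv_norm (𝕜 := ℝ) hy)

theorem hasDerivAt_logistic (b t : ℝ) :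
    HasDerivAt (fun t => Real.exp (b * t) / (1 + Real.exp (b * t)))
      (b * (Real.exp (b * t) / (1 + Real.exp (b * t)))
        * (1 - Real.exp (b * t) / (1 + Real.exp (b * t)))) t := by
  have h1 : HasDerivAt (fun t => Real.exp (b * t)) (Real.exp (b * t) * b) t := by
    simpa using ((hasDerivAt_id t).const_mul b).exp
  have h0 : 1 + Real.exp (b * t) ≠ 0 := by positivity
  refine (h1.fun_div (h1.const_add 1) h0).congr_deriv ?_
  field_simp

theorem exists_hasDerivAt_logistic_weight {q b : ℝ} (hq : 0 < q) (hb : 0 < b) :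
    ∃ Φ : ℝ → ℝ, (∀ t, HasDerivAt Φ
        (-(q / 2) * (Real.exp (b * t) / (1 + Real.exp (b * t))) * Φ t) t) ∧
      (∀ t, 0 < Φ t) ∧ (∀ t, Φ t ≤ 1) ∧
      ∃ c > 0, ∀ t, 1 ≤ c * (1 + Real.exp (q / 2 * t)) * Φ t := by
  refine ⟨fun t => Real.exp (-(q / (2 * b)) * Real.log (1 + Real.exp (b * t))), ?_,
    fun t => Real.exp_pos _, fun t => ?_, Real.exp (q / (2 * b) * Real.log 2), Real.exp_pos _, ?_⟩
  · intro t
    have h0 : 1 + Real.exp (b * t) ≠ 0 := by positivity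
    have h1 : HasDerivAt (fun t => Real.exp (b * t)) (Real.exp (b * t) * b) t := by
      simpa using ((hasDerivAt_id t).const_mul b).exp
    refine (((h1.const_add 1).log h0).const_mul (-(q / (2 * b)))).exp.congr_deriv ?_
    field_simp
  · rw [Real.exp_le_one_iff]
    have : 0 ≤ Real.log (1 + Real.exp (b * t)) := Real.log_nonneg (by linarith [Real.exp_pos (b * t)])
    have : 0 ≤ q / (2 * b) * Real.log (1 + Real.exp (b * t)) := by positivity
    linarith
  · intro t
    have hE := Real.exp_pos (q / 2 * t)
    have hc : 0 < q / (2 * b) := by positivity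
    rcases le_total 0 t with ht | ht
    · have h1 : Real.log (1 + Real.exp (b * t)) ≤ Real.log 2 + b * t := by
        rw [← Real.log_exp (b * t), ← Real.log_mul (by norm_num) (Real.exp_pos _).ne']
        refine Real.log_le_log (by positivity) ?_
        rw [Real.log_exp]
        linarith [Real.one_le_exp (by positivity : 0 ≤ b * t)]
      calc (1 : ℝ) ≤ Real.exp (q / (2 * b) * (Real.log 2 + b * t - Real.log (1 + Real.exp (b * t)))) :=
            Real.one_le_exp (mul_nonneg hc.le (by linarith))
        _ = Real.exp (q / (2 * b) * Real.log 2) * Real.exp (q / 2 * t)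
            * Real.exp (-(q / (2 * b)) * Real.log (1 + Real.exp (b * t))) := by
          rw [← Real.exp_add, ← Real.exp_add]
          congr 1
          field_simp
          ring
        _ ≤ _ := by gcongr; linarith
    · have h1 : Real.log (1 + Real.exp (b * t)) ≤ Real.log 2 := by
        refine Real.log_le_log (by positivity) ?_
        linarith [Real.exp_le_one_iff.2 (mul_nonpos_of_nonneg_of_nonpos hb.le ht)]
      calc (1 : ℝ) ≤ Real.exp (q / (2 * b) * (Real.log 2 - Real.log (1 + Real.exp (b * t)))) :=
            Real.one_le_exp (mul_nonneg hc.le (by linarith))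
        _ = Real.exp (q / (2 * b) * Real.log 2) * 1
            * Real.exp (-(q / (2 * b)) * Real.log (1 + Real.exp (b * t))) := by
          rw [mul_one, ← Real.exp_add]
          congr 1
          ring
        _ ≤ _ := by gcongr; linarith

namespace IsLogSolution

variable {n : ℕ} {q lam : ℝ} {W : EuclideanSpace ℝ (Fin (n + 1)) → ℝ}

theorem continuousOn (h : IsLogSolution q lam W) : ContinuousOn W {0}ᶜ :=
  fun x hx => (h.contDiffAt x hx).continuousAt.continuousWithinAt

theorem continuousOn_gradient (h : IsLogSolution q lam W) : ContinuousOn (gradient W) {0}ᶜ :=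
  fun x hx => (h.contDiffAt x hx).gradient.continuousAt.continuousWithinAt

theorem norm_gradient_smul (h : IsLogSolution q lam W) {c : ℝ} (hc : 0 < c)
    {x : EuclideanSpace ℝ (Fin (n + 1))} (hx : x ≠ 0) :
    ‖c • x‖ ^ 2 * ‖gradient W (c • x)‖ ^ 2 = ‖x‖ ^ 2 * ‖gradient W x‖ ^ 2 := by
  rw [h.gradient_smul hx hc, norm_smul, norm_smul]
  ring

theorem pos (h : IsLogSolution q lam W) : 0 < lam := by
  obtain ⟨x, hx, hmax, -⟩ := exists_isLocalMax_of_smul_eq (F := fun y => -1 * W y)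
    (continuousOn_const.mul h.continuousOn) fun c hc x _ => by rw [h.smul c hc]
  obtain ⟨g, hg⟩ := h.laplacian x hx
  obtain ⟨h1, h2⟩ := ((HasJet.const (-1) x).mul hg).of_isLocalMax hmax
  have hg0 : g = 0 := by simpa using h1
  have hE := Real.exp_pos (q * W x)
  simp [hg0] at h2
  linarith

theorem exists_bound {N : ℕ} (hN : 2 ≤ N) {q L : ℝ} (hq : 0 < q) (hNq : ((N : ℝ) - 2) * q < 4)
    (hL : 0 < L) : ∃ K, ∀ lam ≤ L, ∀ W : EuclideanSpace ℝ (Fin (N + 1)) → ℝ,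
      IsLogSolution q lam W → ∀ x, ‖x‖ = 1 → Real.exp (q * W x) ≤ K ∧ ‖gradient W x‖ ^ 2 ≤ K := by
  obtain ⟨b, hb, d, hd, K, hK⟩ := exists_weight_bound (n := N) (by exact_mod_cast hN) hq hNq hL
  obtain ⟨Φ, hΦ, hpos, hle, c, hc, hΦc⟩ := exists_hasDerivAt_logistic_weight hq hb
  obtain ⟨U, hU⟩ : ∃ U, U = 1 + (K * c + K * c) / d := ⟨_, rfl⟩
  refine ⟨max (U ^ 2) (K * c * (1 + U)), fun lam hlam W h x hx => ?_⟩
  obtain ⟨y, hy, hmax, hymax⟩ := exists_isLocalMax_of_smul_eq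
    (F := fun y => Φ (W y) * (‖y‖ ^ 2 * ‖gradient W y‖ ^ 2 + d * Real.exp (q * W y)))
    (by
      have h1 := h.continuousOn
      have h2 := h.continuousOn_gradient
      have h3 : Continuous Φ := continuous_iff_continuousAt.2 fun t => (hΦ t).continuousAt
      exact (h3.comp_continuousOn h1).mul (by fun_prop))
    fun a ha z hz => by rw [h.norm_gradient_smul ha hz, h.smul a ha]
  have hκ (t : ℝ) := (hasDerivAt_logistic b t).const_mul (-(q / 2))
  have hbound := hK (W y) (‖gradient W y‖ ^ 2) (Real.exp (q * W y)) lam _ _ _ rfl rfl rfl rfl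
    (by positivity) h.pos hlam (fun D a hD ha α μ => by
      have := h.ineq_of_isLocalMax hy hΦ hκ (by
        have : ∀ t, 1 + Real.exp (b * t) ≠ 0 := fun t => by positivity
        fun_prop (disch := assumption)) hpos hmax rfl rfl rfl rfl hD ha α μ
      push_cast at this
      linarith)
  have hK0 : 0 ≤ K := le_trans (by positivity) hbound
  have h1 : Φ (W x) * (‖gradient W x‖ ^ 2 + d * Real.exp (q * W x)) ≤ K := by
    have h2 := hymax x hx
    simp only [hx, hy, one_pow, one_mul] at h2
    refine h2.trans (le_trans ?_ hbound)
    exact mul_le_of_le_one_left (by positivity) (hle _)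
  have h2 : ‖gradient W x‖ ^ 2 + d * Real.exp (q * W x) ≤ K * c * (1 + Real.exp (q / 2 * W x)) := by
    have h3 := mul_le_mul_of_nonneg_right (hΦc (W x))
      (by positivity : 0 ≤ ‖gradient W x‖ ^ 2 + d * Real.exp (q * W x))
    have h4 := mul_le_mul_of_nonneg_left h1
      (by positivity : 0 ≤ c * (1 + Real.exp (q / 2 * W x)))
    linarith
  have hsq : Real.exp (q * W x) = Real.exp (q / 2 * W x) ^ 2 := by
    rw [← Real.exp_nat_mul]; congr 1; push_cast; ring
  have hE := Real.exp_pos (q / 2 * W x)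
  have hg : 0 ≤ ‖gradient W x‖ ^ 2 := by positivity
  have hEU : Real.exp (q / 2 * W x) ≤ U := by
    rw [hU]
    refine le_of_mul_sq_le hd (by positivity) (by positivity) ?_
    rw [← hsq]
    linarith
  refine ⟨le_max_of_le_left ?_, le_max_of_le_right ?_⟩
  · rw [hsq]; gcongr
  · have h5 : K * c * (1 + Real.exp (q / 2 * W x)) ≤ K * c * (1 + U) := by gcongr
    have : 0 ≤ d * Real.exp (q * W x) := by positivity
    linarith

end IsLogSolution

theorem exists_norm_eq_one_inner_eq_zero {n : ℕ} (hn : 2 ≤ n)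
    (x y : EuclideanSpace ℝ (Fin (n + 1))) :
    ∃ z : EuclideanSpace ℝ (Fin (n + 1)), ‖z‖ = 1 ∧ inner ℝ x z = 0 ∧ inner ℝ y z = 0 := by
  have hne : (Submodule.span ℝ {x, y})ᗮ ≠ ⊥ := by
    intro h0
    have h1 := (Submodule.span ℝ {x, y}).finrank_add_finrank_orthogonal
    have h2 := finrank_span_le_card (R := ℝ) ({x, y} : Set (EuclideanSpace ℝ (Fin (n + 1))))
    have h3 : ({x, y} : Set (EuclideanSpace ℝ (Fin (n + 1)))).toFinset.card ≤ 2 := by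
      rw [Set.toFinset_insert, Set.toFinset_singleton]
      exact Finset.card_le_two
    rw [h0, finrank_bot, finrank_euclideanSpace_fin] at h1
    omega
  obtain ⟨z, hz, hz0⟩ := Submodule.exists_mem_ne_zero_of_ne_bot hne
  rw [Submodule.mem_orthogonal] at hz
  refine ⟨‖z‖⁻¹ • z, norm_smul_inv_norm (𝕜 := ℝ) hz0, ?_, ?_⟩
  · rw [inner_smul_right, hz x (Submodule.subset_span (by simp)), mul_zero]
  · rw [inner_smul_right, hz y (Submodule.subset_span (by simp)), mul_zero]

namespace IsLogSolution

variable {n : ℕ} {q lam K : ℝ} {W : EuclideanSpace ℝ (Fin (n + 1)) → ℝ}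
  {x y : EuclideanSpace ℝ (Fin (n + 1))}

theorem abs_sub_le_of_inner_eq_zero (h : IsLogSolution q lam W)
    (hK : ∀ x, ‖x‖ = 1 → ‖gradient W x‖ ^ 2 ≤ K) (hx : ‖x‖ = 1) (hy : ‖y‖ = 1)
    (hxy : inner ℝ x y = 0) : |W y - W x| ≤ 2 * √K := by
  have hseg (z) (hz : z ∈ segment ℝ x y) : 1 / 2 ≤ ‖z‖ ^ 2 := by
    obtain ⟨a, b, ha, hb, hab, rfl⟩ := hz
    rw [norm_add_sq_real, inner_smul_left, inner_smul_right, hxy, norm_smul, norm_smul, hx, hy,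
      Real.norm_of_nonneg ha, Real.norm_of_nonneg hb]
    obtain rfl : b = 1 - a := by linarith
    simp only [mul_zero, mul_one, add_zero]
    nlinarith [sq_nonneg (a - 1 / 2)]
  have hne (z) (hz : z ∈ segment ℝ x y) : z ≠ 0 := by
    rintro rfl
    have := hseg 0 hz
    norm_num at this
  have hd (z) (hz : z ∈ segment ℝ x y) :
      HasFDerivWithinAt W (innerSL ℝ (gradient W z)) (segment ℝ x y) z :=
    (h.hasJet (hne z hz)).hasFDerivAt.hasFDerivWithinAt
  have hb (z) (hz : z ∈ segment ℝ x y) : ‖innerSL ℝ (gradient W z)‖ ≤ √(2 * K) := by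
    rw [innerSL_apply_norm]
    refine Real.le_sqrt_of_sq_le ?_
    have h1 := h.norm_gradient_smul (inv_pos.2 (norm_pos_iff.2 (hne z hz))) (hne z hz)
    have hn : ‖‖z‖⁻¹ • z‖ = 1 := norm_smul_inv_norm (𝕜 := ℝ) (hne z hz)
    have h2 := hK _ hn
    rw [hn, one_pow, one_mul] at h1
    rw [h1] at h2
    have := mul_le_mul_of_nonneg_right (hseg z hz) (sq_nonneg ‖gradient W z‖)
    linarith
  have := (convex_segment x y).norm_image_sub_le_of_norm_hasFDerivWithin_le hd hb
    (left_mem_segment ℝ x y) (right_mem_segment ℝ x y)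
  rw [Real.norm_eq_abs] at this
  refine this.trans (le_of_eq ?_)
  have h2 : ‖y - x‖ = √2 := by
    rw [← Real.sqrt_sq (norm_nonneg _), norm_sub_sq_real, real_inner_comm, hxy, hx, hy]
    norm_num
  rw [h2, Real.sqrt_mul (by norm_num)]
  linear_combination √K * Real.mul_self_sqrt (by norm_num : (0 : ℝ) ≤ 2)

theorem abs_sub_le (hn : 2 ≤ n) (h : IsLogSolution q lam W)
    (hK : ∀ x, ‖x‖ = 1 → ‖gradient W x‖ ^ 2 ≤ K) (hx : ‖x‖ = 1) (hy : ‖y‖ = 1) :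
    |W y - W x| ≤ 4 * √K := by
  obtain ⟨z, hz, hxz, hyz⟩ := exists_norm_eq_one_inner_eq_zero hn x y
  have h1 := h.abs_sub_le_of_inner_eq_zero hK hx hz hxz
  have h2 := h.abs_sub_le_of_inner_eq_zero hK hy hz hyz
  rw [abs_le] at *
  constructor <;> linarith

theorem exists_one_le_mul_exp (hn : 2 ≤ n) (h : IsLogSolution q lam W)
    (hW : ∃ x y, ‖x‖ = 1 ∧ ‖y‖ = 1 ∧ W x ≠ W y) : ∃ x, ‖x‖ = 1 ∧ 1 ≤ q * Real.exp (q * W x) := by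
  obtain ⟨x, hx, hmax, hle⟩ := exists_isLocalMax_of_smul_eq
    (F := fun y => (1 : ℝ) * (‖y‖ ^ 2 * ‖gradient W y‖ ^ 2 + 0 * Real.exp (q * W y)))
    (by
      have h1 := h.continuousOn
      have h2 := h.continuousOn_gradient
      fun_prop)
    fun c hc z hz => by rw [h.norm_gradient_smul hc hz, h.smul c hc]
  refine ⟨x, hx, ?_⟩
  have key := h.ineq_of_isLocalMax hx (Φ := fun _ => 1) (κ := fun _ => 0) (κ' := fun _ => 0)
    (fun t => by simpa using hasDerivAt_const t (1 : ℝ)) (fun t => hasDerivAt_const t (0 : ℝ))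
    continuous_const (fun _ => one_pos) hmax rfl rfl rfl rfl rfl (a := 0) (by ring) 0 0
  have hg : 0 < ‖gradient W x‖ ^ 2 := by
    refine lt_of_le_of_ne (by positivity) fun h0 => ?_
    obtain ⟨y, z, hy, hz, hyz⟩ := hW
    have := h.abs_sub_le hn (K := 0) (fun w hw => by simpa [hx, hw, ← h0] using hle w hw) hz hy
    simp [sub_eq_zero, hyz] at this
  have hn' : (2 : ℝ) ≤ n := by exact_mod_cast hn
  push_cast at key
  have h2 : ‖gradient W x‖ ^ 2 * (2 * (n - 1) - 2 * (q * Real.exp (q * W x))) ≤ 0 := by linarith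
  linarith [nonpos_of_mul_nonpos_right h2 hg]

/-- Two-sided a priori bounds for non-constant solutions. -/
theorem exists_bounds {N : ℕ} (hN : 2 ≤ N) {q L : ℝ} (hq : 0 < q)
    (hNq : ((N : ℝ) - 2) * q < 4) (hL : 0 < L) :
    ∃ K, ∀ lam ≤ L, ∀ W : EuclideanSpace ℝ (Fin (N + 1)) → ℝ, IsLogSolution q lam W →
      (∃ x y, ‖x‖ = 1 ∧ ‖y‖ = 1 ∧ W x ≠ W y) → ∀ x, ‖x‖ = 1 → |W x| ≤ K := by
  obtain ⟨K, hK⟩ := exists_bound hN hq hNq hL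
  refine ⟨max (Real.log K / q) (Real.log q / q + 4 * √K), fun lam hlam W h hW x hx => ?_⟩
  obtain ⟨y, hy, hqy⟩ := h.exists_one_le_mul_exp hN hW
  have h1 := abs_le.1 (h.abs_sub_le hN (fun z hz => (hK lam hlam W h z hz).2) hy hx)
  have h2 : -(Real.log q / q) ≤ W y := by
    have := Real.log_le_log one_pos hqy
    rw [Real.log_one, Real.log_mul hq.ne' (Real.exp_pos _).ne', Real.log_exp] at this
    rw [← neg_div, div_le_iff₀ hq]
    linarith
  have h3 : W x ≤ Real.log K / q := by
    have := Real.log_le_log (Real.exp_pos _) (hK lam hlam W h x hx).1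
    rw [Real.log_exp] at this
    rw [le_div_iff₀ hq]
    linarith
  rw [abs_le]
  constructor
  · have := le_max_right (Real.log K / q) (Real.log q / q + 4 * √K)
    linarith
  · exact h3.trans (le_max_left _ _)

end IsLogSolution

theorem isLogSolution_log {m : ℕ} {p lam : ℝ} {v : EuclideanSpace ℝ (Fin m) → ℝ}
    (hv : ContDiffOn ℝ 2 (fun x => v (‖x‖⁻¹ • x)) {x | x ≠ 0})
    (hpos : ∀ θ ∈ Metric.sphere (0 : EuclideanSpace ℝ (Fin m)) 1, 0 < v θ)
    (heq : ∀ θ ∈ Metric.sphere (0 : EuclideanSpace ℝ (Fin m)) 1,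
      -(sphLaplacian v θ) = v θ ^ p - lam * v θ) :
    IsLogSolution (p - 1) lam fun x => Real.log (v (‖x‖⁻¹ • x)) := by
  have hpos' (x) (hx : x ≠ 0) : 0 < v (‖x‖⁻¹ • x) :=
    hpos _ (mem_sphere_zero_iff_norm.2 (norm_smul_inv_norm (𝕜 := ℝ) hx))
  have hcd (x) (hx : x ≠ 0) : ContDiffAt ℝ 2 (fun x => Real.log (v (‖x‖⁻¹ • x))) x :=
    (hv.contDiffAt (isOpen_ne.mem_nhds hx)).log (hpos' x hx).ne'
  refine ⟨hcd, fun c hc x => ?_, fun x hx => ?_⟩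
  · simp only [norm_smul, Real.norm_of_nonneg hc.le, smul_smul, mul_inv]
    congr 3
    field_simp
  · have hx0 : x ≠ 0 := norm_ne_zero_iff.1 (hx ▸ one_ne_zero)
    obtain ⟨g, L, hjet⟩ : ∃ g L, HasJet (fun x => Real.log (v (‖x‖⁻¹ • x))) x g L :=
      ⟨_, _, (hcd x hx0).hasJet⟩
    have hV := (hjet.comp Real.hasDerivAt_exp Real.hasDerivAt_exp).congr
      (f₂ := fun x => v (‖x‖⁻¹ • x)) (by
        filter_upwards [isOpen_ne.mem_nhds hx0] with y hy using (Real.exp_log (hpos' y hy)).symm)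
    have hvx : 0 < v x := hpos x (mem_sphere_zero_iff_norm.2 hx)
    have h1 := heq x (mem_sphere_zero_iff_norm.2 hx)
    rw [sphLaplacian, hV.eLaplacian_eq] at h1
    refine ⟨g, ?_⟩
    convert hjet using 1
    simp only [hx, inv_one, one_smul, Real.exp_log hvx] at h1 ⊢
    rw [mul_comm, ← Real.rpow_def_of_pos hvx, Real.rpow_sub_one hvx.ne']
    field_simp
    linarith

end

theorem stmt6 (N : ℕ) (hN : 2 ≤ N) (p : ℝ) (hp1 : 1 < p)
    (hp2 : 3 ≤ N → p < ((N : ℝ) + 2) / ((N : ℝ) - 2)) :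
    ∀ Λ : ℝ, 0 < Λ → ∃ C : ℝ, 0 < C ∧
      ∀ (lam : ℝ) (v : EuclideanSpace ℝ (Fin (N + 1)) → ℝ),
        lam ≤ Λ →
        ContDiffOn ℝ 2 (fun x => v (‖x‖⁻¹ • x)) {x | x ≠ 0} →
        (∀ θ ∈ Metric.sphere (0 : EuclideanSpace ℝ (Fin (N + 1))) 1, 0 < v θ) →
        (¬ ∀ θ ∈ Metric.sphere (0 : EuclideanSpace ℝ (Fin (N + 1))) 1,
            ∀ θ' ∈ Metric.sphere (0 : EuclideanSpace ℝ (Fin (N + 1))) 1, v θ = v θ') →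
        (∀ θ ∈ Metric.sphere (0 : EuclideanSpace ℝ (Fin (N + 1))) 1,
          -(sphLaplacian v θ) = v θ ^ p - lam * v θ) →
        ∀ θ ∈ Metric.sphere (0 : EuclideanSpace ℝ (Fin (N + 1))) 1,
          1 / C ≤ v θ ∧ v θ ≤ C := by
  intro Λ hΛ
  have hNp : ((N : ℝ) - 2) * (p - 1) < 4 := by
    rcases hN.eq_or_lt with rfl | hN3
    · norm_num
    · have hN' : (0 : ℝ) < N - 2 := sub_pos.2 (by exact_mod_cast hN3)
      have := (lt_div_iff₀ hN').1 (hp2 hN3)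
      linarith
  obtain ⟨K, hK⟩ := IsLogSolution.exists_bounds hN (sub_pos.2 hp1) hNp hΛ
  refine ⟨Real.exp K, Real.exp_pos K, fun lam v hlam hv hpos hne heq θ hθ => ?_⟩
  have hθ1 : ‖θ‖ = 1 := by simpa using hθ
  have hbound := hK lam hlam _ (isLogSolution_log hv hpos heq) (by
    push Not at hne
    obtain ⟨x, hx, y, hy, hxy⟩ := hne
    refine ⟨x, y, by simpa using hx, by simpa using hy, fun h => hxy ?_⟩
    rw [mem_sphere_zero_iff_norm] at hx hy
    simp only [hx, hy, inv_one, one_smul] at h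
    exact Real.log_injOn_pos (hpos x (by simpa using hx)) (hpos y (by simpa using hy)) h) θ hθ1
  simp only [hθ1, inv_one, one_smul] at hbound
  obtain ⟨h1, h2⟩ := abs_le.1 hbound
  rw [one_div, ← Real.exp_neg]
  exact ⟨(Real.le_log_iff_exp_le (hpos θ hθ)).1 h1, (Real.log_le_iff_le_exp (hpos θ hθ)).1 h2⟩
end

section
/- Let n ≥ 3. Let g : (S^n \ {n}) × (0,∞) → ℝ be continuous with g(·,s) bounded from below on S^n \ {n} for each s ∈ (0,∞), and suppose: (g1) there is a function G with g(θ,s) = G(θ_{n+1}, s) for all θ and s; (g2) for each s > 0, the map t ↦ G(t,s) is strictly increasing; (g3) for each t ∈ (−1,1), the map s ↦ s^{−(n+2)/(n−2)} G(t,s) is non-increasing on (0,∞); (g4) for each t ∈ (−1,1), the map s ↦ G(t,s) is non-decreasing on (0,∞). If v ∈ C²(S^n \ {n}) is positive, satisfies −L_{S^n} v(θ) = g(θ, v(θ)) for all θ ∈ S^n \ {n}, and liminf_{θ → n} v(θ) > 0, then v is rotationally symmetric about the line through n and s. -/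
open scoped BigOperators

open Filter Topology Set Metric

lemma eLaplacian_eq_sum_fderiv {m : ℕ} (u : EuclideanSpace ℝ (Fin m) → ℝ)
    (x : EuclideanSpace ℝ (Fin m)) :
    eLaplacian u x = ∑ i : Fin m, fderiv ℝ (fderiv ℝ u) x (EuclideanSpace.single i 1)
      (EuclideanSpace.single i 1) := by
  simp [eLaplacian, iteratedFDeriv_two_apply]

lemma eLaplacian_eq_laplacian {m : ℕ} (u : EuclideanSpace ℝ (Fin m) → ℝ)
    (x : EuclideanSpace ℝ (Fin m)) : eLaplacian u x = Laplacian.laplacian u x := by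
  rw [InnerProductSpace.laplacian_eq_iteratedFDeriv_orthonormalBasis u
    (EuclideanSpace.basisFun (Fin m) ℝ)]
  simp [eLaplacian]

lemma eLaplacian_sub {m : ℕ} {u w : EuclideanSpace ℝ (Fin m) → ℝ} {x : EuclideanSpace ℝ (Fin m)}
    (hu : ContDiffAt ℝ 2 u x) (hw : ContDiffAt ℝ 2 w x) :
    eLaplacian (fun y => u y - w y) x = eLaplacian u x - eLaplacian w x := by
  simp only [eLaplacian_eq_laplacian]
  exact hu.laplacian_sub hw

lemma eLaplacian_const_mul {m : ℕ} {u : EuclideanSpace ℝ (Fin m) → ℝ}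
    {x : EuclideanSpace ℝ (Fin m)} (c : ℝ) (hu : ContDiffAt ℝ 2 u x) :
    eLaplacian (fun y => c * u y) x = c * eLaplacian u x := by
  simp only [eLaplacian_eq_laplacian]
  exact InnerProductSpace.laplacian_smul c hu

section SecondDerivative

variable {E F G : Type*} [NormedAddCommGroup E] [NormedSpace ℝ E] [NormedAddCommGroup F]
  [NormedSpace ℝ F] [NormedAddCommGroup G] [NormedSpace ℝ G]

lemma ContDiffAt.differentiableAt_fderiv_of_two {f : E → F} {x : E} (hf : ContDiffAt ℝ 2 f x) :
    DifferentiableAt ℝ (fderiv ℝ f) x :=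
  (hf.fderiv_right (m := 1) (by norm_num)).differentiableAt (by norm_num)

lemma ContDiffAt.eventually_differentiableAt_of_two {f : E → F} {x : E}
    (hf : ContDiffAt ℝ 2 f x) : ∀ᶠ y in 𝓝 x, DifferentiableAt ℝ f y :=
  (hf.eventually (by simp)).mono fun _ hy => hy.differentiableAt (by norm_num)

lemma fderiv_fderiv_comp {f : F → G} {y : E → F} {x : E} (hf : ContDiffAt ℝ 2 f (y x))
    (hy : ContDiffAt ℝ 2 y x) (a b : E) :
    fderiv ℝ (fderiv ℝ (fun z => f (y z))) x a b =
      fderiv ℝ (fderiv ℝ f) (y x) (fderiv ℝ y x a) (fderiv ℝ y x b) +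
        fderiv ℝ f (y x) (fderiv ℝ (fderiv ℝ y) x a b) := by
  have h : fderiv ℝ (fun z => f (y z)) =ᶠ[𝓝 x]
      fun z => (fderiv ℝ f (y z)).comp (fderiv ℝ y z) := by
    filter_upwards [hy.continuousAt.eventually hf.eventually_differentiableAt_of_two,
      hy.eventually_differentiableAt_of_two] with z h1 h2
    exact fderiv_comp z h1 h2
  rw [h.fderiv_eq]
  have hy1 := (hy.differentiableAt (by norm_num)).hasFDerivAt
  have h1 : HasFDerivAt (fun z => fderiv ℝ f (y z))
      ((fderiv ℝ (fderiv ℝ f) (y x)).comp (fderiv ℝ y x)) x :=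
    HasFDerivAt.comp x hf.differentiableAt_fderiv_of_two.hasFDerivAt hy1
  rw [(h1.clm_comp hy.differentiableAt_fderiv_of_two.hasFDerivAt).fderiv]
  simp [add_comm]

lemma fderiv_fderiv_mul {f g : E → ℝ} {x : E} (hf : ContDiffAt ℝ 2 f x)
    (hg : ContDiffAt ℝ 2 g x) (a b : E) :
    fderiv ℝ (fderiv ℝ (fun z => f z * g z)) x a b =
      f x * fderiv ℝ (fderiv ℝ g) x a b + fderiv ℝ f x a * fderiv ℝ g x b +
        fderiv ℝ g x a * fderiv ℝ f x b + g x * fderiv ℝ (fderiv ℝ f) x a b := by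
  have h : fderiv ℝ (fun z => f z * g z) =ᶠ[𝓝 x]
      fun z => f z • fderiv ℝ g z + g z • fderiv ℝ f z := by
    filter_upwards [hf.eventually_differentiableAt_of_two,
      hg.eventually_differentiableAt_of_two] with z h1 h2
    exact fderiv_mul h1 h2
  rw [h.fderiv_eq]
  have hf1 := (hf.differentiableAt (by norm_num)).hasFDerivAt
  have hg1 := (hg.differentiableAt (by norm_num)).hasFDerivAt
  rw [((hf1.fun_smul hg.differentiableAt_fderiv_of_two.hasFDerivAt).fun_add
    (hg1.fun_smul hf.differentiableAt_fderiv_of_two.hasFDerivAt)).fderiv]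
  simp
  ring

lemma fderiv_smul_of_homogeneous {f : E → F} {α : ℝ}
    (hf : ∀ x : E, ∀ s : ℝ, 0 < s → f (s • x) = s ^ α • f x) {s : ℝ} (hs : 0 < s) (x : E) :
    fderiv ℝ f (s • x) = s ^ (α - 1) • fderiv ℝ f x := by
  have h1 : fderiv ℝ (fun y => f (s • y)) x = s • fderiv ℝ f (s • x) := fderiv_comp_smul s
  have h2 : (fun y => f (s • y)) = s ^ α • f := by
    funext y; exact hf y s hs
  rw [h2, fderiv_const_smul_field] at h1
  rw [Real.rpow_sub_one hs.ne', div_eq_inv_mul, mul_smul, Pi.smul_apply] at *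
  rw [h1, smul_smul, inv_mul_cancel₀ hs.ne', one_smul]

lemma fderiv_apply_self_of_homogeneous {f : E → F} {α : ℝ}
    (hf : ∀ x : E, ∀ s : ℝ, 0 < s → f (s • x) = s ^ α • f x) {x : E}
    (hx : DifferentiableAt ℝ f x) : fderiv ℝ f x x = α • f x := by
  have h1 : HasDerivAt (fun s : ℝ => s • x) x 1 := by
    simpa using (hasDerivAt_id (1 : ℝ)).smul_const x
  have h2 : HasDerivAt (fun s : ℝ => f (s • x)) (fderiv ℝ f x x) 1 := by
    have : HasFDerivAt f (fderiv ℝ f x) ((1 : ℝ) • x) := by simpa using hx.hasFDerivAt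
    exact this.comp_hasDerivAt 1 h1
  have h3 : HasDerivAt (fun s : ℝ => s ^ α • f x) (α • f x) 1 := by
    simpa using (Real.hasDerivAt_rpow_const (x := 1) (p := α) (Or.inl one_ne_zero)).smul_const (f x)
  refine h2.unique (h3.congr_of_eventuallyEq ?_)
  filter_upwards [lt_mem_nhds (zero_lt_one (α := ℝ))] with s hs
  exact hf x s hs

end SecondDerivative

lemma eLaplacian_smul_of_homogeneous {m : ℕ} {u : EuclideanSpace ℝ (Fin m) → ℝ} {α : ℝ}
    (hu : ∀ x, ∀ s : ℝ, 0 < s → u (s • x) = s ^ α * u x) {s : ℝ} (hs : 0 < s)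
    (x : EuclideanSpace ℝ (Fin m)) :
    eLaplacian u (s • x) = s ^ (α - 2) * eLaplacian u x := by
  simp only [eLaplacian_eq_sum_fderiv]
  have h : ∀ x, ∀ s : ℝ, 0 < s → fderiv ℝ u (s • x) = s ^ (α - 1) • fderiv ℝ u x :=
    fun x s hs => fderiv_smul_of_homogeneous (by simpa using hu) hs x
  rw [fderiv_smul_of_homogeneous h hs, Finset.mul_sum]
  simp only [smul_apply, smul_eq_mul]
  ring_nf

lemma sum_inner_single_mul_inner_single {m : ℕ} (x y : EuclideanSpace ℝ (Fin m)) :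
    ∑ i, inner ℝ x (EuclideanSpace.single i (1 : ℝ)) *
      inner ℝ y (EuclideanSpace.single i (1 : ℝ)) = inner ℝ x y := by
  rw [← (EuclideanSpace.basisFun (Fin m) ℝ).sum_inner_mul_inner x y]
  simp [EuclideanSpace.inner_single_right, EuclideanSpace.inner_single_left]

lemma sum_inner_single_smul_single {m : ℕ} (x : EuclideanSpace ℝ (Fin m)) :
    ∑ i, inner ℝ x (EuclideanSpace.single i (1 : ℝ)) • EuclideanSpace.single i (1 : ℝ) = x := by
  conv_rhs => rw [← (EuclideanSpace.basisFun (Fin m) ℝ).sum_repr x]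
  simp [EuclideanSpace.inner_single_right]

lemma hasFDerivAt_norm_rpow_of_ne_zero {E : Type*} [NormedAddCommGroup E] [InnerProductSpace ℝ E]
    (α : ℝ) {x : E} (hx : x ≠ 0) :
    HasFDerivAt (fun z : E => ‖z‖ ^ α) ((α * ‖x‖ ^ (α - 2)) • innerSL ℝ x) x := by
  have h := (hasStrictFDerivAt_norm_sq x).hasFDerivAt.rpow_const (p := α / 2)
    (Or.inl (by positivity))
  have e : ∀ (z : E) (β : ℝ), (‖z‖ ^ 2) ^ β = ‖z‖ ^ (2 * β) := by
    intro z β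
    rw [Real.rpow_mul (norm_nonneg z)]; norm_num
  simp only [e] at h
  convert h using 1
  · funext z; congr 1; ring
  · rw [← Nat.cast_smul_eq_nsmul ℝ, smul_smul]
    congr 1
    rw [show 2 * (α / 2 - 1) = α - 2 by ring]
    push_cast
    ring

lemma contDiffAt_norm_rpow {E : Type*} [NormedAddCommGroup E] [InnerProductSpace ℝ E]
    (α : ℝ) {x : E} (hx : x ≠ 0) : ContDiffAt ℝ 2 (fun z : E => ‖z‖ ^ α) x :=
  (contDiffAt_norm ℝ hx).rpow_const_of_ne (norm_ne_zero_iff.2 hx)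

lemma fderiv_fderiv_norm_rpow {E : Type*} [NormedAddCommGroup E] [InnerProductSpace ℝ E]
    (α : ℝ) {x : E} (hx : ‖x‖ = 1) (a b : E) :
    fderiv ℝ (fderiv ℝ (fun z : E => ‖z‖ ^ α)) x a b =
      α * (α - 2) * inner ℝ x a * inner ℝ x b + α * inner ℝ a b := by
  have hx0 : x ≠ 0 := by rintro rfl; simp at hx
  have h : fderiv ℝ (fun z : E => ‖z‖ ^ α) =ᶠ[𝓝 x]
      fun z => (α * ‖z‖ ^ (α - 2)) • innerSL ℝ z := by
    filter_upwards [isOpen_ne.mem_nhds hx0] with z hz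
    exact (hasFDerivAt_norm_rpow_of_ne_zero α hz).fderiv
  rw [h.fderiv_eq, (((hasFDerivAt_norm_rpow_of_ne_zero (α - 2) hx0).const_mul α).fun_smul
    (innerSL ℝ : E →L[ℝ] E →L[ℝ] ℝ).hasFDerivAt).fderiv]
  have e : ∀ u w, (innerSL ℝ : E →L[ℝ] E →L[ℝ] ℝ) u w = inner ℝ u w := fun _ _ => rfl
  simp [hx, e]
  ring

/-- The conformal Laplacian: multiplying a function which is homogeneous of degree zero by a
power of the norm adds a zeroth order term to its Laplacian on the unit sphere. -/
lemma eLaplacian_norm_rpow_mul {m : ℕ} (α : ℝ) {u : EuclideanSpace ℝ (Fin m) → ℝ}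
    {x : EuclideanSpace ℝ (Fin m)} (hu : ∀ x, ∀ s : ℝ, 0 < s → u (s • x) = u x)
    (hux : ContDiffAt ℝ 2 u x) (hx : ‖x‖ = 1) :
    eLaplacian (fun z => ‖z‖ ^ α * u z) x = eLaplacian u x + α * (α + m - 2) * u x := by
  have hx0 : x ≠ 0 := by rintro rfl; simp at hx
  have hE : fderiv ℝ u x x = 0 := by
    simpa using fderiv_apply_self_of_homogeneous (α := 0) (by simpa using hu)
      (hux.differentiableAt (by norm_num))
  simp only [eLaplacian_eq_sum_fderiv, fderiv_fderiv_mul (contDiffAt_norm_rpow α hx0) hux,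
    fderiv_fderiv_norm_rpow α hx, (hasFDerivAt_norm_rpow_of_ne_zero α hx0).fderiv]
  simp only [Finset.sum_add_distrib, hx, Real.one_rpow, mul_one, one_mul,
    smul_apply, innerSL_apply_apply, smul_eq_mul, mul_add]
  have h1 := sum_inner_single_mul_inner_single x x
  rw [real_inner_self_eq_norm_sq, hx] at h1
  have h2 : ∑ i, inner ℝ x (EuclideanSpace.single i (1 : ℝ)) *
      fderiv ℝ u x (EuclideanSpace.single i (1 : ℝ)) = 0 := by
    have h := congrArg (fderiv ℝ u x) (sum_inner_single_smul_single x)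
    simpa only [map_sum, map_smul, smul_eq_mul, hE] using h
  have h3 : ∑ i : Fin m, α * inner ℝ x (EuclideanSpace.single i (1 : ℝ)) *
      fderiv ℝ u x (EuclideanSpace.single i (1 : ℝ)) = 0 := by
    simp only [mul_assoc, ← Finset.mul_sum, h2, mul_zero]
  have h4 : ∑ i : Fin m, fderiv ℝ u x (EuclideanSpace.single i (1 : ℝ)) *
      (α * inner ℝ x (EuclideanSpace.single i (1 : ℝ))) = 0 := by
    rw [← h3]; exact Finset.sum_congr rfl fun i _ => by ring
  have h5 : ∑ i : Fin m, u x * (α * (α - 2) * inner ℝ x (EuclideanSpace.single i (1 : ℝ)) *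
      inner ℝ x (EuclideanSpace.single i (1 : ℝ))) = u x * (α * (α - 2)) := by
    simp only [mul_assoc, ← Finset.mul_sum, h1]; ring
  have h6 : ∑ i : Fin m, u x * (α * inner ℝ (EuclideanSpace.single i (1 : ℝ))
      (EuclideanSpace.single i (1 : ℝ))) = m * (u x * α) := by
    simp
  rw [h3, h4, h5, h6]
  ring

lemma eLaplacian_comp {m : ℕ} {f : ℝ → ℝ} {c : EuclideanSpace ℝ (Fin m) → ℝ}
    {x : EuclideanSpace ℝ (Fin m)} (hf : ContDiffAt ℝ 2 f (c x)) (hc : ContDiffAt ℝ 2 c x) :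
    eLaplacian (fun z => f (c z)) x =
      deriv (deriv f) (c x) * (∑ i, fderiv ℝ c x (EuclideanSpace.single i (1 : ℝ)) ^ 2) +
        deriv f (c x) * eLaplacian c x := by
  have h1 : ∀ t s : ℝ, fderiv ℝ f t s = s * deriv f t := fun t s => by simp
  have h2 : ∀ s r : ℝ, fderiv ℝ (fderiv ℝ f) (c x) s r = s * r * deriv (deriv f) (c x) := by
    intro s r
    have e : deriv f = fun t => fderiv ℝ f t 1 := by funext t; simp
    have this := hf.differentiableAt_fderiv_of_two.hasFDerivAt.clm_apply
      (hasFDerivAt_const (1 : ℝ) (c x))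
    have h3 : deriv (deriv f) (c x) = fderiv ℝ (fderiv ℝ f) (c x) 1 1 := by
      rw [e, ← fderiv_apply_one_eq_deriv, this.fderiv]; simp
    rw [h3]
    have := (fderiv ℝ (fderiv ℝ f) (c x)).map_smul s (1 : ℝ)
    simp only [smul_eq_mul, mul_one] at this
    rw [this]
    have := ((fderiv ℝ (fderiv ℝ f) (c x)) 1).map_smul r (1 : ℝ)
    simp only [smul_eq_mul, mul_one] at this
    simp only [smul_apply, this, smul_eq_mul]
    ring
  simp only [eLaplacian_eq_sum_fderiv, fderiv_fderiv_comp hf hc, h1, h2, Finset.sum_add_distrib,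
    Finset.mul_sum]
  congr 1 <;> exact Finset.sum_congr rfl fun i _ => by ring

/-- The conformal Laplacian of a function of the height in the direction `z`. -/
lemma eLaplacian_zonal {m : ℕ} (α : ℝ) {f : ℝ → ℝ} {z x : EuclideanSpace ℝ (Fin m)}
    (hx : ‖x‖ = 1) (hf : ContDiffAt ℝ 2 f (inner ℝ x z)) :
    ContDiffAt ℝ 2 (fun y => ‖y‖ ^ α * f (inner ℝ y z * ‖y‖ ^ (-1 : ℝ))) x ∧
    eLaplacian (fun y => ‖y‖ ^ α * f (inner ℝ y z * ‖y‖ ^ (-1 : ℝ))) x =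
      (‖z‖ ^ 2 - inner ℝ x z ^ 2) * deriv (deriv f) (inner ℝ x z) -
        (m - 1) * inner ℝ x z * deriv f (inner ℝ x z) + α * (α + m - 2) * f (inner ℝ x z) := by
  have hx0 : x ≠ 0 := by rintro rfl; simp at hx
  have hi : ContDiffAt ℝ 2 (fun y : EuclideanSpace ℝ (Fin m) => inner ℝ y z) x :=
    contDiffAt_id.inner ℝ contDiffAt_const
  have hc := hi.mul (contDiffAt_norm_rpow (-1) hx0)
  have hcx : inner ℝ x z * ‖x‖ ^ (-1 : ℝ) = inner ℝ x z := by simp [hx]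
  have hf' : ContDiffAt ℝ 2 f (inner ℝ x z * ‖x‖ ^ (-1 : ℝ)) := by rwa [hcx]
  have hfc : ContDiffAt ℝ 2 (fun y => f (inner ℝ y z * ‖y‖ ^ (-1 : ℝ))) x := hf'.comp x hc
  refine ⟨(contDiffAt_norm_rpow α hx0).mul hfc, ?_⟩
  have hi1 : ∀ y : EuclideanSpace ℝ (Fin m),
      HasFDerivAt (fun y : EuclideanSpace ℝ (Fin m) => inner ℝ y z) (innerSL ℝ z) y := by
    intro y
    have := (innerSL ℝ z).hasFDerivAt (x := y)
    refine this.congr_of_eventuallyEq (Eventually.of_forall fun y => ?_)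
    simp [real_inner_comm]
  have hi2 : fderiv ℝ (fun y : EuclideanSpace ℝ (Fin m) => inner ℝ y z) = fun _ => innerSL ℝ z :=
    funext fun y => (hi1 y).fderiv
  have hxx := sum_inner_single_mul_inner_single x x
  rw [real_inner_self_eq_norm_sq, hx] at hxx
  have hzz := sum_inner_single_mul_inner_single z z
  rw [real_inner_self_eq_norm_sq] at hzz
  have hxz := sum_inner_single_mul_inner_single x z
  have hgrad : ∑ i, fderiv ℝ (fun y => inner ℝ y z * ‖y‖ ^ (-1 : ℝ)) x
      (EuclideanSpace.single i (1 : ℝ)) ^ 2 = ‖z‖ ^ 2 - inner ℝ x z ^ 2 := by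
    have h : ∀ a, fderiv ℝ (fun y => inner ℝ y z * ‖y‖ ^ (-1 : ℝ)) x a =
        inner ℝ z a - inner ℝ x z * inner ℝ x a := by
      intro a
      rw [((hi1 x).fun_mul (hasFDerivAt_norm_rpow_of_ne_zero (-1) hx0)).fderiv]
      simp [hx]
      ring
    have e : ∀ a, (inner ℝ z a - inner ℝ x z * inner ℝ x a) ^ 2 = inner ℝ z a * inner ℝ z a -
      2 * inner ℝ x z * (inner ℝ x a * inner ℝ z a) +
        inner ℝ x z ^ 2 * (inner ℝ x a * inner ℝ x a) := fun a => by ring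
    simp only [h, e, Finset.sum_add_distrib, Finset.sum_sub_distrib, ← Finset.mul_sum, hxx, hzz,
      hxz]
    ring
  have hlap : eLaplacian (fun y => inner ℝ y z * ‖y‖ ^ (-1 : ℝ)) x = -(m - 1) * inner ℝ x z := by
    have h : ∀ a : EuclideanSpace ℝ (Fin m),
        fderiv ℝ (fderiv ℝ (fun y => inner ℝ y z * ‖y‖ ^ (-1 : ℝ))) x a a =
        -2 * (inner ℝ x a * inner ℝ z a) + inner ℝ x z * 3 * (inner ℝ x a * inner ℝ x a) -
          inner ℝ x z * inner ℝ a a := by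
      intro a
      rw [fderiv_fderiv_mul hi (contDiffAt_norm_rpow (-1) hx0), fderiv_fderiv_norm_rpow _ hx,
        (hasFDerivAt_norm_rpow_of_ne_zero (-1) hx0).fderiv, hi2]
      simp [hx]
      ring
    have h1 : ∑ i : Fin m, inner ℝ (EuclideanSpace.single i (1 : ℝ))
      (EuclideanSpace.single i (1 : ℝ)) = (m : ℝ) := by simp
    simp only [eLaplacian_eq_sum_fderiv, h, Finset.sum_add_distrib, Finset.sum_sub_distrib,
      ← Finset.mul_sum, hxx, hxz, h1]
    ring
  rw [eLaplacian_norm_rpow_mul α _ hfc hx, eLaplacian_comp hf' hc, hgrad, hlap, hcx]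
  · ring
  · intro y s hs
    rw [norm_smul, Real.norm_of_nonneg hs.le, real_inner_smul_left, Real.rpow_neg_one,
      Real.rpow_neg_one, mul_inv]
    congr 1
    field_simp

lemma IsLocalMin.eLaplacian_nonneg {m : ℕ} {u : EuclideanSpace ℝ (Fin m) → ℝ}
    {x : EuclideanSpace ℝ (Fin m)} (h : IsLocalMin u x) (hu : ContDiffAt ℝ 2 u x) :
    0 ≤ eLaplacian u x := by
  rw [eLaplacian_eq_sum_fderiv]
  refine Finset.sum_nonneg fun i _ => ?_
  set a : EuclideanSpace ℝ (Fin m) := EuclideanSpace.single i 1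
  have hl : ∀ t : ℝ, HasDerivAt (fun t : ℝ => x + t • a) a t := fun t => by
    simpa using ((hasDerivAt_id t).smul_const a).const_add x
  have hl0 : Tendsto (fun t : ℝ => x + t • a) (𝓝 0) (𝓝 x) := by
    have := (hl 0).continuousAt.tendsto; simpa using this
  set φ : ℝ → ℝ := fun t => u (x + t • a) with hφ
  have hd : deriv φ =ᶠ[𝓝 0] fun t => fderiv ℝ u (x + t • a) a := by
    filter_upwards [hl0.eventually hu.eventually_differentiableAt_of_two] with t ht
    exact (ht.hasFDerivAt.comp_hasDerivAt t (hl t)).deriv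
  have hdd : deriv (deriv φ) 0 = fderiv ℝ (fderiv ℝ u) x a a := by
    rw [hd.deriv_eq]
    have h1 : HasFDerivAt (fderiv ℝ u) (fderiv ℝ (fderiv ℝ u) x) (x + (0 : ℝ) • a) := by
      simpa using hu.differentiableAt_fderiv_of_two.hasFDerivAt
    have h2 : HasDerivAt (fun t : ℝ => fderiv ℝ u (x + t • a)) (fderiv ℝ (fderiv ℝ u) x a) 0 :=
      h1.comp_hasDerivAt 0 (hl 0)
    have h3 := h2.clm_apply (hasDerivAt_const (0 : ℝ) a)
    rw [h3.deriv]
    simp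
  have hmin : IsLocalMin φ 0 := by
    have := hl0.eventually h
    simpa [IsLocalMin, IsMinFilter, hφ] using this
  by_contra! hneg
  rw [← hdd] at hneg
  have hcont : ContinuousAt φ 0 := by
    have : ContinuousAt u (x + (0 : ℝ) • a) := by simpa using hu.continuousAt
    exact ContinuousAt.comp (f := fun t : ℝ => x + t • a) this (hl 0).continuousAt
  have hmax := isLocalMax_of_deriv_deriv_neg hneg hmin.deriv_eq_zero hcont
  have hconst : φ =ᶠ[𝓝 0] fun _ => φ 0 := by
    filter_upwards [hmin, hmax] with t h1 h2 using le_antisymm h2 h1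
  have hz : deriv φ =ᶠ[𝓝 0] fun _ => 0 := by
    filter_upwards [hconst.eventuallyEq_nhds] with t ht
    rw [ht.deriv_eq]; simp
  rw [hz.deriv_eq] at hneg
  simp at hneg

section ConformalReflection

variable {E : Type*} [NormedAddCommGroup E] [InnerProductSpace ℝ E]

/-- If `‖e‖ ^ 2 = 1 + τ ^ 2`, this is the spatial part of the Lorentz reflection in the spacelike
unit vector `(e, τ)`, restricted to the light cone. It induces on the unit sphere the conformal
reflection across the small sphere `⟪x, e⟫ = τ`, with conformal factor the norm of the image. -/
noncomputable def conformalReflection (e : E) (τ : ℝ) (x : E) : E :=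
  x - (2 * (inner ℝ x e - τ * ‖x‖)) • e

lemma conformalReflection_smul (e : E) (τ : ℝ) (x : E) {s : ℝ} (hs : 0 < s) :
    conformalReflection e τ (s • x) = s • conformalReflection e τ x := by
  simp only [conformalReflection, norm_smul, Real.norm_of_nonneg hs.le, real_inner_smul_left,
    smul_sub, smul_smul]
  ring_nf

lemma norm_smul_sub_sq {e x : E} {τ : ℝ} (he : ‖e‖ ^ 2 = 1 + τ ^ 2) (hx : ‖x‖ = 1) :
    ‖τ • x - e‖ ^ 2 = 1 - 2 * τ * (inner ℝ x e - τ) := by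
  rw [norm_sub_sq_real, norm_smul, mul_pow, hx, he, real_inner_smul_left, Real.norm_eq_abs, sq_abs]
  ring

lemma norm_conformalReflection {e x : E} {τ : ℝ} (he : ‖e‖ ^ 2 = 1 + τ ^ 2) (hx : ‖x‖ = 1) :
    ‖conformalReflection e τ x‖ = ‖τ • x - e‖ ^ 2 := by
  rw [← abs_of_nonneg (norm_nonneg (conformalReflection e τ x)),
    ← abs_of_nonneg (sq_nonneg ‖τ • x - e‖), ← sq_eq_sq_iff_abs_eq_abs, norm_smul_sub_sq he hx,
    conformalReflection, norm_sub_sq_real, norm_smul, mul_pow, hx, he, real_inner_smul_right,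
    Real.norm_eq_abs, sq_abs]
  ring

lemma norm_conformalReflection_eq {e x : E} {τ : ℝ} (he : ‖e‖ ^ 2 = 1 + τ ^ 2) (hx : ‖x‖ = 1) :
    ‖conformalReflection e τ x‖ = 1 - 2 * τ * (inner ℝ x e - τ) := by
  rw [norm_conformalReflection he hx, norm_smul_sub_sq he hx]

lemma norm_conformalReflection_pos {e x : E} {τ : ℝ} (he : ‖e‖ ^ 2 = 1 + τ ^ 2) (hx : ‖x‖ = 1) :
    0 < ‖conformalReflection e τ x‖ := by
  rw [norm_conformalReflection he hx]
  have : τ • x - e ≠ 0 := by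
    intro h
    rw [sub_eq_zero] at h
    rw [← h, norm_smul, mul_pow, hx, Real.norm_eq_abs, sq_abs] at he
    linarith
  positivity

lemma norm_normalized_conformalReflection_sub {e x : E} {τ : ℝ} (he : ‖e‖ ^ 2 = 1 + τ ^ 2)
    (hx : ‖x‖ = 1) (hxe : τ ≤ inner ℝ x e) :
    ‖‖conformalReflection e τ x‖⁻¹ • conformalReflection e τ x - x‖ *
      √‖conformalReflection e τ x‖ = 2 * (inner ℝ x e - τ) := by
  have hpos := norm_conformalReflection_pos he hx
  set T := ‖conformalReflection e τ x‖ with hT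
  have hq : ‖τ • x - e‖ = √T := by
    rw [hT, norm_conformalReflection he hx, Real.sqrt_sq (norm_nonneg _)]
  have h1 : conformalReflection e τ x - T • x = (2 * (inner ℝ x e - τ)) • (τ • x - e) := by
    rw [hT, norm_conformalReflection_eq he hx, conformalReflection, hx]
    module
  have h2 : T⁻¹ • conformalReflection e τ x - x = T⁻¹ • (conformalReflection e τ x - T • x) := by
    rw [smul_sub, smul_smul, inv_mul_cancel₀ hpos.ne', one_smul]
  rw [h2, h1, norm_smul, norm_smul, hq, Real.norm_of_nonneg (by positivity),
    Real.norm_of_nonneg (by linarith)]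
  field_simp
  rw [Real.sq_sqrt hpos.le, mul_comm]

lemma contDiffAt_conformalReflection (e : E) (τ : ℝ) {x : E} (hx : x ≠ 0) :
    ContDiffAt ℝ 2 (conformalReflection e τ) x := by
  unfold conformalReflection
  exact contDiffAt_id.sub ((contDiffAt_const.mul ((contDiffAt_id.inner ℝ contDiffAt_const).sub
    (contDiffAt_const.mul (contDiffAt_norm ℝ hx)))).smul contDiffAt_const)

lemma fderiv_conformalReflection (e : E) (τ : ℝ) {x : E} (hx : x ≠ 0) (a : E) :
    fderiv ℝ (conformalReflection e τ) x a =
      a - (2 * inner ℝ a e) • e + (2 * τ * fderiv ℝ (fun z : E => ‖z‖ ^ (1 : ℝ)) x a) • e := by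
  have h1 : HasFDerivAt (fun z : E => ‖z‖ ^ (1 : ℝ)) _ x :=
    ((contDiffAt_norm_rpow 1 hx).differentiableAt (by norm_num)).hasFDerivAt
  have h2 : HasFDerivAt (fun z : E => inner ℝ z e) (innerSL ℝ e) x :=
    (innerSL ℝ e).hasFDerivAt.congr_of_eventuallyEq
      (Eventually.of_forall fun y => by simp [real_inner_comm])
  have h3 := (hasFDerivAt_id x).fun_sub
    (((h2.fun_sub (h1.const_mul τ)).const_mul 2).smul_const e)
  have h4 : conformalReflection e τ =
      fun z => id z - (2 * (inner ℝ z e - τ * ‖z‖ ^ (1 : ℝ))) • e := by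
    funext z; simp [conformalReflection]
  rw [h4, h3.fderiv]
  simp [real_inner_comm]
  module

lemma fderiv_fderiv_conformalReflection {e x : E} (τ : ℝ) (hx : ‖x‖ = 1) (a : E) :
    fderiv ℝ (fderiv ℝ (conformalReflection e τ)) x a a =
      (2 * τ * (inner ℝ a a - inner ℝ x a * inner ℝ x a)) • e := by
  have hx0 : x ≠ 0 := by rintro rfl; simp at hx
  have hd := (contDiffAt_conformalReflection e τ hx0).differentiableAt_fderiv_of_two
  have h1 : fderiv ℝ (fderiv ℝ (conformalReflection e τ)) x a a =
      fderiv ℝ (fun z => fderiv ℝ (conformalReflection e τ) z a) x a := by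
    have := hd.hasFDerivAt.clm_apply (hasFDerivAt_const a x)
    rw [this.fderiv]
    simp
  have h2 : (fun z => fderiv ℝ (conformalReflection e τ) z a) =ᶠ[𝓝 x] fun z =>
      a - (2 * inner ℝ a e) • e + (2 * τ * fderiv ℝ (fun z : E => ‖z‖ ^ (1 : ℝ)) z a) • e := by
    filter_upwards [isOpen_ne.mem_nhds hx0] with z hz
    exact fderiv_conformalReflection e τ hz a
  have h3 : HasFDerivAt (fun z => fderiv ℝ (fun z : E => ‖z‖ ^ (1 : ℝ)) z a) _ x :=
    (contDiffAt_norm_rpow 1 hx0).differentiableAt_fderiv_of_two.hasFDerivAt.clm_apply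
      (hasFDerivAt_const a x)
  have h4 := ((h3.const_mul (2 * τ)).smul_const e).const_add (a - (2 * inner ℝ a e) • e)
  rw [h1, h2.fderiv_eq, h4.fderiv]
  have h5 := fderiv_fderiv_norm_rpow 1 hx a a
  simp only [ContinuousLinearMap.comp_zero, zero_add,
    ContinuousLinearMap.smulRight_apply, smul_apply, ContinuousLinearMap.flip_apply, h5,
    smul_eq_mul]
  congr 1
  ring

end ConformalReflection

/-- Conformal covariance: on the unit sphere, conformal reflections intertwine the Laplacian of
functions of the critical degree of homogeneity. -/
lemma eLaplacian_comp_conformalReflection {m : ℕ} {u : EuclideanSpace ℝ (Fin m) → ℝ} {α : ℝ}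
    (hα : 2 * α = 3 - m) (hu : ∀ x, ∀ s : ℝ, 0 < s → u (s • x) = s ^ α * u x)
    {e x : EuclideanSpace ℝ (Fin m)} {τ : ℝ} (he : ‖e‖ ^ 2 = 1 + τ ^ 2) (hx : ‖x‖ = 1)
    (hux : ContDiffAt ℝ 2 u (conformalReflection e τ x)) :
    eLaplacian (fun z => u (conformalReflection e τ z)) x =
      eLaplacian u (conformalReflection e τ x) := by
  have hx0 : x ≠ 0 := by rintro rfl; simp at hx
  set y := conformalReflection e τ x with hy
  set B := fderiv ℝ (fderiv ℝ u) y with hB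
  set D := fderiv ℝ u y with hD
  set β : EuclideanSpace ℝ (Fin m) → ℝ := fun a => 2 * inner ℝ (τ • x - e) a with hβ
  have hE : B y = (α - 1) • D := fderiv_apply_self_of_homogeneous
    (fun x s hs => fderiv_smul_of_homogeneous (by simpa using hu) hs x)
    hux.differentiableAt_fderiv_of_two
  have hsymm : ∀ a b, B a b = B b a :=
    (hux.isSymmSndFDerivAt (by simp) : IsSymmSndFDerivAt ℝ u y)
  have hY : ∀ a, fderiv ℝ (conformalReflection e τ) x a = a + β a • e := by
    intro a
    rw [fderiv_conformalReflection e τ hx0, (hasFDerivAt_norm_rpow_of_ne_zero 1 hx0).fderiv]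
    simp only [hβ, hx, inner_sub_left, real_inner_smul_left, Real.one_rpow, mul_one,
      smul_apply, innerSL_apply_apply, smul_eq_mul, real_inner_comm a e]
    module
  have hterm : ∀ a, fderiv ℝ (fderiv ℝ (fun z => u (conformalReflection e τ z))) x a a =
      B a a + 2 * (2 * B e (inner ℝ (τ • x - e) a • a)) +
        4 * B e e * (inner ℝ (τ • x - e) a * inner ℝ (τ • x - e) a) +
        2 * τ * D e * (inner ℝ a a - inner ℝ x a * inner ℝ x a) := by
    intro a
    rw [fderiv_fderiv_comp (y := conformalReflection e τ) hux
      (contDiffAt_conformalReflection e τ hx0),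
      fderiv_fderiv_conformalReflection τ hx, hY]
    simp only [map_add, map_smul, add_apply, smul_apply, smul_eq_mul, hβ, ← hy, ← hB, ← hD]
    rw [hsymm a e]
    ring
  have hxx := sum_inner_single_mul_inner_single x x
  rw [real_inner_self_eq_norm_sq, hx] at hxx
  have hqq := sum_inner_single_mul_inner_single (τ • x - e) (τ • x - e)
  rw [real_inner_self_eq_norm_sq, norm_smul_sub_sq he hx] at hqq
  have hm : ∑ i : Fin m, inner ℝ (EuclideanSpace.single i (1 : ℝ))
      (EuclideanSpace.single i (1 : ℝ)) = (m : ℝ) := by simp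
  simp only [eLaplacian_eq_sum_fderiv, hterm, Finset.sum_add_distrib, ← Finset.mul_sum, hqq,
    Finset.sum_sub_distrib, hxx, hm, ← map_sum, sum_inner_single_smul_single]
  have hkey : (τ • x - e) + (1 - 2 * τ * (inner ℝ x e - τ)) • e = τ • y := by
    rw [hy, conformalReflection, hx]
    module
  have h5 : B e (τ • x - e) + (1 - 2 * τ * (inner ℝ x e - τ)) * B e e = τ * ((α - 1) * D e) := by
    have := congrArg (B e) hkey
    rw [map_add, map_smul, map_smul, hsymm e y, hE] at this
    simpa using this
  linear_combination 4 * h5 + 2 * τ * D e * hα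

/-- `u` is the extension, homogeneous of the critical degree `α`, of a solution `v` of
`-L v = g(·, v)` on the unit sphere punctured at `z`, where `L` is the conformal Laplacian and the
nonlinearity `g` increases in the direction of `z` and is at most critical. -/
structure IsConformalSolution {n : ℕ} (z : EuclideanSpace ℝ (Fin (n + 1))) (α : ℝ)
    (u : EuclideanSpace ℝ (Fin (n + 1)) → ℝ)
    (g : EuclideanSpace ℝ (Fin (n + 1)) → ℝ → ℝ) : Prop where
  three_le : 3 ≤ n
  degree : α = -((n : ℝ) - 2) / 2
  norm_pole : ‖z‖ = 1
  homogeneous : ∀ x, ∀ s : ℝ, 0 < s → u (s • x) = s ^ α * u x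
  smooth : ∀ x, inner ℝ x z < ‖x‖ → ContDiffAt ℝ 2 u x
  lower_bound : ∃ c : ℝ, 0 < c ∧ ∀ x, ‖x‖ = 1 → inner ℝ x z < 1 → c ≤ u x
  equation : ∀ x, ‖x‖ = 1 → inner ℝ x z < 1 → eLaplacian u x = -g x (u x)
  continuousOn : ContinuousOn (fun q : EuclideanSpace ℝ (Fin (n + 1)) × ℝ => g q.1 q.2)
    ({x | ‖x‖ = 1 ∧ inner ℝ x z < 1} ×ˢ Ioi (0 : ℝ))
  nonneg : ∀ x, ‖x‖ = 1 → inner ℝ x z < 1 → ∀ s, 0 < s → 0 ≤ g x s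
  lt_of_lt : ∀ x y, ‖x‖ = 1 → ‖y‖ = 1 → inner ℝ x z < inner ℝ y z → inner ℝ y z < 1 →
    ∀ s, 0 < s → g x s < g y s
  subcritical : ∀ x, ‖x‖ = 1 → inner ℝ x z < 1 → ∀ s t, 0 < s → s ≤ t →
    g x t ≤ (t / s) ^ (((n : ℝ) + 2) / ((n : ℝ) - 2)) * g x s

/-- The points of the open cap `τ < ⟪x, e⟫` whose conformal reflection is not a multiple of `z`. -/
def reflectionDomain {E : Type*} [NormedAddCommGroup E] [InnerProductSpace ℝ E] (z e : E) (τ : ℝ) :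
    Set E :=
  {x | ‖x‖ = 1 ∧ τ < inner ℝ x e ∧
    inner ℝ (conformalReflection e τ x) z < ‖conformalReflection e τ x‖}

section

variable {E : Type*} [NormedAddCommGroup E] [InnerProductSpace ℝ E]

lemma ne_zero_of_inner_lt_norm {x z : E} (h : inner ℝ x z < ‖x‖) : x ≠ 0 := by
  rintro rfl; simp at h

lemma inner_lt_one_of_le_inner {x z e : E} {τ : ℝ} (hx : ‖x‖ = 1) (hz : ‖z‖ = 1) (hτ : 0 ≤ τ)
    (hez : inner ℝ e z < -τ) (hxe : τ ≤ inner ℝ x e) : inner ℝ x z < 1 := by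
  rw [inner_lt_one_iff_real_of_norm_eq_one hx hz]
  rintro rfl
  rw [real_inner_comm] at hez
  linarith

lemma norm_normalize {x : E} (hx : x ≠ 0) : ‖‖x‖⁻¹ • x‖ = 1 := by
  simp [norm_smul, hx]

lemma inner_normalize_lt_one {x z : E} (h : inner ℝ x z < ‖x‖) :
    inner ℝ (‖x‖⁻¹ • x) z < 1 := by
  have := norm_pos_iff.2 (ne_zero_of_inner_lt_norm h)
  rwa [real_inner_smul_left, inv_mul_lt_iff₀ this, mul_one]

lemma norm_conformalReflection_le_one {e x : E} {τ : ℝ} (he : ‖e‖ ^ 2 = 1 + τ ^ 2)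
    (hx : ‖x‖ = 1) (hτ : 0 ≤ τ) (hxe : τ ≤ inner ℝ x e) : ‖conformalReflection e τ x‖ ≤ 1 := by
  rw [norm_conformalReflection_eq he hx]
  nlinarith [mul_nonneg hτ (sub_nonneg.2 hxe)]

lemma isLocalMin_of_homogeneous {F : E → ℝ} {α : ℝ}
    (hF : ∀ x, ∀ s : ℝ, 0 < s → F (s • x) = s ^ α * F x) {x : E} (hx : ‖x‖ = 1)
    (h : ∀ᶠ y in 𝓝 x, ‖y‖ = 1 → 0 ≤ F y) (h0 : F x = 0) : IsLocalMin F x := by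
  have hx0 : x ≠ 0 := by rintro rfl; simp at hx
  have hc : Tendsto (fun y : E => ‖y‖⁻¹ • y) (𝓝 x) (𝓝 x) := by
    have : ContinuousAt (fun y : E => ‖y‖⁻¹ • y) x :=
      (continuousAt_id.norm.inv₀ (norm_ne_zero_iff.2 hx0)).smul continuousAt_id
    simpa [ContinuousAt, hx] using this
  filter_upwards [hc.eventually h, isOpen_ne.mem_nhds hx0] with y hy hy0
  have hpos : 0 < ‖y‖ := norm_pos_iff.2 hy0
  rw [h0]
  have := hF (‖y‖⁻¹ • y) ‖y‖ hpos
  rw [smul_smul, mul_inv_cancel₀ hpos.ne', one_smul] at this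
  rw [this]
  exact mul_nonneg (by positivity) (hy (norm_normalize hy0))

@[fun_prop]
lemma continuous_conformalReflection (e : E) (τ : ℝ) : Continuous (conformalReflection e τ) := by
  unfold conformalReflection; fun_prop

lemma eventually_mem_reflectionDomain {z e x : E} {τ : ℝ} (hx : x ∈ reflectionDomain z e τ) :
    ∀ᶠ y in 𝓝 x, ‖y‖ = 1 → y ∈ reflectionDomain z e τ := by
  have h1 : Continuous fun y : E => inner ℝ y e := by fun_prop
  have h2 : Continuous fun y : E => ‖conformalReflection e τ y‖ -
    inner ℝ (conformalReflection e τ y) z := by fun_prop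
  filter_upwards [h1.continuousAt.eventually (lt_mem_nhds hx.2.1),
    h2.continuousAt.eventually (lt_mem_nhds (sub_pos.2 hx.2.2))] with y h3 h4 h5
  exact ⟨h5, h3, sub_pos.1 h4⟩

lemma conformalReflection_of_inner_eq {e x : E} {τ : ℝ} (hx : ‖x‖ = 1) (h : inner ℝ x e = τ) :
    conformalReflection e τ x = x := by
  simp [conformalReflection, hx, h]

end

namespace IsConformalSolution

variable {n : ℕ} {z : EuclideanSpace ℝ (Fin (n + 1))} {α : ℝ}
  {u : EuclideanSpace ℝ (Fin (n + 1)) → ℝ} {g : EuclideanSpace ℝ (Fin (n + 1)) → ℝ → ℝ}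

lemma three_le_cast (hu : IsConformalSolution z α u g) : (3 : ℝ) ≤ n := by
  exact_mod_cast hu.three_le

lemma degree_le (hu : IsConformalSolution z α u g) : α ≤ -(1 / 2) := by
  have := hu.three_le_cast
  rw [hu.degree]; linarith

lemma pos (hu : IsConformalSolution z α u g) {x : EuclideanSpace ℝ (Fin (n + 1))}
    (hx : ‖x‖ = 1) (hxz : inner ℝ x z < 1) : 0 < u x := by
  obtain ⟨c, hc, h⟩ := hu.lower_bound
  exact hc.trans_le (h x hx hxz)

lemma apply_eq_norm_rpow_mul (hu : IsConformalSolution z α u g)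
    {x : EuclideanSpace ℝ (Fin (n + 1))} (hx : x ≠ 0) : u x = ‖x‖ ^ α * u (‖x‖⁻¹ • x) := by
  have := hu.homogeneous (‖x‖⁻¹ • x) ‖x‖ (norm_pos_iff.2 hx)
  rwa [smul_smul, mul_inv_cancel₀ (norm_ne_zero_iff.2 hx), one_smul] at this

lemma lt_neg_eLaplacian_reflection (hu : IsConformalSolution z α u g)
    {e x : EuclideanSpace ℝ (Fin (n + 1))} {τ : ℝ} (he : ‖e‖ ^ 2 = 1 + τ ^ 2) (hτ : 0 ≤ τ)
    (hez : inner ℝ e z < -τ) (hx : x ∈ reflectionDomain z e τ) :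
    0 < u (conformalReflection e τ x) ∧
    g x (u (conformalReflection e τ x)) < -eLaplacian u (conformalReflection e τ x) := by
  obtain ⟨hx1, hxe, hyz⟩ := hx
  have hT := norm_conformalReflection_eq he hx1
  have hT1 := norm_conformalReflection_le_one he hx1 hτ hxe.le
  have hinner : inner ℝ (conformalReflection e τ x) z =
      inner ℝ x z - 2 * (inner ℝ x e - τ) * inner ℝ e z := by
    simp [conformalReflection, hx1, inner_sub_left, real_inner_smul_left]
  set y := conformalReflection e τ x with hy
  have hy0 := ne_zero_of_inner_lt_norm hyz
  have hpos : 0 < ‖y‖ := norm_pos_iff.2 hy0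
  set φ := ‖y‖⁻¹ • y with hφ
  have hφ1 : ‖φ‖ = 1 := norm_normalize hy0
  have hφz : inner ℝ φ z < 1 := inner_normalize_lt_one hyz
  have huy := hu.apply_eq_norm_rpow_mul hy0
  have hs := hu.pos hφ1 hφz
  rw [← hφ] at huy
  have hyφ : y = ‖y‖ • φ := by rw [hφ, smul_smul, mul_inv_cancel₀ hpos.ne', one_smul]
  have hlap : -eLaplacian u y = ‖y‖ ^ (α - 2) * g φ (u φ) := by
    have := eLaplacian_smul_of_homogeneous hu.homogeneous hpos φ
    rw [← hyφ, hu.equation φ hφ1 hφz] at this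
    rw [this]; ring
  have hTα : 1 ≤ ‖y‖ ^ α :=
    Real.one_le_rpow_of_pos_of_le_one_of_nonpos hpos hT1 (by linarith [hu.degree_le])
  have huypos : 0 < u y := by rw [huy]; positivity
  refine ⟨huypos, ?_⟩
  have hle : u φ ≤ u y := by rw [huy]; nlinarith
  have h1 := hu.subcritical φ hφ1 hφz (u φ) (u y) hs hle
  have hn := hu.three_le_cast
  have h2 : (u y / u φ) ^ (((n : ℝ) + 2) / ((n : ℝ) - 2)) = ‖y‖ ^ (α - 2) := by
    rw [huy, mul_div_assoc, div_self hs.ne', mul_one, ← Real.rpow_mul hpos.le, hu.degree]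
    congr 1
    have : (n : ℝ) - 2 ≠ 0 := by linarith
    field_simp
    ring
  rw [h2, ← hlap] at h1
  refine lt_of_lt_of_le (hu.lt_of_lt x φ hx1 hφ1 ?_ hφz _ huypos) h1
  rw [hφ, real_inner_smul_left, ← div_eq_inv_mul, lt_div_iff₀ hpos, hinner, hT]
  have h3 : -1 ≤ inner ℝ x z := by
    have := (abs_le.1 (abs_real_inner_le_norm x z)).1
    rwa [hx1, hu.norm_pole, mul_one] at this
  have h4 : 0 < τ * inner ℝ x z - inner ℝ e z := by nlinarith
  nlinarith [mul_pos (sub_pos.2 hxe) h4]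

lemma degree_eq (hu : IsConformalSolution z α u g) : 2 * α = 3 - ((n + 1 : ℕ) : ℝ) := by
  rw [hu.degree]; push_cast; ring

lemma reflection_homogeneous (hu : IsConformalSolution z α u g)
    (e : EuclideanSpace ℝ (Fin (n + 1))) (τ : ℝ) (x : EuclideanSpace ℝ (Fin (n + 1))) (s : ℝ)
    (hs : 0 < s) :
    u (conformalReflection e τ (s • x)) = s ^ α * u (conformalReflection e τ x) := by
  rw [conformalReflection_smul e τ x hs, hu.homogeneous _ s hs]

lemma lt_of_forall_le (hu : IsConformalSolution z α u g)
    {e x : EuclideanSpace ℝ (Fin (n + 1))} {τ : ℝ} (he : ‖e‖ ^ 2 = 1 + τ ^ 2) (hτ : 0 ≤ τ)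
    (hez : inner ℝ e z < -τ)
    (h : ∀ y ∈ reflectionDomain z e τ, u y ≤ u (conformalReflection e τ y))
    (hx : x ∈ reflectionDomain z e τ) : u x < u (conformalReflection e τ x) := by
  refine lt_of_le_of_ne (h x hx) fun heq => ?_
  have hx0 : x ≠ 0 := by rintro rfl; simpa using hx.1
  have hxz := inner_lt_one_of_le_inner hx.1 hu.norm_pole hτ hez hx.2.1.le
  have hs1 : ContDiffAt ℝ 2 u x := hu.smooth x (by rwa [hx.1])
  have hs2 := hu.smooth _ hx.2.2
  have hs3 : ContDiffAt ℝ 2 (fun y => u (conformalReflection e τ y)) x :=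
    hs2.comp x (contDiffAt_conformalReflection e τ hx0)
  have hmin : IsLocalMin (fun y => u (conformalReflection e τ y) - u y) x := by
    refine isLocalMin_of_homogeneous (α := α) (fun y s hs => ?_) hx.1 ?_ (by rw [heq, sub_self])
    · rw [hu.reflection_homogeneous e τ y s hs, hu.homogeneous y s hs]; ring
    · filter_upwards [eventually_mem_reflectionDomain hx] with y hy hy1
      exact sub_nonneg.2 (h y (hy hy1))
  have h1 := hmin.eLaplacian_nonneg (hs3.sub hs1)
  rw [eLaplacian_sub hs3 hs1, eLaplacian_comp_conformalReflection hu.degree_eq hu.homogeneous he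
    hx.1 hs2, hu.equation x hx.1 hxz] at h1
  have h2 := (hu.lt_neg_eLaplacian_reflection he hτ hez hx).2
  rw [← heq] at h2
  linarith

end IsConformalSolution

/-- The zonal function `x ↦ f ⟪x / ‖x‖, e⟫` extended to be homogeneous of degree `α`. -/
noncomputable def zonalExtension {E : Type*} [NormedAddCommGroup E] [InnerProductSpace ℝ E]
    (α : ℝ) (f : ℝ → ℝ) (e x : E) : ℝ :=
  ‖x‖ ^ α * f (inner ℝ x e * ‖x‖ ^ (-1 : ℝ))

/-- A positive comparison function for reflection across `⟪x, e⟫ = τ ‖x‖`. Its normal derivative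
blows up at the hyperplane, and it is infinite where the reflection of `x` is a multiple of `z`. -/
noncomputable def reflectionBarrier {E : Type*} [NormedAddCommGroup E] [InnerProductSpace ℝ E]
    (α : ℝ) (z e : E) (τ : ℝ) (x : E) : ℝ :=
  zonalExtension α (fun c => 1 + √(c - τ)) e x +
    zonalExtension α (fun c => Real.log 2 - Real.log (1 - c)) z (conformalReflection e τ x)

section

variable {E : Type*} [NormedAddCommGroup E] [InnerProductSpace ℝ E]

lemma zonalExtension_smul (α : ℝ) (f : ℝ → ℝ) (e x : E) {s : ℝ} (hs : 0 < s) :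
    zonalExtension α f e (s • x) = s ^ α * zonalExtension α f e x := by
  simp only [zonalExtension, norm_smul, Real.norm_of_nonneg hs.le, real_inner_smul_left]
  rw [Real.mul_rpow hs.le (norm_nonneg _), Real.mul_rpow hs.le (norm_nonneg _), Real.rpow_neg_one s,
    show s * inner ℝ x e * (s⁻¹ * ‖x‖ ^ (-1 : ℝ)) = inner ℝ x e * ‖x‖ ^ (-1 : ℝ) by field_simp]
  ring

lemma zonalExtension_of_norm_eq_one (α : ℝ) (f : ℝ → ℝ) (e : E) {x : E} (hx : ‖x‖ = 1) :
    zonalExtension α f e x = f (inner ℝ x e) := by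
  simp [zonalExtension, hx]

lemma zonalExtension_eq (α : ℝ) (f : ℝ → ℝ) (e x : E) :
    zonalExtension α f e x = ‖x‖ ^ α * f (inner ℝ (‖x‖⁻¹ • x) e) := by
  rw [zonalExtension, real_inner_smul_left, Real.rpow_neg_one, mul_comm (inner ℝ x e)]

lemma continuousAt_zonalExtension (α : ℝ) {f : ℝ → ℝ} {e x : E} (hx : x ≠ 0)
    (hf : ContinuousAt f (inner ℝ (‖x‖⁻¹ • x) e)) : ContinuousAt (zonalExtension α f e) x := by
  have h : zonalExtension α f e = fun x => ‖x‖ ^ α * f (inner ℝ (‖x‖⁻¹ • x) e) :=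
    funext (zonalExtension_eq α f e)
  rw [h]
  have h0 := norm_ne_zero_iff.2 hx
  have h1 : ContinuousAt (fun x : E => ‖x‖⁻¹ • x) x :=
    (continuousAt_id.norm.inv₀ h0).smul continuousAt_id
  exact (continuousAt_id.norm.rpow_const (Or.inl h0)).mul
    (ContinuousAt.comp (f := fun x : E => inner ℝ (‖x‖⁻¹ • x) e) hf (h1.inner continuousAt_const))

lemma reflectionBarrier_smul (α : ℝ) (z e : E) (τ : ℝ) (x : E) {s : ℝ} (hs : 0 < s) :
    reflectionBarrier α z e τ (s • x) = s ^ α * reflectionBarrier α z e τ x := by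
  rw [reflectionBarrier, conformalReflection_smul _ _ _ hs, zonalExtension_smul _ _ _ _ hs,
    zonalExtension_smul _ _ _ _ hs, reflectionBarrier, mul_add]

lemma reflectionBarrier_eq (α : ℝ) (z e : E) (τ : ℝ) {x : E} (hx : ‖x‖ = 1) :
    reflectionBarrier α z e τ x = 1 + √(inner ℝ x e - τ) + ‖conformalReflection e τ x‖ ^ α *
      (Real.log 2 - Real.log (1 - inner ℝ (‖conformalReflection e τ x‖⁻¹ •
        conformalReflection e τ x) z)) := by
  rw [reflectionBarrier, zonalExtension_of_norm_eq_one _ _ _ hx, zonalExtension_eq]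

lemma continuousAt_reflectionBarrier (α : ℝ) {z e : E} {τ : ℝ} {x : E} (hx : x ≠ 0)
    (hxz : inner ℝ (conformalReflection e τ x) z < ‖conformalReflection e τ x‖) :
    ContinuousAt (reflectionBarrier α z e τ) x := by
  refine (continuousAt_zonalExtension α hx (by fun_prop)).add
    (ContinuousAt.comp (continuousAt_zonalExtension α (ne_zero_of_inner_lt_norm hxz) ?_)
      (continuous_conformalReflection e τ).continuousAt)
  have h : 1 - inner ℝ (‖conformalReflection e τ x‖⁻¹ • conformalReflection e τ x) z ≠ 0 :=
    (sub_pos.2 (inner_normalize_lt_one hxz)).ne'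
  fun_prop (disch := assumption)

lemma log_one_sub_le_log_two {c : ℝ} (h : -1 ≤ c) (h1 : c < 1) :
    Real.log (1 - c) ≤ Real.log 2 :=
  Real.log_le_log (by linarith) (by linarith)

lemma neg_one_le_inner_of_norm_eq_one {x z : E} (hx : ‖x‖ = 1) (hz : ‖z‖ = 1) :
    -1 ≤ inner ℝ x z := by
  have := (abs_le.1 (abs_real_inner_le_norm x z)).1
  rwa [hx, hz, mul_one] at this

lemma one_le_reflectionBarrier {α : ℝ} {z e : E} {τ : ℝ} {x : E} (hz : ‖z‖ = 1) (hx : ‖x‖ = 1)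
    (hxz : inner ℝ (conformalReflection e τ x) z < ‖conformalReflection e τ x‖) :
    1 ≤ reflectionBarrier α z e τ x := by
  rw [reflectionBarrier_eq _ _ _ _ hx]
  have h := log_one_sub_le_log_two (neg_one_le_inner_of_norm_eq_one
    (norm_normalize (ne_zero_of_inner_lt_norm hxz)) hz) (inner_normalize_lt_one hxz)
  have := mul_nonneg (Real.rpow_nonneg (norm_nonneg (conformalReflection e τ x)) α)
    (sub_nonneg.2 h)
  have := Real.sqrt_nonneg (inner ℝ x e - τ)
  linarith

end

lemma contDiffAt_log_two_sub_log_one_sub {c : ℝ} (hc : c < 1) :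
    ContDiffAt ℝ 2 (fun c => Real.log 2 - Real.log (1 - c)) c :=
  contDiffAt_const.sub ((contDiffAt_const.sub contDiffAt_id).log (by
    have : 1 - c ≠ 0 := by linarith
    simpa using this))

lemma deriv_log_two_sub_log_one_sub {c : ℝ} (hc : c < 1) :
    deriv (fun c => Real.log 2 - Real.log (1 - c)) c = (1 - c)⁻¹ := by
  have h := (((hasDerivAt_id c).const_sub 1).log (sub_pos.2 hc).ne').const_sub (Real.log 2)
  simp only [id] at h
  rw [h.deriv]; ring

lemma deriv_deriv_log_two_sub_log_one_sub {c : ℝ} (hc : c < 1) :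
    deriv (deriv fun c => Real.log 2 - Real.log (1 - c)) c = ((1 - c) ^ 2)⁻¹ := by
  have h : deriv (fun c => Real.log 2 - Real.log (1 - c)) =ᶠ[𝓝 c] fun c => (1 - c)⁻¹ := by
    filter_upwards [gt_mem_nhds hc] with x hx using deriv_log_two_sub_log_one_sub hx
  rw [h.deriv_eq]
  have h := ((hasDerivAt_id c).const_sub 1).inv (sub_pos.2 hc).ne'
  simp only [id] at h
  erw [h.deriv]; simp

lemma contDiffAt_one_add_sqrt_sub {c τ : ℝ} (hc : τ < c) :
    ContDiffAt ℝ 2 (fun c => 1 + √(c - τ)) c :=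
  contDiffAt_const.add ((contDiffAt_id.sub contDiffAt_const).sqrt (by
    have : c - τ ≠ 0 := by linarith
    simpa using this))

lemma deriv_one_add_sqrt_sub {c τ : ℝ} (hc : τ < c) :
    deriv (fun c => 1 + √(c - τ)) c = (2 * √(c - τ))⁻¹ := by
  have h := (((hasDerivAt_id c).sub_const τ).sqrt (sub_pos.2 hc).ne').const_add 1
  simp only [id] at h
  rw [h.deriv]; ring

lemma deriv_deriv_one_add_sqrt_sub {c τ : ℝ} (hc : τ < c) :
    deriv (deriv fun c => 1 + √(c - τ)) c = -(4 * ((c - τ) * √(c - τ)))⁻¹ := by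
  have h : deriv (fun c => 1 + √(c - τ)) =ᶠ[𝓝 c] fun c => (2 * √(c - τ))⁻¹ := by
    filter_upwards [lt_mem_nhds hc] with x hx using deriv_one_add_sqrt_sub hx
  rw [h.deriv_eq]
  have h0 := Real.sqrt_pos.2 (sub_pos.2 hc)
  have h := ((((hasDerivAt_id c).sub_const τ).sqrt (sub_pos.2 hc).ne').const_mul 2).inv
    (by simpa using h0.ne')
  simp only [id] at h
  erw [h.deriv]
  have h1 := Real.mul_self_sqrt (sub_pos.2 hc).le
  rw [← h1]
  simp only [Real.sqrt_mul_self h0.le]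
  field_simp
  norm_num

namespace IsConformalSolution

variable {n : ℕ} {z : EuclideanSpace ℝ (Fin (n + 1))} {α : ℝ}
  {u : EuclideanSpace ℝ (Fin (n + 1)) → ℝ} {g : EuclideanSpace ℝ (Fin (n + 1)) → ℝ → ℝ}

lemma eLaplacian_reflectionBarrier_le (hu : IsConformalSolution z α u g)
    {e x : EuclideanSpace ℝ (Fin (n + 1))} {τ : ℝ} (he : ‖e‖ ^ 2 = 1 + τ ^ 2) (hτ : 0 ≤ τ)
    (hx : x ∈ reflectionDomain z e τ) :
    ContDiffAt ℝ 2 (reflectionBarrier α z e τ) x ∧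
    eLaplacian (reflectionBarrier α z e τ) x ≤
      -((1 + τ ^ 2 - inner ℝ x e ^ 2) / (4 * ((inner ℝ x e - τ) * √(inner ℝ x e - τ)))) -
      ‖conformalReflection e τ x‖ ^ (α - 2) *
        ((n * inner ℝ (‖conformalReflection e τ x‖⁻¹ • conformalReflection e τ x) z - 1 -
          inner ℝ (‖conformalReflection e τ x‖⁻¹ • conformalReflection e τ x) z) /
        (1 - inner ℝ (‖conformalReflection e τ x‖⁻¹ • conformalReflection e τ x) z)) := by
  have hn := hu.three_le_cast
  have hx0 : x ≠ 0 := by rintro rfl; simpa using hx.1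
  have hy0 := ne_zero_of_inner_lt_norm hx.2.2
  have hpos := norm_pos_iff.2 hy0
  have hφ := norm_normalize hy0
  have hc' := inner_normalize_lt_one hx.2.2
  have hc'1 := neg_one_le_inner_of_norm_eq_one hφ hu.norm_pole
  have hyφ : conformalReflection e τ x = ‖conformalReflection e τ x‖ •
      (‖conformalReflection e τ x‖⁻¹ • conformalReflection e τ x) := by
    rw [smul_smul, mul_inv_cancel₀ hpos.ne', one_smul]
  have hγ : α * (α + ((n + 1 : ℕ) : ℝ) - 2) = -(n * (n - 2) / 4) := by
    rw [hu.degree]; push_cast; ring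
  obtain ⟨h1, h2⟩ := eLaplacian_zonal α hx.1 (contDiffAt_one_add_sqrt_sub hx.2.1)
  obtain ⟨-, h4⟩ := eLaplacian_zonal α hφ (contDiffAt_log_two_sub_log_one_sub hc')
  set H := zonalExtension α (fun c => Real.log 2 - Real.log (1 - c)) z with hH
  have hhom : ∀ x, ∀ s : ℝ, 0 < s → H (s • x) = s ^ α * H x :=
    fun x s hs => zonalExtension_smul _ _ _ _ hs
  have h5 : ContDiffAt ℝ 2 H (conformalReflection e τ x) := by
    have hi : ContDiffAt ℝ 2
        (fun y : EuclideanSpace ℝ (Fin (n + 1)) => inner ℝ y z * ‖y‖ ^ (-1 : ℝ))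
        (conformalReflection e τ x) :=
      (contDiffAt_id.inner ℝ contDiffAt_const).mul (contDiffAt_norm_rpow (-1) hy0)
    refine (contDiffAt_norm_rpow α hy0).mul
      (ContDiffAt.comp (g := fun c => Real.log 2 - Real.log (1 - c)) (conformalReflection e τ x)
        (contDiffAt_log_two_sub_log_one_sub ?_) hi)
    rwa [mul_comm, Real.rpow_neg_one, ← real_inner_smul_left]
  have h6 : ContDiffAt ℝ 2 (fun y => H (conformalReflection e τ y)) x :=
    h5.comp x (contDiffAt_conformalReflection e τ hx0)
  refine ⟨h1.add h6, ?_⟩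
  have h7 : eLaplacian (reflectionBarrier α z e τ) x =
      eLaplacian (zonalExtension α (fun c => 1 + √(c - τ)) e) x +
      eLaplacian (fun y => H (conformalReflection e τ y)) x := by
    simp only [eLaplacian_eq_laplacian]
    exact h1.laplacian_add h6
  rw [eLaplacian_comp_conformalReflection hu.degree_eq hhom he hx.1 h5] at h7
  have h8 := eLaplacian_smul_of_homogeneous hhom hpos
    (‖conformalReflection e τ x‖⁻¹ • conformalReflection e τ x)
  rw [← hyφ] at h8
  set y := conformalReflection e τ x
  set c' := inner ℝ (‖y‖⁻¹ • y) z with hcc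
  set c := inner ℝ x e
  have h9 : eLaplacian H (‖y‖⁻¹ • y) ≤ -((n * c' - 1 - c') / (1 - c')) := by
    refine (le_of_eq h4).trans ?_
    rw [deriv_deriv_log_two_sub_log_one_sub hc', deriv_log_two_sub_log_one_sub hc', hγ,
      hu.norm_pole]
    have hl := log_one_sub_le_log_two hc'1 hc'
    have : 0 ≤ n * (n - 2) / 4 * (Real.log 2 - Real.log (1 - c')) :=
      mul_nonneg (by nlinarith) (by linarith)
    have h0 : 1 - c' ≠ 0 := by linarith
    have e1 : (1 ^ 2 - c' ^ 2) * ((1 - c') ^ 2)⁻¹ - (((n + 1 : ℕ) : ℝ) - 1) * c' * (1 - c')⁻¹ =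
        -((n * c' - 1 - c') / (1 - c')) := by
      push_cast; field_simp; ring
    linarith
  have h10 : eLaplacian (zonalExtension α (fun c => 1 + √(c - τ)) e) x ≤
      -((1 + τ ^ 2 - c ^ 2) / (4 * ((c - τ) * √(c - τ)))) := by
    refine (le_of_eq h2).trans ?_
    have hc : τ < c := hx.2.1
    rw [deriv_deriv_one_add_sqrt_sub hc, deriv_one_add_sqrt_sub hc, hγ, he]
    have hs := Real.sqrt_nonneg (c - τ)
    have : 0 ≤ n * (n - 2) / 4 * (1 + √(c - τ)) := mul_nonneg (by nlinarith) (by linarith)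
    have h0 : 0 ≤ c := by linarith
    have : 0 ≤ (((n + 1 : ℕ) : ℝ) - 1) * c * (2 * √(c - τ))⁻¹ := by
      have : (0 : ℝ) ≤ ((n + 1 : ℕ) : ℝ) - 1 := by push_cast; linarith
      positivity
    rw [div_eq_mul_inv (1 + τ ^ 2 - c ^ 2)]
    linarith
  rw [h7, h8]
  have := mul_le_mul_of_nonneg_left h9 (Real.rpow_nonneg hpos.le (α - 2))
  linarith

end IsConformalSolution

namespace IsConformalSolution

variable {n : ℕ} {z : EuclideanSpace ℝ (Fin (n + 1))} {α : ℝ}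
  {u : EuclideanSpace ℝ (Fin (n + 1)) → ℝ} {g : EuclideanSpace ℝ (Fin (n + 1)) → ℝ → ℝ}

lemma sub_le_mul_sub (hu : IsConformalSolution z α u g) {x : EuclideanSpace ℝ (Fin (n + 1))}
    (hx : ‖x‖ = 1) (hxz : inner ℝ x z < 1) {s t : ℝ} (hs : 0 < s) (hst : s ≤ t) :
    g x t - g x s ≤ ((n + 2) / (n - 2) * (g x t / t)) * (t - s) := by
  have hn := hu.three_le_cast
  have ht := hs.trans_le hst
  have h1 := hu.subcritical x hx hxz s t hs hst
  have h2 := one_add_mul_self_le_rpow_one_add (s := s / t - 1) (p := ((n : ℝ) + 2) / (n - 2))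
    (by have : 0 < s / t := by positivity
        linarith)
    (by rw [le_div_iff₀ (by linarith)]; linarith)
  have h3 := hu.nonneg x hx hxz t ht
  rw [add_sub_cancel] at h2
  have h4 : (s / t) ^ (((n : ℝ) + 2) / (n - 2)) * (t / s) ^ (((n : ℝ) + 2) / (n - 2)) = 1 := by
    rw [← Real.mul_rpow (by positivity) (by positivity), div_mul_div_cancel₀ ht.ne',
      div_self hs.ne', Real.one_rpow]
  have h5 : (s / t) ^ (((n : ℝ) + 2) / (n - 2)) * g x t ≤ g x s := by
    have := mul_le_mul_of_nonneg_left h1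
      (Real.rpow_nonneg (div_pos hs ht).le (((n : ℝ) + 2) / (n - 2)))
    rwa [← mul_assoc, h4, one_mul] at this
  have h6 := mul_le_mul_of_nonneg_right h2 h3
  have h7 : ((n + 2) / (n - 2) * (g x t / t)) * (t - s) =
      g x t - (1 + (n + 2) / (n - 2) * (s / t - 1)) * g x t := by
    field_simp; ring
  rw [h7]
  linarith

/-- The differential inequality satisfied at a minimum of the quotient of `u ∘ Y - u` by the
barrier, `Y` being the conformal reflection. -/
lemma barrier_inequality (hu : IsConformalSolution z α u g)
    {e x : EuclideanSpace ℝ (Fin (n + 1))} {τ μ : ℝ} (he : ‖e‖ ^ 2 = 1 + τ ^ 2) (hτ : 0 ≤ τ)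
    (hez : inner ℝ e z < -τ) (hx : x ∈ reflectionDomain z e τ) (hμ : 0 < μ)
    (heq : u (conformalReflection e τ x) - u x = -μ * reflectionBarrier α z e τ x)
    (hmin : ∀ y ∈ reflectionDomain z e τ,
      -μ * reflectionBarrier α z e τ y ≤ u (conformalReflection e τ y) - u y) :
    (1 + τ ^ 2 - inner ℝ x e ^ 2) / (4 * ((inner ℝ x e - τ) * √(inner ℝ x e - τ))) +
      ‖conformalReflection e τ x‖ ^ (α - 2) *
        ((n * inner ℝ (‖conformalReflection e τ x‖⁻¹ • conformalReflection e τ x) z - 1 -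
          inner ℝ (‖conformalReflection e τ x‖⁻¹ • conformalReflection e τ x) z) /
        (1 - inner ℝ (‖conformalReflection e τ x‖⁻¹ • conformalReflection e τ x) z)) ≤
      ((n + 2) / (n - 2) * (g x (u x) / u x)) * reflectionBarrier α z e τ x := by
  have hx0 : x ≠ 0 := by rintro rfl; simpa using hx.1
  have hxz := inner_lt_one_of_le_inner hx.1 hu.norm_pole hτ hez hx.2.1.le
  have hs1 : ContDiffAt ℝ 2 u x := hu.smooth x (by rwa [hx.1])
  have hs2 := hu.smooth _ hx.2.2
  have hs3 : ContDiffAt ℝ 2 (fun y => u (conformalReflection e τ y)) x :=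
    hs2.comp x (contDiffAt_conformalReflection e τ hx0)
  obtain ⟨hb, hb'⟩ := hu.eLaplacian_reflectionBarrier_le he hτ hx
  have hs4 : ContDiffAt ℝ 2 (fun y => -μ * reflectionBarrier α z e τ y) x := contDiffAt_const.mul hb
  have hlm : IsLocalMin (fun y => (u (conformalReflection e τ y) - u y) -
      -μ * reflectionBarrier α z e τ y) x := by
    refine isLocalMin_of_homogeneous (α := α) (fun y s hs => ?_) hx.1 ?_ (by rw [heq, sub_self])
    · rw [hu.reflection_homogeneous e τ y s hs, hu.homogeneous y s hs,
        reflectionBarrier_smul _ _ _ _ _ hs]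
      ring
    · filter_upwards [eventually_mem_reflectionDomain hx] with y hy hy1
      exact sub_nonneg.2 (hmin y (hy hy1))
  have h1 := hlm.eLaplacian_nonneg ((hs3.sub hs1).sub hs4)
  rw [eLaplacian_sub (hs3.sub hs1) hs4, eLaplacian_sub hs3 hs1, eLaplacian_const_mul _ hb,
    eLaplacian_comp_conformalReflection hu.degree_eq hu.homogeneous he hx.1 hs2,
    hu.equation x hx.1 hxz] at h1
  obtain ⟨h2, h3⟩ := hu.lt_neg_eLaplacian_reflection he hτ hez hx
  have hψ := one_le_reflectionBarrier (α := α) hu.norm_pole hx.1 hx.2.2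
  have h4 := hu.sub_le_mul_sub hx.1 hxz h2 (t := u x) (by nlinarith)
  rw [show u x - u (conformalReflection e τ x) = μ * reflectionBarrier α z e τ x by linarith] at h4
  refine le_of_mul_le_mul_left ?_ hμ
  nlinarith [mul_le_mul_of_nonneg_left hb' hμ.le]

lemma continuousAt (hu : IsConformalSolution z α u g) {x : EuclideanSpace ℝ (Fin (n + 1))}
    (hx : inner ℝ x z < ‖x‖) : ContinuousAt u x :=
  (hu.smooth x hx).continuousAt

lemma exists_isMinOn_quotient (hu : IsConformalSolution z α u g)
    {e : EuclideanSpace ℝ (Fin (n + 1))} {τ : ℝ} (he : ‖e‖ ^ 2 = 1 + τ ^ 2) (hτ : 0 ≤ τ)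
    (hez : inner ℝ e z < -τ)
    (hbad : ∃ x ∈ reflectionDomain z e τ, u (conformalReflection e τ x) < u x) :
    ∃ x ∈ reflectionDomain z e τ, ∃ μ > 0,
      u (conformalReflection e τ x) - u x = -μ * reflectionBarrier α z e τ x ∧
      ∀ y ∈ reflectionDomain z e τ,
        -μ * reflectionBarrier α z e τ y ≤ u (conformalReflection e τ y) - u y := by
  obtain ⟨x₁, hx₁, hlt⟩ := hbad
  set Y := conformalReflection e τ with hY
  set ψ := reflectionBarrier α z e τ with hψ
  have hψ1 : ∀ x, ‖x‖ = 1 → inner ℝ (Y x) z < ‖Y x‖ → 1 ≤ ψ x := fun x h1 h2 =>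
    one_le_reflectionBarrier hu.norm_pole h1 h2
  have hupos : ∀ x ∈ reflectionDomain z e τ, 0 < u (Y x) := fun x hx =>
    (hu.lt_neg_eLaplacian_reflection he hτ hez hx).1
  have hcap : IsCompact {x : EuclideanSpace ℝ (Fin (n + 1)) | ‖x‖ = 1 ∧ τ ≤ inner ℝ x e} := by
    refine (isCompact_sphere (0 : EuclideanSpace ℝ (Fin (n + 1))) 1).of_isClosed_subset ?_ ?_
    · have h : IsClosed {x : EuclideanSpace ℝ (Fin (n + 1)) | τ ≤ inner ℝ x e} :=
        isClosed_le continuous_const (by fun_prop)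
      exact (isClosed_eq continuous_norm continuous_const).inter h
    · exact fun x hx => by simpa using hx.1
  have hucap : ContinuousOn u {x | ‖x‖ = 1 ∧ τ ≤ inner ℝ x e} := fun x hx =>
    (hu.continuousAt (by
      rw [hx.1]; exact inner_lt_one_of_le_inner hx.1 hu.norm_pole hτ hez hx.2)).continuousWithinAt
  obtain ⟨M, hM⟩ := (hcap.image_of_continuousOn hucap).bddAbove
  replace hM : ∀ x ∈ reflectionDomain z e τ, u x ≤ M := fun x hx =>
    hM ⟨x, ⟨hx.1, hx.2.1.le⟩, rfl⟩
  set q := fun x => (u (Y x) - u x) / ψ x with hq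
  have hψ₁ := hψ1 x₁ hx₁.1 hx₁.2.2
  have hq₁ : q x₁ < 0 := div_neg_of_neg_of_pos (sub_neg.2 hlt) (by linarith)
  set ε := 2 * Real.exp (M / q x₁) with hε
  have hε0 : 0 < ε := by positivity
  have hlogε : Real.log ε = Real.log 2 + M / q x₁ := by
    rw [hε, Real.log_mul (by norm_num) (Real.exp_pos _).ne', Real.log_exp]
  set K := {x : EuclideanSpace ℝ (Fin (n + 1)) | ‖x‖ = 1 ∧ τ ≤ inner ℝ x e} ∩
    {x | inner ℝ (Y x) z ≤ (1 - ε) * ‖Y x‖} with hK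
  have hKlt : ∀ x ∈ K, inner ℝ (Y x) z < ‖Y x‖ := fun x hx => by
    have h1 : 0 < ‖Y x‖ := norm_conformalReflection_pos he hx.1.1
    have h2 : inner ℝ (Y x) z ≤ (1 - ε) * ‖Y x‖ := hx.2
    nlinarith
  have hKc : IsCompact K := by
    have : Continuous Y := continuous_conformalReflection e τ
    exact hcap.inter_right (isClosed_le (by fun_prop) (by fun_prop))
  have hout : ∀ x ∈ reflectionDomain z e τ, x ∉ K → q x₁ < q x := by
    intro x hx hxK
    have hT : 0 < ‖Y x‖ := norm_conformalReflection_pos he hx.1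
    have hT1 : ‖Y x‖ ≤ 1 := norm_conformalReflection_le_one he hx.1 hτ hx.2.1.le
    have h1 : (1 - ε) * ‖Y x‖ < inner ℝ (Y x) z := by
      by_contra h
      exact hxK ⟨⟨hx.1, hx.2.1.le⟩, not_lt.1 h⟩
    have h2 : 1 - ε < inner ℝ (‖Y x‖⁻¹ • Y x) z := by
      rw [real_inner_smul_left, ← div_eq_inv_mul, lt_div_iff₀ hT]; exact h1
    have h3 := inner_normalize_lt_one hx.2.2
    have h4 : Real.log (1 - inner ℝ (‖Y x‖⁻¹ • Y x) z) ≤ Real.log ε :=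
      Real.log_le_log (sub_pos.2 h3) (by linarith)
    have h5 : 1 ≤ ‖Y x‖ ^ α :=
      Real.one_le_rpow_of_pos_of_le_one_of_nonpos hT hT1 (by linarith [hu.degree_le])
    have h6 := log_one_sub_le_log_two (neg_one_le_inner_of_norm_eq_one
      (norm_normalize (ne_zero_of_inner_lt_norm hx.2.2)) hu.norm_pole) h3
    have h7 := reflectionBarrier_eq α z e τ hx.1
    have h8 := Real.sqrt_nonneg (inner ℝ x e - τ)
    have h9 : -(M / q x₁) < ψ x := by
      rw [hψ, h7]
      have : Real.log 2 - Real.log (1 - inner ℝ (‖Y x‖⁻¹ • Y x) z) ≤ ‖Y x‖ ^ α *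
          (Real.log 2 - Real.log (1 - inner ℝ (‖Y x‖⁻¹ • Y x) z)) :=
        le_mul_of_one_le_left (sub_nonneg.2 h6) h5
      linarith
    have hψx := hψ1 x hx.1 hx.2.2
    rw [hq]
    simp only
    rw [lt_div_iff₀ (by linarith)]
    have h10 : q x₁ * ψ x < q x₁ * (-(M / q x₁)) := mul_lt_mul_of_neg_left h9 hq₁
    have h11 : q x₁ * (-(M / q x₁)) = -M := by
      rw [mul_neg, mul_div_cancel₀ _ hq₁.ne]
    have := hM x hx
    have := hupos x hx
    simp only [hq] at h10 h11
    linarith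
  have hx₁K : x₁ ∈ K := by
    by_contra h
    exact lt_irrefl _ (hout x₁ hx₁ h)
  have hqK : ContinuousOn q K := by
    intro x hx
    have hx0 : x ≠ 0 := by rintro rfl; simpa using hx.1.1
    refine ContinuousAt.continuousWithinAt (ContinuousAt.div (ContinuousAt.sub ?_ ?_) ?_ ?_)
    · exact ContinuousAt.comp (hu.continuousAt (hKlt x hx))
        (continuous_conformalReflection e τ).continuousAt
    · refine hu.continuousAt ?_
      rw [hx.1.1]
      exact inner_lt_one_of_le_inner hx.1.1 hu.norm_pole hτ hez hx.1.2
    · exact continuousAt_reflectionBarrier α hx0 (hKlt x hx)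
    · linarith [hψ1 x hx.1.1 (hKlt x hx)]
  obtain ⟨x₀, hx₀, hmin⟩ := hKc.exists_isMinOn ⟨x₁, hx₁K⟩ hqK
  have hq₀ : q x₀ < 0 := (hmin hx₁K).trans_lt hq₁
  have hx₀D : x₀ ∈ reflectionDomain z e τ := by
    refine ⟨hx₀.1.1, lt_of_le_of_ne hx₀.1.2 fun h => ?_, hKlt x₀ hx₀⟩
    have : Y x₀ = x₀ := conformalReflection_of_inner_eq hx₀.1.1 h.symm
    simp [hq, this] at hq₀
  have hle : ∀ y ∈ reflectionDomain z e τ, q x₀ ≤ q y := by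
    intro y hy
    by_cases hyK : y ∈ K
    · exact hmin hyK
    · exact (hmin hx₁K).trans (hout y hy hyK).le
  refine ⟨x₀, hx₀D, -q x₀, by linarith, ?_, fun y hy => ?_⟩
  · have := hψ1 x₀ hx₀.1.1 (hKlt x₀ hx₀)
    simp only [hq]
    field_simp
  · have h1 := hψ1 y hy.1 hy.2.2
    have h2 := hle y hy
    rw [neg_neg, ← le_div_iff₀ (by linarith)]
    exact h2

end IsConformalSolution

section

variable {A C a d r s : ℕ → ℝ} {A' C' a' d' r' s' N : ℝ}

lemma ne_zero_of_tendsto_of_barrier_inequality (hN : 2 < N)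
    (hA : ∀ k, 0 ≤ A k) (hd : ∀ k, 0 < d k) (ha : ∀ k, 0 < a k)
    (hdt : Tendsto d atTop (𝓝 d')) (hrt : Tendsto r atTop (𝓝 r')) (hat : Tendsto a atTop (𝓝 a'))
    (hCt : Tendsto C atTop (𝓝 C')) (hst : Tendsto s atTop (𝓝 s')) (hr' : 0 < r')
    (h : ∀ k, A k / (4 * (d k * √(d k))) + r k * ((N * (1 - a k) - 1 - (1 - a k)) / a k) ≤
      C k * (1 + √(d k) + s k * (Real.log 2 - Real.log (a k)))) : a' ≠ 0 := by
  rintro rfl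
  have h1 : ∀ k, r k * (N * (1 - a k) - 1 - (1 - a k)) ≤
      C k * (a k * (1 + √(d k)) + s k * (a k * Real.log 2 + Real.negMulLog (a k))) := by
    intro k
    have h0 : 0 ≤ A k / (4 * (d k * √(d k))) :=
      div_nonneg (hA k) (by have := (hd k).le; positivity)
    have h2 := mul_le_mul_of_nonneg_left ((le_add_of_nonneg_left h0).trans (h k)) (ha k).le
    have h3 : a k * (r k * ((N * (1 - a k) - 1 - (1 - a k)) / a k)) =
      r k * (N * (1 - a k) - 1 - (1 - a k)) := by
      have := (ha k).ne'
      field_simp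
    rw [h3] at h2
    refine h2.trans (le_of_eq ?_)
    rw [Real.negMulLog]; ring
  have h2 : Tendsto (fun k => Real.negMulLog (a k)) atTop (𝓝 (Real.negMulLog 0)) :=
    (Real.continuous_negMulLog.tendsto 0).comp hat
  have h3 := le_of_tendsto_of_tendsto'
    (hrt.mul ((((hat.const_sub 1).const_mul N).sub_const 1).sub (hat.const_sub 1)))
    (hCt.mul ((hat.mul ((hdt.sqrt).const_add 1)).add
      (hst.mul ((hat.mul_const (Real.log 2)).add h2))))
    h1
  simp only [Real.negMulLog_zero] at h3
  nlinarith

lemma limit_ne_zero_of_barrier_inequality (hd : ∀ k, 0 < d k) (ha' : 0 < a')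
    (hAt : Tendsto A atTop (𝓝 A')) (hA' : 0 < A')
    (hdt : Tendsto d atTop (𝓝 d')) (hrt : Tendsto r atTop (𝓝 r')) (hat : Tendsto a atTop (𝓝 a'))
    (hCt : Tendsto C atTop (𝓝 C')) (hst : Tendsto s atTop (𝓝 s'))
    (h : ∀ k, A k / (4 * (d k * √(d k))) + r k * ((N * (1 - a k) - 1 - (1 - a k)) / a k) ≤
      C k * (1 + √(d k) + s k * (Real.log 2 - Real.log (a k)))) : d' ≠ 0 := by
  rintro rfl
  have h1 : ∀ k, A k / 4 + d k * √(d k) * (r k * ((N * (1 - a k) - 1 - (1 - a k)) / a k)) ≤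
      d k * √(d k) * (C k * (1 + √(d k) + s k * (Real.log 2 - Real.log (a k)))) := by
    intro k
    have h0 : 0 < d k * √(d k) := mul_pos (hd k) (Real.sqrt_pos.2 (hd k))
    refine le_trans (le_of_eq ?_) (mul_le_mul_of_nonneg_left (h k) h0.le)
    rw [mul_add]
    generalize d k * √(d k) = D at *
    congr 1
    field_simp
  have h2 := hdt.mul hdt.sqrt
  have h3 := le_of_tendsto_of_tendsto'
    ((hAt.div_const 4).add (h2.mul (hrt.mul (((((hat.const_sub 1).const_mul N).sub_const 1).sub
      (hat.const_sub 1)).div hat ha'.ne'))))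
    (h2.mul (hCt.mul ((hdt.sqrt.const_add 1).add (hst.mul ((hat.log ha'.ne').const_sub _)))))
    h1
  simp only [zero_mul, add_zero] at h3
  linarith

end

lemma continuous_conformalReflection_uncurry {E : Type*} [NormedAddCommGroup E]
    [InnerProductSpace ℝ E] :
    Continuous fun p : E × ℝ × E => conformalReflection p.1 p.2.1 p.2.2 := by
  unfold conformalReflection; fun_prop

namespace IsConformalSolution

variable {n : ℕ} {z : EuclideanSpace ℝ (Fin (n + 1))} {α : ℝ}
  {u : EuclideanSpace ℝ (Fin (n + 1)) → ℝ} {g : EuclideanSpace ℝ (Fin (n + 1)) → ℝ → ℝ}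

lemma exists_reflection_le_of_tendsto (hu : IsConformalSolution z α u g)
    {e : ℕ → EuclideanSpace ℝ (Fin (n + 1))} {e' : EuclideanSpace ℝ (Fin (n + 1))}
    {τ : ℕ → ℝ} {τ' : ℝ} (he : ∀ k, ‖e k‖ ^ 2 = 1 + τ k ^ 2) (hτ : ∀ k, 0 ≤ τ k)
    (hez : ∀ k, inner ℝ (e k) z < -τ k) (hez' : inner ℝ e' z < -τ')
    (het : Tendsto e atTop (𝓝 e')) (hτt : Tendsto τ atTop (𝓝 τ'))
    (hbad : ∀ k, ∃ x ∈ reflectionDomain z (e k) (τ k),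
      u (conformalReflection (e k) (τ k) x) < u x) :
    ∃ x ∈ reflectionDomain z e' τ', u (conformalReflection e' τ' x) ≤ u x := by
  have hn := hu.three_le_cast
  choose x hx μ hμ heq hmin using fun k =>
    hu.exists_isMinOn_quotient (he k) (hτ k) (hez k) (hbad k)
  obtain ⟨x', hx', φ, hφ, hxt⟩ :=
    (isCompact_sphere (0 : EuclideanSpace ℝ (Fin (n + 1))) 1).tendsto_subseq
    (x := x) fun k => by simpa using (hx k).1
  replace hx' : ‖x'‖ = 1 := by simpa using hx'
  have hB := fun k => hu.barrier_inequality (he (φ k)) (hτ (φ k)) (hez (φ k)) (hx (φ k)) (hμ (φ k))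
    (heq (φ k)) (hmin (φ k))
  have hle : ∀ k, u (conformalReflection (e (φ k)) (τ (φ k)) (x (φ k))) ≤ u (x (φ k)) := by
    intro k
    have h1 := one_le_reflectionBarrier (α := α) hu.norm_pole (hx (φ k)).1 (hx (φ k)).2.2
    nlinarith [heq (φ k), hμ (φ k)]
  replace het := het.comp hφ.tendsto_atTop
  replace hτt := hτt.comp hφ.tendsto_atTop
  replace he := fun k => he (φ k)
  replace hτ := fun k => hτ (φ k)
  replace hez := fun k => hez (φ k)
  replace hx := fun k => hx (φ k)
  clear hmin heq hμ hbad
  have he' : ‖e'‖ ^ 2 = 1 + τ' ^ 2 :=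
    tendsto_nhds_unique ((het.norm).pow 2) (by simpa [he] using (hτt.pow 2).const_add 1)
  have hτ' : 0 ≤ τ' := ge_of_tendsto' hτt hτ
  have hct : Tendsto (fun k => inner ℝ (x (φ k)) (e (φ k))) atTop (𝓝 (inner ℝ x' e')) :=
    hxt.inner het
  have hc' : τ' ≤ inner ℝ x' e' := le_of_tendsto_of_tendsto' hτt hct fun k => (hx k).2.1.le
  have hYt : Tendsto (fun k => conformalReflection (e (φ k)) (τ (φ k)) (x (φ k))) atTop
      (𝓝 (conformalReflection e' τ' x')) :=
    (continuous_conformalReflection_uncurry.tendsto (e', τ', x')).comp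
      (het.prodMk_nhds (hτt.prodMk_nhds hxt))
  have hT : 0 < ‖conformalReflection e' τ' x'‖ := norm_conformalReflection_pos he' hx'
  have hTt := hYt.norm
  have hat : Tendsto (fun k => 1 - inner ℝ (‖conformalReflection (e (φ k)) (τ (φ k)) (x (φ k))‖⁻¹ •
      conformalReflection (e (φ k)) (τ (φ k)) (x (φ k))) z) atTop
      (𝓝 (1 - inner ℝ (‖conformalReflection e' τ' x'‖⁻¹ • conformalReflection e' τ' x') z)) :=
    (((hTt.inv₀ hT.ne').smul hYt).inner tendsto_const_nhds).const_sub 1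
  have hxz : inner ℝ x' z < 1 := inner_lt_one_of_le_inner hx' hu.norm_pole hτ' hez' hc'
  have hxkz : ∀ k, inner ℝ (x (φ k)) z < 1 := fun k =>
    inner_lt_one_of_le_inner (hx k).1 hu.norm_pole (hτ k) (hez k) (hx k).2.1.le
  have hut : Tendsto (fun k => u (x (φ k))) atTop (𝓝 (u x')) :=
    (hu.continuousAt (x := x') (by rwa [hx'])).tendsto.comp hxt
  have hux' := hu.pos hx' hxz
  have hgt : Tendsto (fun k => g (x (φ k)) (u (x (φ k)))) atTop (𝓝 (g x' (u x'))) := by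
    have h1 := hu.continuousOn (x', u x') ⟨⟨hx', hxz⟩, hux'⟩
    refine Tendsto.comp (f := fun k => (x (φ k), u (x (φ k)))) h1 ?_
    exact tendsto_nhdsWithin_iff.2 ⟨hxt.prodMk_nhds hut,
      Eventually.of_forall fun k => ⟨⟨(hx k).1, hxkz k⟩, hu.pos (hx k).1 (hxkz k)⟩⟩
  have hCt := (hgt.div hut hux'.ne').const_mul (((n : ℝ) + 2) / (n - 2))
  have hdt := hct.sub hτt
  have hAt : Tendsto (fun k => 1 + τ (φ k) ^ 2 - inner ℝ (x (φ k)) (e (φ k)) ^ 2) atTop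
      (𝓝 (1 + τ' ^ 2 - inner ℝ x' e' ^ 2)) := ((hτt.pow 2).const_add 1).sub (hct.pow 2)
  have hA : ∀ k, 0 ≤ 1 + τ (φ k) ^ 2 - inner ℝ (x (φ k)) (e (φ k)) ^ 2 := by
    intro k
    have h1 := abs_real_inner_le_norm (x (φ k)) (e (φ k))
    rw [(hx k).1, one_mul] at h1
    have h2 := pow_le_pow_left₀ (abs_nonneg _) h1 2
    rw [sq_abs, he k] at h2
    linarith
  have hB' : ∀ k, (1 + τ (φ k) ^ 2 - inner ℝ (x (φ k)) (e (φ k)) ^ 2) /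
      (4 * ((inner ℝ (x (φ k)) (e (φ k)) - τ (φ k)) * √(inner ℝ (x (φ k)) (e (φ k)) - τ (φ k)))) +
      ‖conformalReflection (e (φ k)) (τ (φ k)) (x (φ k))‖ ^ (α - 2) *
      ((n * (1 - (1 - inner ℝ (‖conformalReflection (e (φ k)) (τ (φ k)) (x (φ k))‖⁻¹ •
        conformalReflection (e (φ k)) (τ (φ k)) (x (φ k))) z)) - 1 -
        (1 - (1 - inner ℝ (‖conformalReflection (e (φ k)) (τ (φ k)) (x (φ k))‖⁻¹ •
        conformalReflection (e (φ k)) (τ (φ k)) (x (φ k))) z))) /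
        (1 - inner ℝ (‖conformalReflection (e (φ k)) (τ (φ k)) (x (φ k))‖⁻¹ •
        conformalReflection (e (φ k)) (τ (φ k)) (x (φ k))) z)) ≤
      ((n + 2) / (n - 2) * (g (x (φ k)) (u (x (φ k))) / u (x (φ k)))) *
      (1 + √(inner ℝ (x (φ k)) (e (φ k)) - τ (φ k)) +
      ‖conformalReflection (e (φ k)) (τ (φ k)) (x (φ k))‖ ^ α * (Real.log 2 - Real.log
      (1 - inner ℝ (‖conformalReflection (e (φ k)) (τ (φ k)) (x (φ k))‖⁻¹ •
        conformalReflection (e (φ k)) (τ (φ k)) (x (φ k))) z))) := by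
    intro k
    have h1 := hB k
    rw [reflectionBarrier_eq _ _ _ _ (hx k).1] at h1
    simpa only [sub_sub_cancel] using h1
  have hrt := hTt.rpow_const (p := α - 2) (Or.inl hT.ne')
  have hst := hTt.rpow_const (p := α) (Or.inl hT.ne')
  have hd : ∀ k, 0 < inner ℝ (x (φ k)) (e (φ k)) - τ (φ k) := fun k => sub_pos.2 (hx k).2.1
  have ha : ∀ k, 0 < 1 - inner ℝ (‖conformalReflection (e (φ k)) (τ (φ k)) (x (φ k))‖⁻¹ •
        conformalReflection (e (φ k)) (τ (φ k)) (x (φ k))) z :=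
    fun k => sub_pos.2 (inner_normalize_lt_one (hx k).2.2)
  have ha' := ne_zero_of_tendsto_of_barrier_inequality (by linarith) hA hd ha hdt hrt hat hCt hst
    (Real.rpow_pos_of_pos hT _) hB'
  replace ha' := lt_of_le_of_ne (ge_of_tendsto' hat fun k => (ha k).le) ha'.symm
  have hYz : inner ℝ (conformalReflection e' τ' x') z < ‖conformalReflection e' τ' x'‖ := by
    rw [sub_pos, real_inner_smul_left, ← div_eq_inv_mul, div_lt_one hT] at ha'
    exact ha'
  refine ⟨x', ⟨hx', lt_of_le_of_ne hc' fun h => ?_, hYz⟩,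
    le_of_tendsto_of_tendsto' ((hu.continuousAt hYz).tendsto.comp hYt) hut hle⟩
  refine limit_ne_zero_of_barrier_inequality hd ha' hAt ?_ hdt hrt hat hCt hst hB'
    (sub_eq_zero.2 h.symm)
  rw [← h]; simp

theorem le_reflection_of_path (hu : IsConformalSolution z α u g)
    {e : ℝ → EuclideanSpace ℝ (Fin (n + 1))} (hec : Continuous e)
    (he : ∀ τ, ‖e τ‖ ^ 2 = 1 + τ ^ 2) (hez : ∀ τ, 0 ≤ τ → inner ℝ (e τ) z < -τ) {τ₀ : ℝ}
    (hstart : ∀ τ, τ₀ ≤ τ → ∀ x ∈ reflectionDomain z (e τ) τ,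
      u x ≤ u (conformalReflection (e τ) τ x)) {τ : ℝ} (hτ : 0 ≤ τ) :
    ∀ x ∈ reflectionDomain z (e τ) τ, u x ≤ u (conformalReflection (e τ) τ x) := by
  set B : Set ℝ := {τ | 0 ≤ τ ∧ ∃ x ∈ reflectionDomain z (e τ) τ,
    u (conformalReflection (e τ) τ x) < u x} with hB
  by_contra! hcon
  have hne : B.Nonempty := ⟨τ, hτ, hcon⟩
  have hbdd : BddAbove B := by
    refine ⟨τ₀, fun t ht => ?_⟩
    by_contra! h
    obtain ⟨-, x, hx, hlt⟩ := ht
    exact hlt.not_ge (hstart t h.le x hx)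
  obtain ⟨t, -, htt, htB⟩ := exists_seq_tendsto_sSup hne hbdd
  have hT : 0 ≤ sSup B := hτ.trans (le_csSup hbdd ⟨hτ, hcon⟩)
  obtain ⟨x, hx, hle⟩ := hu.exists_reflection_le_of_tendsto (fun k => he (t k))
    (fun k => (htB k).1) (fun k => hez _ (htB k).1) (hez _ hT) ((hec.tendsto _).comp htt) htt
    (fun k => (htB k).2)
  refine hle.not_gt (hu.lt_of_forall_le (he _) hT (hez _ hT) (fun y hy => ?_) hx)
  by_contra! hlt
  have hYc : Continuous fun s => conformalReflection (e s) s y :=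
    continuous_conformalReflection_uncurry.comp (hec.prodMk (continuous_id.prodMk continuous_const))
  have hc1 : Continuous fun s => s - inner ℝ y (e s) := by fun_prop
  have hc2 : Continuous fun s => inner ℝ (conformalReflection (e s) s y) z -
    ‖conformalReflection (e s) s y‖ := by fun_prop
  have h1 : ∀ᶠ s in 𝓝 (sSup B), s - inner ℝ y (e s) < 0 :=
    (hc1.tendsto _).eventually (gt_mem_nhds (sub_neg.2 hy.2.1))
  have h2 : ∀ᶠ s in 𝓝 (sSup B), inner ℝ (conformalReflection (e s) s y) z -
      ‖conformalReflection (e s) s y‖ < 0 :=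
    (hc2.tendsto _).eventually (gt_mem_nhds (sub_neg.2 hy.2.2))
  have h3 : ∀ᶠ s in 𝓝 (sSup B), u (conformalReflection (e s) s y) < u y :=
    (ContinuousAt.comp (f := fun s => conformalReflection (e s) s y)
      (hu.continuousAt hy.2.2) hYc.continuousAt).eventually (gt_mem_nhds hlt)
  obtain ⟨s, ⟨hs1, hs2, hs3⟩, hs⟩ := (((h1.and (h2.and h3)).filter_mono
    (nhdsWithin_le_nhds (s := Ioi (sSup B)))).and self_mem_nhdsWithin).exists
  exact (notMem_of_csSup_lt hs hbdd) ⟨hT.trans (le_of_lt hs), y,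
    ⟨hy.1, sub_neg.1 hs1, sub_neg.1 hs2⟩, hs3⟩

end IsConformalSolution

namespace IsConformalSolution

variable {n : ℕ} {z : EuclideanSpace ℝ (Fin (n + 1))} {α : ℝ}
  {u : EuclideanSpace ℝ (Fin (n + 1)) → ℝ} {g : EuclideanSpace ℝ (Fin (n + 1)) → ℝ → ℝ}

lemma exists_sub_le_mul_norm_sub (hu : IsConformalSolution z α u g) :
    ∃ K ρ : ℝ, 0 ≤ K ∧ 0 < ρ ∧ ∀ x, ‖x‖ = 1 → ‖x + z‖ < ρ → ∀ y, ‖y‖ = 1 → inner ℝ y z < 1 →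
      u x ≤ u y + K * ‖y - x‖ := by
  have hz : inner ℝ (-z) z < ‖-z‖ := by
    simp [hu.norm_pole]
  obtain ⟨K, t, ht, hK⟩ :=
    ((hu.smooth _ hz).of_le (by norm_num : (1 : WithTop ℕ∞) ≤ 2)).exists_lipschitzOnWith
  obtain ⟨ρ, hρ, hball⟩ := Metric.mem_nhds_iff.1 ht
  have hM : 0 < u (-z) := hu.pos (by simpa using hu.norm_pole) (by simp [hu.norm_pole])
  have hdist : ∀ x, ‖x + z‖ = dist x (-z) := fun x => by rw [dist_eq_norm, sub_neg_eq_add]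
  refine ⟨K + (u (-z) + K * ρ) / (ρ / 2), ρ / 2, by positivity, by positivity,
    fun x hx hxz y hy hyz => ?_⟩
  have hxt : x ∈ t := hball (by rw [mem_ball, ← hdist]; linarith)
  have hzt : -z ∈ t := hball (mem_ball_self hρ)
  have hdiv : 0 ≤ (u (-z) + K * ρ) / (ρ / 2) := by positivity
  by_cases hyt : ‖y + z‖ < ρ
  · have h1 := hK.dist_le_mul _ hxt _ (hball (by rwa [mem_ball, ← hdist]) : y ∈ t)
    rw [Real.dist_eq, dist_comm, dist_eq_norm] at h1
    have h2 := le_abs_self (u x - u y)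
    have h3 := mul_nonneg hdiv (norm_nonneg (y - x))
    linarith
  · have h1 := hK.dist_le_mul _ hxt _ hzt
    rw [Real.dist_eq, ← hdist] at h1
    have h2 := le_abs_self (u x - u (-z))
    have h3 : ρ / 2 ≤ ‖y - x‖ := by
      have := norm_add_le (y - x) (x + z)
      rw [show y - x + (x + z) = y + z by abel] at this
      linarith
    have h4 : (u (-z) + K * ρ) ≤ (u (-z) + K * ρ) / (ρ / 2) * ‖y - x‖ := by
      rw [div_mul_eq_mul_div, le_div_iff₀ (by positivity)]
      exact mul_le_mul_of_nonneg_left h3 (by positivity)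
    have h5 := hu.pos hy hyz
    have h6 : (K : ℝ) * ‖x + z‖ ≤ K * ρ := mul_le_mul_of_nonneg_left (by linarith) K.2
    have h7 := mul_nonneg K.2 (norm_nonneg (y - x))
    have h8 : (K : ℝ) * ‖y - x‖ = K.1 * ‖y - x‖ := rfl
    linarith

lemma exists_le_reflection_of_le (hu : IsConformalSolution z α u g) :
    ∃ τ₀ : ℝ, ∀ τ, τ₀ ≤ τ → ∀ e : EuclideanSpace ℝ (Fin (n + 1)), ‖e‖ ^ 2 = 1 + τ ^ 2 →
      inner ℝ e z < -τ → ∀ x ∈ reflectionDomain z e τ, u x ≤ u (conformalReflection e τ x) := by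
  obtain ⟨K, ρ, hK, hρ, hlip⟩ := hu.exists_sub_le_mul_norm_sub
  obtain ⟨c, hc, hcu⟩ := hu.lower_bound
  refine ⟨1 + 2 / ρ + 2 * K / c, fun τ hτ e he hez x hx => ?_⟩
  have hρ' : 0 < 2 / ρ := by positivity
  have hKc : 0 ≤ 2 * K / c := by positivity
  have hτ0 : 0 < τ := by linarith
  have hτρ : 2 < τ * ρ := by rw [← div_lt_iff₀ hρ]; linarith
  have hτK : 2 * K ≤ τ * c := by rw [← div_le_iff₀ hc]; linarith
  have hT := norm_conformalReflection_pos he hx.1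
  have hT1 := norm_conformalReflection_le_one he hx.1 hτ0.le hx.2.1.le
  have hTeq := norm_conformalReflection_eq he hx.1
  have hnear : ‖x + z‖ < ρ := by
    have h1 : ‖τ • x - e‖ ≤ 1 := by
      rw [norm_conformalReflection he hx.1] at hT1
      exact (sq_le_one_iff₀ (norm_nonneg _)).1 hT1
    have h2 : ‖e + τ • z‖ ≤ 1 := by
      rw [← sq_le_one_iff₀ (norm_nonneg _), norm_add_sq_real, norm_smul, mul_pow, hu.norm_pole, he,
        real_inner_smul_right, Real.norm_eq_abs, sq_abs]
      nlinarith
    have h3 := norm_add_le (τ • x - e) (e + τ • z)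
    rw [show τ • x - e + (e + τ • z) = τ • (x + z) by rw [smul_add]; abel, norm_smul,
      Real.norm_of_nonneg hτ0.le] at h3
    nlinarith
  have hφ := norm_normalize (ne_zero_of_inner_lt_norm hx.2.2)
  have hφz := inner_normalize_lt_one hx.2.2
  have h1 := hlip x hx.1 hnear _ hφ hφz
  have h2 := hcu _ hφ hφz
  have h3 := norm_normalized_conformalReflection_sub he hx.1 hx.2.1.le
  have h4 := hu.apply_eq_norm_rpow_mul (ne_zero_of_inner_lt_norm hx.2.2)
  set T := ‖conformalReflection e τ x‖
  set φ := T⁻¹ • conformalReflection e τ x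
  have h5 : (√T)⁻¹ ≤ T ^ α := by
    rw [Real.sqrt_eq_rpow, ← Real.rpow_neg hT.le]
    exact Real.rpow_le_rpow_of_exponent_ge hT hT1 hu.degree_le
  have hq : 0 < √T := Real.sqrt_pos.2 hT
  have hq1 : √T ≤ 1 := Real.sqrt_le_one.2 hT1
  have hq2 := Real.sq_sqrt hT.le
  have h6 : τ * (‖φ - x‖ * √T) = (1 - √T) * (1 + √T) := by
    rw [h3]; nlinarith
  have h7 : (√T)⁻¹ * u φ ≤ u (conformalReflection e τ x) := by
    rw [h4]; exact mul_le_mul_of_nonneg_right h5 (by linarith)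
  refine le_trans ?_ h7
  rw [← div_eq_inv_mul, le_div_iff₀ hq]
  have h8 : u x * √T ≤ u φ * √T + K * (‖φ - x‖ * √T) := by nlinarith
  have h9 : τ * (K * (‖φ - x‖ * √T)) ≤ τ * ((1 - √T) * u φ) := by
    have e1 : τ * (K * (‖φ - x‖ * √T)) = (1 - √T) * (K * (1 + √T)) := by
      rw [mul_left_comm, h6]; ring
    rw [e1, mul_left_comm τ]
    refine mul_le_mul_of_nonneg_left ?_ (by linarith)
    have := mul_le_mul_of_nonneg_left h2 hτ0.le
    have := mul_le_mul_of_nonneg_left hq1 hK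
    linarith
  have h10 := le_of_mul_le_mul_left h9 hτ0
  linarith

lemma le_reflection_of_orthogonal (hu : IsConformalSolution z α u g)
    {e x : EuclideanSpace ℝ (Fin (n + 1))} (he : ‖e‖ = 1) (hez : inner ℝ e z = 0) (hx : ‖x‖ = 1)
    (hxe : 0 < inner ℝ x e) (hxz : inner ℝ x z < 1) : u x ≤ u (conformalReflection e 0 x) := by
  obtain ⟨τ₀, hτ₀⟩ := hu.exists_le_reflection_of_le
  have hzz : inner ℝ z z = (1 : ℝ) := by rw [real_inner_self_eq_norm_sq, hu.norm_pole]; norm_num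
  have key : ∀ δ : ℝ, 0 < δ → δ ≤ 1 → ∀ x ∈ reflectionDomain z (√(1 - δ ^ 2) • e - δ • z) 0,
      u x ≤ u (conformalReflection (√(1 - δ ^ 2) • e - δ • z) 0 x) := by
    intro δ hδ hδ1
    have hsq : √(1 - δ ^ 2) ^ 2 = 1 - δ ^ 2 := Real.sq_sqrt (by nlinarith)
    have hpath : ∀ τ : ℝ, ‖√(1 - δ ^ 2) • e - √(δ ^ 2 + τ ^ 2) • z‖ ^ 2 = 1 + τ ^ 2 := by
      intro τ
      rw [norm_sub_sq_real, norm_smul, norm_smul, mul_pow, mul_pow, he, hu.norm_pole,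
        real_inner_smul_left, real_inner_smul_right, hez, Real.norm_eq_abs, Real.norm_eq_abs,
        sq_abs, sq_abs, hsq, Real.sq_sqrt (by positivity)]
      ring
    have hpole : ∀ τ : ℝ, 0 ≤ τ →
        inner ℝ (√(1 - δ ^ 2) • e - √(δ ^ 2 + τ ^ 2) • z) z < -τ := by
      intro τ hτ
      rw [inner_sub_left, real_inner_smul_left, real_inner_smul_left, hez, hzz]
      have : τ < √(δ ^ 2 + τ ^ 2) := Real.lt_sqrt_of_sq_lt (by nlinarith)
      linarith
    have := hu.le_reflection_of_path (e := fun τ => √(1 - δ ^ 2) • e - √(δ ^ 2 + τ ^ 2) • z)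
      (by fun_prop) hpath hpole (τ₀ := max τ₀ 0)
      (fun τ hτ x hx => hτ₀ τ (le_of_max_le_left hτ) _ (hpath τ)
        (hpole τ (le_of_max_le_right hτ)) x hx) le_rfl
    simpa [Real.sqrt_sq hδ.le] using this
  have hc : Continuous fun δ : ℝ => √(1 - δ ^ 2) • e - δ • z := by fun_prop
  have hYc : Continuous fun δ : ℝ => conformalReflection (√(1 - δ ^ 2) • e - δ • z) 0 x :=
    continuous_conformalReflection_uncurry.comp
      (hc.prodMk (continuous_const.prodMk continuous_const))
  have hnorm : ‖conformalReflection e 0 x‖ = 1 := by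
    rw [norm_conformalReflection_eq (by rw [he]; norm_num) hx]; ring
  have hYz : inner ℝ (conformalReflection e 0 x) z < ‖conformalReflection e 0 x‖ := by
    rw [hnorm, conformalReflection, inner_sub_left, real_inner_smul_left, hez]
    simpa using hxz
  have hc1 : Continuous fun δ : ℝ => inner ℝ x (√(1 - δ ^ 2) • e - δ • z) := by fun_prop
  have hc2 : Continuous fun δ : ℝ =>
      inner ℝ (conformalReflection (√(1 - δ ^ 2) • e - δ • z) 0 x) z -
      ‖conformalReflection (√(1 - δ ^ 2) • e - δ • z) 0 x‖ := by fun_prop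
  have h1 := (hc1.tendsto 0).eventually_const_lt (u := 0) (by simpa using hxe)
  have h2 := (hc2.tendsto 0).eventually_lt_const (u := 0) (by simpa using hYz)
  have h3 : Tendsto (fun δ : ℝ => u (conformalReflection (√(1 - δ ^ 2) • e - δ • z) 0 x)) (𝓝 0)
      (𝓝 (u (conformalReflection e 0 x))) := by
    refine (hu.continuousAt hYz).tendsto.comp ?_
    have := hYc.tendsto 0
    simpa using this
  refine ge_of_tendsto (h3.mono_left (nhdsWithin_le_nhds (s := Ioi 0))) ?_
  filter_upwards [nhdsWithin_le_nhds h1, nhdsWithin_le_nhds h2, self_mem_nhdsWithin,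
    nhdsWithin_le_nhds (Iio_mem_nhds (zero_lt_one' ℝ))] with δ h1 h2 h3 h4
  exact key δ h3 (le_of_lt h4) x ⟨hx, h1, sub_neg.1 h2⟩

theorem le_of_inner_eq (hu : IsConformalSolution z α u g)
    {x y : EuclideanSpace ℝ (Fin (n + 1))} (hx : ‖x‖ = 1) (hy : ‖y‖ = 1)
    (hxy : inner ℝ x z = inner ℝ y z) (hxz : inner ℝ x z < 1) : u x ≤ u y := by
  by_cases h : x = y
  · rw [h]
  have h0 : 0 < ‖x - y‖ := norm_sub_pos_iff.2 h
  have hin : inner ℝ x (x - y) = ‖x - y‖ ^ 2 / 2 := by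
    rw [norm_sub_sq_real, hx, hy, inner_sub_right, real_inner_self_eq_norm_sq, hx]; ring
  have hin' : inner ℝ x (‖x - y‖⁻¹ • (x - y)) = ‖x - y‖ / 2 := by
    rw [real_inner_smul_right, hin]; field_simp
  have hle := hu.le_reflection_of_orthogonal (e := ‖x - y‖⁻¹ • (x - y))
    (norm_normalize (sub_ne_zero.2 h))
    (by rw [real_inner_smul_left, inner_sub_left, hxy, sub_self, mul_zero]) hx
    (by rw [hin']; positivity) hxz
  have hy' : conformalReflection (‖x - y‖⁻¹ • (x - y)) 0 x = y := by
    rw [conformalReflection, hin', zero_mul, sub_zero, smul_smul,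
      show 2 * (‖x - y‖ / 2) * ‖x - y‖⁻¹ = 1 by field_simp, one_smul, sub_sub_cancel]
  rwa [hy'] at hle

end IsConformalSolution

lemma sphere_diff_singleton_eq {E : Type*} [NormedAddCommGroup E] [InnerProductSpace ℝ E] {z : E}
    (hz : ‖z‖ = 1) : sphere (0 : E) 1 \ {z} = {x | ‖x‖ = 1 ∧ inner ℝ x z < 1} := by
  ext x
  simp only [Set.mem_sdiff, mem_sphere_zero_iff_norm, mem_singleton_iff, mem_ofPred_eq]
  refine and_congr_right fun hx => ?_
  rw [inner_lt_one_iff_real_of_norm_eq_one hx hz]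

lemma isConformalSolution_of_sphLaplacian {n : ℕ} (hn : 3 ≤ n)
    {z : EuclideanSpace ℝ (Fin (n + 1))} (hz : ‖z‖ = 1)
    {g : EuclideanSpace ℝ (Fin (n + 1)) → ℝ → ℝ} {v : EuclideanSpace ℝ (Fin (n + 1)) → ℝ}
    (hg : ContinuousOn (fun q : EuclideanSpace ℝ (Fin (n + 1)) × ℝ => g q.1 q.2)
      ({x | ‖x‖ = 1 ∧ inner ℝ x z < 1} ×ˢ Ioi (0 : ℝ)))
    (hg0 : ∀ x, ‖x‖ = 1 → inner ℝ x z < 1 → ∀ s, 0 < s → 0 ≤ g x s)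
    (hglt : ∀ x y, ‖x‖ = 1 → ‖y‖ = 1 → inner ℝ x z < inner ℝ y z → inner ℝ y z < 1 →
      ∀ s, 0 < s → g x s < g y s)
    (hgsub : ∀ x, ‖x‖ = 1 → inner ℝ x z < 1 → ∀ s t, 0 < s → s ≤ t →
      g x t ≤ (t / s) ^ (((n : ℝ) + 2) / ((n : ℝ) - 2)) * g x s)
    (hv : ContDiffOn ℝ 2 (fun x => v (‖x‖⁻¹ • x)) {x | x ≠ 0 ∧ ‖x‖⁻¹ • x ≠ z})
    (hpos : ∀ x, ‖x‖ = 1 → inner ℝ x z < 1 → 0 < v x)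
    (heq : ∀ x, ‖x‖ = 1 → inner ℝ x z < 1 →
      -(sphLaplacian v x - ((n : ℝ) * ((n : ℝ) - 2) / 4) * v x) = g x (v x))
    (hliminf : ∃ c : ℝ, 0 < c ∧ ∀ᶠ x in 𝓝[{x | ‖x‖ = 1 ∧ inner ℝ x z < 1}] z, c ≤ v x) :
    IsConformalSolution z (-((n : ℝ) - 2) / 2)
      (fun x => ‖x‖ ^ (-((n : ℝ) - 2) / 2) * v (‖x‖⁻¹ • x)) g := by
  have hhom : ∀ x : EuclideanSpace ℝ (Fin (n + 1)), ∀ s : ℝ, 0 < s →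
      v (‖s • x‖⁻¹ • s • x) = v (‖x‖⁻¹ • x) := by
    intro x s hs
    rw [norm_smul, Real.norm_of_nonneg hs.le, smul_smul, mul_inv, mul_right_comm,
      inv_mul_cancel₀ hs.ne', one_mul]
  have hsmooth : ∀ x, inner ℝ x z < ‖x‖ → ContDiffAt ℝ 2 (fun x => v (‖x‖⁻¹ • x)) x := by
    intro x hx
    have hx0 := ne_zero_of_inner_lt_norm hx
    refine hv.contDiffAt ?_
    have h1 : ContinuousAt (fun x : EuclideanSpace ℝ (Fin (n + 1)) => ‖x‖⁻¹ • x) x :=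
      (continuousAt_id.norm.inv₀ (norm_ne_zero_iff.2 hx0)).smul continuousAt_id
    have h2 : ‖x‖⁻¹ • x ≠ z := by
      rw [← inner_lt_one_iff_real_of_norm_eq_one (norm_normalize hx0) hz]
      exact inner_normalize_lt_one hx
    filter_upwards [isOpen_ne.mem_nhds hx0, h1.eventually_ne h2] with y hy1 hy2
    exact ⟨hy1, hy2⟩
  have hvx : ∀ x : EuclideanSpace ℝ (Fin (n + 1)), ‖x‖ = 1 →
      ‖x‖ ^ (-((n : ℝ) - 2) / 2) * v (‖x‖⁻¹ • x) = v x := by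
    intro x hx
    simp [hx]
  refine ⟨hn, rfl, hz, fun x s hs => ?_, fun x hx => ?_, ?_, fun x hx hxz => ?_,
    hg, hg0, hglt, hgsub⟩
  · rw [hhom x s hs, norm_smul, Real.norm_of_nonneg hs.le, Real.mul_rpow hs.le (norm_nonneg _),
      mul_assoc]
  · exact (contDiffAt_norm_rpow _ (ne_zero_of_inner_lt_norm hx)).mul (hsmooth x hx)
  · obtain ⟨c, hc, h⟩ := hliminf
    obtain ⟨U, hU, hzU, hUc⟩ := mem_nhdsWithin.1 h
    have hcomp : IsCompact (sphere (0 : EuclideanSpace ℝ (Fin (n + 1))) 1 \ U) :=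
      (isCompact_sphere _ _).diff hU
    have hmem : ∀ x ∈ sphere (0 : EuclideanSpace ℝ (Fin (n + 1))) 1 \ U,
        ‖x‖ = 1 ∧ inner ℝ x z < 1 := by
      intro x hx
      have hx1 : ‖x‖ = 1 := by simpa using hx.1
      refine ⟨hx1, (inner_lt_one_iff_real_of_norm_eq_one hx1 hz).2 ?_⟩
      rintro rfl
      exact hx.2 hzU
    obtain ⟨c', hc', h'⟩ := hcomp.exists_forall_le' (f := fun x => v (‖x‖⁻¹ • x)) (a := 0)
      (fun x hx =>
        (hsmooth x (by rw [(hmem x hx).1]; exact (hmem x hx).2)).continuousAt.continuousWithinAt)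
      (fun x hx => by
        have := hpos x (hmem x hx).1 (hmem x hx).2
        simpa [(hmem x hx).1] using this)
    refine ⟨min c c', lt_min hc hc', fun x hx hxz => ?_⟩
    rw [hvx x hx]
    by_cases hxU : x ∈ U
    · exact (min_le_left _ _).trans (hUc ⟨hxU, hx, hxz⟩)
    · have := h' x ⟨by simpa using hx, hxU⟩
      simp only [hx, inv_one, one_smul] at this
      exact (min_le_right _ _).trans this
  · rw [eLaplacian_norm_rpow_mul _ hhom (hsmooth x (by rwa [hx])) hx, hvx x hx, ← heq x hx hxz,
      sphLaplacian]
    simp only [hx, inv_one, one_smul]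
    push_cast
    ring

lemma mem_closure_of_inner_lt_one {E : Type*} [NormedAddCommGroup E] [InnerProductSpace ℝ E]
    {z w : E} (hz : ‖z‖ = 1) (hw : ‖w‖ = 1) (hwz : inner ℝ w z = 0) {x : E} (hx : ‖x‖ = 1)
    (hxz : inner ℝ x z < 1) : x ∈ closure {x : E | ‖x‖ = 1 ∧ inner ℝ x z ∈ Ioo (-1) 1} := by
  rcases (neg_one_le_inner_of_norm_eq_one hx hz).lt_or_eq with h | h
  · exact subset_closure ⟨hx, h, hxz⟩
  have hxz' : x = -z := by
    rw [← inner_eq_one_iff_of_norm_eq_one (𝕜 := ℝ) hx (by rwa [norm_neg]), inner_neg_right, ← h,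
      neg_neg]
  have hc : Continuous fun t : ℝ => t • w - √(1 - t ^ 2) • z := by fun_prop
  have ht : Tendsto (fun t : ℝ => t • w - √(1 - t ^ 2) • z) (𝓝[>] 0) (𝓝 x) := by
    simpa [hxz'] using (hc.tendsto 0).mono_left (nhdsWithin_le_nhds (s := Ioi 0))
  refine mem_closure_of_tendsto ht ?_
  filter_upwards [self_mem_nhdsWithin, nhdsWithin_le_nhds (Iio_mem_nhds (zero_lt_one' ℝ))]
    with t ht0 ht1
  have ht0 : 0 < t := ht0
  have ht1 : t < 1 := ht1
  have hs : √(1 - t ^ 2) ^ 2 = 1 - t ^ 2 := Real.sq_sqrt (by nlinarith)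
  have hs0 := Real.sqrt_nonneg (1 - t ^ 2)
  have hin : inner ℝ (t • w - √(1 - t ^ 2) • z) z = -√(1 - t ^ 2) := by
    rw [inner_sub_left, real_inner_smul_left, real_inner_smul_left, hwz, real_inner_self_eq_norm_sq,
      hz]
    ring
  refine ⟨?_, ?_, ?_⟩
  · rw [← sq_eq_sq₀ (norm_nonneg _) zero_le_one, norm_sub_sq_real, norm_smul, norm_smul, mul_pow,
      mul_pow, hz, hw, real_inner_smul_left, real_inner_smul_right, hwz, Real.norm_eq_abs,
      Real.norm_eq_abs, sq_abs, sq_abs, hs]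
    ring
  · rw [hin]; nlinarith
  · rw [hin]; linarith

lemma le_rpow_mul_of_antitoneOn {p : ℝ} {G : ℝ → ℝ}
    (hG : AntitoneOn (fun s : ℝ => s ^ (-p) * G s) (Ioi 0)) {s t : ℝ} (hs : 0 < s) (hst : s ≤ t) :
    G t ≤ (t / s) ^ p * G s := by
  have ht := hs.trans_le hst
  have h := mul_le_mul_of_nonneg_left (hG hs ht hst) (Real.rpow_nonneg ht.le p)
  simp only at h
  rwa [← mul_assoc, ← Real.rpow_add ht, add_neg_cancel, Real.rpow_zero, one_mul, ← mul_assoc,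
    Real.rpow_neg hs.le, ← div_eq_mul_inv, ← Real.div_rpow ht.le hs.le] at h

lemma nonneg_of_antitoneOn_of_monotoneOn {p : ℝ} (hp : 0 < p) {G : ℝ → ℝ}
    (hG : AntitoneOn (fun s : ℝ => s ^ (-p) * G s) (Ioi 0)) (hG' : MonotoneOn G (Ioi 0)) {s : ℝ}
    (hs : 0 < s) : 0 ≤ G s := by
  have h1 := le_rpow_mul_of_antitoneOn hG hs (by linarith : s ≤ 2 * s)
  have h2 : G s ≤ G (2 * s) := hG' hs (by simpa using hs) (by linarith)
  rw [mul_div_cancel_right₀ _ hs.ne'] at h1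
  have h3 : (1 : ℝ) < 2 ^ p := Real.one_lt_rpow (by norm_num) hp
  nlinarith

theorem stmt9 (n : ℕ) (hn : 3 ≤ n)
    -- the unit sphere and the north pole
    (S : Set (EuclideanSpace ℝ (Fin (n + 1))))
    (hS : S = Metric.sphere (0 : EuclideanSpace ℝ (Fin (n + 1))) 1)
    (north : EuclideanSpace ℝ (Fin (n + 1)))
    (hnorth : north = EuclideanSpace.single (Fin.last n) 1)
    (g : EuclideanSpace ℝ (Fin (n + 1)) → ℝ → ℝ)
    -- g continuous on (Sⁿ \ {n}) × (0,∞)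
    (hg_cont : ContinuousOn (fun q : (EuclideanSpace ℝ (Fin (n + 1))) × ℝ => g q.1 q.2)
      ((S \ {north}) ×ˢ Set.Ioi (0 : ℝ)))
    -- g(·,s) is bounded from below on Sⁿ \ {n} for each s > 0
    (hg_bdd : ∀ s : ℝ, 0 < s → ∃ M : ℝ, ∀ θ ∈ S \ {north}, M ≤ g θ s)
    -- (g1)-(g4)
    (hG : ∃ G : ℝ → ℝ → ℝ,
      (∀ θ ∈ S \ {north}, ∀ s : ℝ, 0 < s → g θ s = G (θ (Fin.last n)) s) ∧
      (∀ s : ℝ, 0 < s → StrictMono (fun t => G t s)) ∧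
      (∀ t ∈ Set.Ioo (-1 : ℝ) 1,
        AntitoneOn (fun s : ℝ => s ^ (-(((n : ℝ) + 2) / ((n : ℝ) - 2))) * G t s)
          (Set.Ioi 0)) ∧
      (∀ t ∈ Set.Ioo (-1 : ℝ) 1, MonotoneOn (fun s => G t s) (Set.Ioi 0)))
    (v : EuclideanSpace ℝ (Fin (n + 1)) → ℝ)
    -- v ∈ C²(Sⁿ \ {n}), via its degree-zero homogeneous extension
    (hv : ContDiffOn ℝ 2 (fun x => v (‖x‖⁻¹ • x)) {x | x ≠ 0 ∧ ‖x‖⁻¹ • x ≠ north})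
    (hvpos : ∀ θ ∈ S \ {north}, 0 < v θ)
    -- the equation −L_{Sⁿ} v = g(θ, v)
    (heq : ∀ θ ∈ S \ {north},
      -(sphLaplacian v θ - ((n : ℝ) * ((n : ℝ) - 2) / 4) * v θ) = g θ (v θ))
    -- liminf_{θ → n} v(θ) > 0
    (hliminf : ∃ c : ℝ, 0 < c ∧ ∀ᶠ θ in nhdsWithin north (S \ {north}), c ≤ v θ) :
    -- v is rotationally symmetric about the line through n and s
    ∀ θ ∈ S \ {north}, ∀ θ' ∈ S \ {north},
      θ (Fin.last n) = θ' (Fin.last n) → v θ = v θ' := by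
  subst hS hnorth
  set z : EuclideanSpace ℝ (Fin (n + 1)) := EuclideanSpace.single (Fin.last n) 1 with hzdef
  have hz : ‖z‖ = 1 := by simp [hzdef]
  have hlast : ∀ x : EuclideanSpace ℝ (Fin (n + 1)), x (Fin.last n) = inner ℝ x z := by
    intro x; simp [hzdef, EuclideanSpace.inner_single_right]
  rw [sphere_diff_singleton_eq hz] at *
  obtain ⟨G, hG1, hG2, hG3, hG4⟩ := hG
  have hn' : (3 : ℝ) ≤ n := by exact_mod_cast hn
  have hp : 0 < ((n : ℝ) + 2) / ((n : ℝ) - 2) := div_pos (by linarith) (by linarith)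
  have hclosure := fun (x : EuclideanSpace ℝ (Fin (n + 1))) (hx : ‖x‖ = 1)
      (hxz : inner ℝ x z < 1) =>
    mem_closure_iff_seq_limit.1 (mem_closure_of_inner_lt_one (w := EuclideanSpace.single 0 1) hz
      (by simp) (by
        have : Fin.last n ≠ 0 := by simpa [Fin.ext_iff] using (by omega : n ≠ 0)
        simp [hzdef, EuclideanSpace.inner_single_right, this]) hx hxz)
  have hlim : ∀ x, ‖x‖ = 1 → inner ℝ x z < 1 → ∀ y : ℕ → EuclideanSpace ℝ (Fin (n + 1)),
      (∀ k, ‖y k‖ = 1 ∧ inner ℝ (y k) z ∈ Set.Ioo (-1) 1) → Tendsto y atTop (𝓝 x) →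
      ∀ s, 0 < s → Tendsto (fun k => g (y k) s) atTop (𝓝 (g x s)) := by
    intro x hx hxz y hy hyt s hs
    refine Tendsto.comp (f := fun k => (y k, s)) (hg_cont (x, s) ⟨⟨hx, hxz⟩, hs⟩) ?_
    exact tendsto_nhdsWithin_iff.2 ⟨hyt.prodMk_nhds tendsto_const_nhds,
      Eventually.of_forall fun k => ⟨⟨(hy k).1, (hy k).2.2⟩, hs⟩⟩
  have hu := isConformalSolution_of_sphLaplacian hn hz hg_cont ?_ ?_ ?_ hv
    (fun x hx hxz => hvpos x ⟨hx, hxz⟩) (fun x hx hxz => heq x ⟨hx, hxz⟩) hliminf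
  · intro θ hθ θ' hθ' h
    rw [hlast, hlast] at h
    have h1 := hu.le_of_inner_eq hθ.1 hθ'.1 h hθ.2
    have h2 := hu.le_of_inner_eq hθ'.1 hθ.1 h.symm hθ'.2
    simp only [hθ.1, hθ'.1, inv_one, one_smul, Real.one_rpow, one_mul] at h1 h2
    exact le_antisymm h1 h2
  · intro x hx hxz s hs
    obtain ⟨y, hy, hyt⟩ := hclosure x hx hxz
    refine ge_of_tendsto' (hlim x hx hxz y hy hyt s hs) fun k => ?_
    rw [hG1 _ ⟨(hy k).1, (hy k).2.2⟩ s hs, hlast]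
    exact nonneg_of_antitoneOn_of_monotoneOn hp (hG3 _ (hy k).2) (hG4 _ (hy k).2) hs
  · intro x y hx hy hxy hyz s hs
    rw [hG1 x ⟨hx, hxy.trans hyz⟩ s hs, hG1 y ⟨hy, hyz⟩ s hs, hlast, hlast]
    exact hG2 s hs hxy
  · intro x hx hxz s t hs hst
    obtain ⟨y, hy, hyt⟩ := hclosure x hx hxz
    refine le_of_tendsto_of_tendsto' (hlim x hx hxz y hy hyt t (hs.trans_le hst))
      ((hlim x hx hxz y hy hyt s hs).const_mul _) fun k => ?_
    rw [hG1 _ ⟨(hy k).1, (hy k).2.2⟩ s hs, hG1 _ ⟨(hy k).1, (hy k).2.2⟩ t (hs.trans_le hst), hlast]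
    exact le_rpow_mul_of_antitoneOn (hG3 _ (hy k).2) hs hst
end
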